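/- arXiv:1710.00476 — 2 statements merged into one kernel-verified Lean document; each statement's English description precedes it below -/
import Mathlib

section
/- Let d ≥ 1, 0 < q < ∞, m ∈ ℝ, and μ ∈ ℕ. Suppose s ≤ τ_q := d/min(1,q) − d. Then there exist a symbol a ∈ S^m_{1,1} and a tempered distribution f such that the limit T_a f := lim_{N→∞} Σ_{j=0}^{N} Σ_{k=0}^{N} T_{a_{j,k}} f converges in S′(ℝ^d), the quantity sup_{0≤k≤μ−1} 2^{k(s+m)} ‖Π_k f‖_{L^∞} + sup_{R∈D_μ} (|R|^{−1} ∫_R Σ_{k=μ}^∞ 2^{(s+m)kq} |Π_k f(x)|^q dx)^{1/q} is finite, while sup_{P∈D_μ} (|P|^{−1} ∫_P Σ_{k=μ}^∞ 2^{skq} |Π_k T_a f(x)|^q dx)^{1/q} = ∞. -/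
noncomputable section

open MeasureTheory SchwartzMap Complex RealInnerProductSpace Filter
open scoped ENNReal NNReal ContDiff SchwartzMap

/-- Euclidean space `ℝ^d`. -/
abbrev RD (d : ℕ) : Type := EuclideanSpace ℝ (Fin d)

/-- Tempered distributions on `ℝ^d`. -/
abbrev TD (d : ℕ) : Type := 𝓢(RD d, ℂ) →L[ℂ] ℂ

/-- Fourier transform of a Schwartz function (with the convention
`f̂(ξ) = ∫ f(x) e^{-2πi⟨x,ξ⟩} dx`). -/
def fourierS {d : ℕ} (f : 𝓢(RD d, ℂ)) : 𝓢(RD d, ℂ) :=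
  SchwartzMap.fourierTransformCLM ℂ f

/-- Hörmander symbol class `S^m_{1,1}`: `a` is smooth and
`‖∂_ξ^α ∂_x^β a(x,ξ)‖ ≤ c_{α,β} (1+‖ξ‖)^{m-|α|+|β|}` for all orders of derivatives. -/
def IsSymbolS11 (d : ℕ) (m : ℝ) (a : RD d → RD d → ℂ) : Prop :=
  ContDiff ℝ ∞ (fun p : RD d × RD d => a p.1 p.2) ∧
  ∀ α β : ℕ, ∃ c : ℝ, ∀ x ξ : RD d,
    ‖iteratedFDeriv ℝ α (fun ξ' => iteratedFDeriv ℝ β (fun x' => a x' ξ') x) ξ‖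
      ≤ c * (1 + ‖ξ‖) ^ (m - (α : ℝ) + (β : ℝ))

/-- The pseudo-differential operator `T_a f(x) = ∫ a(x,ξ) f̂(ξ) e^{2πi⟨x,ξ⟩} dξ`
acting on a Schwartz function `f`. -/
def pdo {d : ℕ} (a : RD d → RD d → ℂ) (f : 𝓢(RD d, ℂ)) (x : RD d) : ℂ :=
  ∫ ξ, a x ξ * fourierS f ξ * Complex.exp (2 * Real.pi * Complex.I * ((⟪x, ξ⟫ : ℝ) : ℂ))

/-- Littlewood–Paley data: a Schwartz function `φ` with `φ̂` supported in
`{1/2 ≤ |ξ| ≤ 2}` and `Σ_{k∈ℤ} φ̂(2^{-k}ξ) = 1` for `ξ ≠ 0`, together with the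
low-frequency piece `Φ` determined by `Φ̂ = 1 - Σ_{k≥1} φ̂(2^{-k}·)`. -/
structure LPData (d : ℕ) where
  φ : 𝓢(RD d, ℂ)
  Φ : 𝓢(RD d, ℂ)
  supp_φ : ∀ ξ : RD d, fourierS φ ξ ≠ 0 → 1/2 ≤ ‖ξ‖ ∧ ‖ξ‖ ≤ 2
  sum_φ : ∀ ξ : RD d, ξ ≠ 0 → HasSum (fun k : ℤ => fourierS φ ((2:ℝ)^(-k) • ξ)) 1
  Φ_def : ∀ ξ : RD d, fourierS Φ ξ = 1 - ∑' k : ℕ, fourierS φ (((2:ℝ)^(k+1))⁻¹ • ξ)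

/-- The Littlewood–Paley convolution kernel: `Φ` for `k = 0` and
`φ_k = 2^{kd} φ(2^k ·)` for `k ≥ 1`. -/
def LPkernel {d : ℕ} (D : LPData d) : ℕ → RD d → ℂ
  | 0, x => D.Φ x
  | (k+1), x => (((2:ℝ)^((k+1) * d) : ℝ) : ℂ) * D.φ ((2:ℝ)^(k+1) • x)

/-- The Fourier transform of the `k`-th Littlewood–Paley kernel, i.e. `φ̂_k = φ̂(2^{-k}·)`
for `k ≥ 1` and `Φ̂` for `k = 0`. -/
def LPhat {d : ℕ} (D : LPData d) : ℕ → RD d → ℂ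
  | 0, ξ => fourierS D.Φ ξ
  | (k+1), ξ => fourierS D.φ (((2:ℝ)^(k+1))⁻¹ • ξ)

/-- Littlewood–Paley operator `Π_k g = φ_k ∗ g` (with `φ_0 := Φ`) acting on functions. -/
def LP {d : ℕ} (D : LPData d) (k : ℕ) (g : RD d → ℂ) (x : RD d) : ℂ :=
  ∫ y, LPkernel D k y * g (x - y)

/-- `Π*_k = Π_{k-1} + Π_k + Π_{k+1}` (with the convention `φ_{-1} := 0`). -/
def LPstar {d : ℕ} (D : LPData d) (k : ℕ) (g : RD d → ℂ) (x : RD d) : ℂ :=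
  (if k = 0 then 0 else LP D (k-1) g x) + LP D k g x + LP D (k+1) g x

open Classical in
/-- Pairing of a tempered distribution with a plain function: it gives `u ψ` if the
function is (the coercion of) a Schwartz function `ψ`, and `0` otherwise. -/
def pairing {d : ℕ} (u : TD d) (g : RD d → ℂ) : ℂ :=
  if h : ∃ ψ : 𝓢(RD d, ℂ), ⇑ψ = g then u h.choose else 0

/-- Fourier transform of a tempered distribution, `⟨û, ψ⟩ = ⟨u, ψ̂⟩`. -/
def fourierTD {d : ℕ} (u : TD d) : TD d :=
  u.comp (SchwartzMap.fourierTransformCLM ℂ)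

/-- Littlewood–Paley operator on tempered distributions:
`Π_k u (x) = ⟨u, φ_k(x - ·)⟩`. -/
def LPdist {d : ℕ} (D : LPData d) (k : ℕ) (u : TD d) (x : RD d) : ℂ :=
  pairing u (fun y => LPkernel D k (x - y))

/-- The symbol `a_{j,k}(x,ξ) = (φ_j ∗ a(·,ξ))(x) · φ̂_k(ξ)` (with `Φ` replacing `φ_0`). -/
def symbolPiece {d : ℕ} (D : LPData d) (a : RD d → RD d → ℂ) (j k : ℕ)
    (x ξ : RD d) : ℂ :=
  (∫ y, LPkernel D j y * a (x - y) ξ) * LPhat D k ξ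

/-- `T_{a_{j,k}} u (x) = ⟨û, a_{j,k}(x,·) e^{2πi⟨x,·⟩}⟩` for a tempered distribution `u`. -/
def pdoPieceD {d : ℕ} (D : LPData d) (a : RD d → RD d → ℂ) (j k : ℕ)
    (u : TD d) (x : RD d) : ℂ :=
  pairing (fourierTD u)
    (fun ξ => symbolPiece D a j k x ξ * Complex.exp (2 * Real.pi * Complex.I * ((⟪x, ξ⟫ : ℝ) : ℂ)))

/-- Partial sums `Σ_{j=0}^N Σ_{k=0}^N T_{a_{j,k}} u (x)`. -/
def pdoPartial {d : ℕ} (D : LPData d) (a : RD d → RD d → ℂ) (N : ℕ)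
    (u : TD d) (x : RD d) : ℂ :=
  ∑ j ∈ Finset.range (N+1), ∑ k ∈ Finset.range (N+1), pdoPieceD D a j k u x

/-- `T_a u` converges in `S'` to the tempered distribution `Tf`: the partial sums
`Σ_{j,k≤N} T_{a_{j,k}} u` (which are functions) converge to `Tf` weakly. -/
def ConvergesInSPrime {d : ℕ} (D : LPData d) (a : RD d → RD d → ℂ)
    (u : TD d) (Tf : TD d) : Prop :=
  ∀ ψ : 𝓢(RD d, ℂ),
    Tendsto (fun N => ∫ x, pdoPartial D a N u x * ψ x) atTop (nhds (Tf ψ))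

/-- The dyadic cube of level `ν` (side length `2^{-ν}`) indexed by `n ∈ ℤ^d`. -/
def dyadicCube (d : ℕ) (ν : ℤ) (n : Fin d → ℤ) : Set (RD d) :=
  {x | ∀ i, (n i : ℝ) * (2:ℝ)^(-ν) ≤ x i ∧ x i < ((n i : ℝ) + 1) * (2:ℝ)^(-ν)}

/-- The local quantity `(|P|⁻¹ ∫_P Σ_{k=k₀}^∞ 2^{skq} ‖g_k(x)‖^q dx)^{1/q}` for the
dyadic cube `P` of level `μ` indexed by `n` (so that `|P|⁻¹ = 2^{μd}`). -/
def cubePiece (d : ℕ) (μ : ℕ) (n : Fin d → ℤ) (k₀ : ℕ) (s q : ℝ)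
    (g : ℕ → RD d → ℂ) : ℝ≥0∞ :=
  ((2:ℝ≥0∞)^((μ:ℝ)*(d:ℝ)) *
    ∫⁻ x in dyadicCube d μ n,
      ∑' j : ℕ, (2:ℝ≥0∞)^(s*((k₀:ℝ)+(j:ℝ))*q) * (‖g (k₀+j) x‖₊ : ℝ≥0∞)^q) ^ (1/q)

/-- The `F_∞^{s,q}` norm (for `q < ∞`) of a function, computed from its
Littlewood–Paley pieces:
`‖Π_0 g‖_∞ + sup_{l(P)<1 dyadic} (|P|⁻¹ ∫_P Σ_{k=-log₂ l(P)}^∞ 2^{skq}|Π_k g|^q)^{1/q}`. -/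
def FinftyNormFun {d : ℕ} (D : LPData d) (s q : ℝ) (g : RD d → ℂ) : ℝ≥0∞ :=
  (⨆ x : RD d, (‖LP D 0 g x‖₊ : ℝ≥0∞)) +
  ⨆ (μ : ℕ) (_ : 1 ≤ μ) (n : Fin d → ℤ),
    cubePiece d μ n μ s q (fun k x => LP D k g x)

/-- The `F_∞^{s,q}` norm (for `q < ∞`) of a tempered distribution. -/
def FinftyNormDist {d : ℕ} (D : LPData d) (s q : ℝ) (u : TD d) : ℝ≥0∞ :=
  (⨆ x : RD d, (‖LPdist D 0 u x‖₊ : ℝ≥0∞)) +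
  ⨆ (μ : ℕ) (_ : 1 ≤ μ) (n : Fin d → ℤ),
    cubePiece d μ n μ s q (fun k x => LPdist D k u x)

/-- The (axis-parallel, closed) cube with corner `c` and side length `L`. -/
def cube (d : ℕ) (c : RD d) (L : ℝ) : Set (RD d) :=
  {x | ∀ i, c i ≤ x i ∧ x i ≤ c i + L}

/-- The average of `g` over the cube with corner `c` and side length `L`. -/
def cubeMean {d : ℕ} (c : RD d) (L : ℝ) (g : RD d → ℂ) : ℂ :=
  (L^d)⁻¹ • ∫ x in cube d c L, g x

/-- The `bmo` norm (local BMO):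
`sup_{l(Q)≥1} |Q|⁻¹∫_Q |g| + sup_{l(Q)<1} |Q|⁻¹∫_Q |g - g_Q|`, over all cubes `Q`. -/
def bmoNorm (d : ℕ) (g : RD d → ℂ) : ℝ≥0∞ :=
  (⨆ (c : RD d) (L : ℝ) (_ : 1 ≤ L),
    ENNReal.ofReal ((L^d)⁻¹) * ∫⁻ x in cube d c L, (‖g x‖₊ : ℝ≥0∞)) +
  (⨆ (c : RD d) (L : ℝ) (_ : 0 < L) (_ : L < 1),
    ENNReal.ofReal ((L^d)⁻¹) * ∫⁻ x in cube d c L, (‖g x - cubeMean c L g‖₊ : ℝ≥0∞))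

/-- The Peetre maximal function `𝔐_{σ,R} g(x) = sup_y ‖g(x-y)‖/(1+R‖y‖)^σ`. -/
def peetre {d : ℕ} (σ R : ℝ) (g : RD d → ℂ) (x : RD d) : ℝ≥0∞ :=
  ⨆ y : RD d, (‖g (x - y)‖₊ : ℝ≥0∞) / ENNReal.ofReal ((1 + R * ‖y‖) ^ σ)

/-- `g` has (distributional) Fourier support contained in `K`: the pairing
`⟨ĝ, ψ⟩ = ∫ g · ψ̂` vanishes for every Schwartz `ψ` whose support does not meet `K`. -/
def HasFourierSupportIn {d : ℕ} (g : RD d → ℂ) (K : Set (RD d)) : Prop :=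
  ∀ ψ : 𝓢(RD d, ℂ), tsupport ⇑ψ ∩ K = ∅ → ∫ x, g x * fourierS ψ x = 0

section

/-! ### Characters and the Fourier transform -/

/-- The character `t ↦ e^{2πit}`. -/
def expChar (t : ℝ) : ℂ := Complex.exp (2 * Real.pi * Complex.I * (t : ℂ))

lemma expChar_add (s t : ℝ) : expChar (s + t) = expChar s * expChar t := by
  rw [expChar, expChar, expChar, ← Complex.exp_add]
  push_cast
  ring_nf

lemma expChar_zero : expChar 0 = 1 := by simp [expChar]

lemma expChar_neg_mul_self (t : ℝ) : expChar (-t) * expChar t = 1 := by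
  rw [← expChar_add, neg_add_cancel, expChar_zero]

lemma norm_expChar (t : ℝ) : ‖expChar t‖ = 1 := by
  have : (2 * Real.pi * Complex.I * (t : ℂ)) = ((2 * Real.pi * t : ℝ) : ℂ) * Complex.I := by
    push_cast; ring
  rw [expChar, this, Complex.norm_exp_ofReal_mul_I]

lemma contDiff_expChar : ContDiff ℝ ∞ expChar := by
  unfold expChar
  exact (contDiff_const.mul Complex.ofRealCLM.contDiff).cexp

lemma continuous_expChar : Continuous expChar := contDiff_expChar.continuous

lemma norm_iteratedFDeriv_expChar (n : ℕ) (t : ℝ) :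
    ‖iteratedFDeriv ℝ n expChar t‖ = (2 * Real.pi) ^ n := by
  have key : ∀ n : ℕ, iteratedDeriv n expChar
      = fun t => (2 * Real.pi * Complex.I) ^ n * expChar t := by
    intro n
    induction n with
    | zero => ext t; simp
    | succ n ih =>
      rw [iteratedDeriv_succ, ih]
      ext t
      have h1 : HasDerivAt expChar (expChar t * (2 * Real.pi * Complex.I * 1)) t := by
        have h := (Complex.ofRealCLM.hasDerivAt (x := t)).const_mul (2 * Real.pi * Complex.I)
        simpa [expChar] using! h.cexp
      rw [(h1.const_mul _).deriv]
      ring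
  rw [norm_iteratedFDeriv_eq_norm_iteratedDeriv, key]
  simp [norm_expChar, abs_of_pos Real.pi_pos]

variable {d : ℕ}

lemma fourierS_eq (f : 𝓢(RD d, ℂ)) (ξ : RD d) :
    fourierS f ξ = ∫ x, expChar (-⟪x, ξ⟫) * f x := by
  change FourierTransform.fourier (f : RD d → ℂ) ξ = _
  rw [Real.fourier_eq']
  congr 1
  ext x
  rw [smul_eq_mul, expChar]
  congr 2
  push_cast
  ring

/-- Inverse Fourier transform of a Schwartz function. -/
def fourierInvS (f : 𝓢(RD d, ℂ)) : 𝓢(RD d, ℂ) := FourierTransformInv.fourierInv f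

lemma fourierInvS_eq (f : 𝓢(RD d, ℂ)) (x : RD d) :
    fourierInvS f x = ∫ ξ, expChar ⟪x, ξ⟫ * f ξ := by
  rw [fourierInvS, SchwartzMap.fourierInv_coe, Real.fourierInv_eq']
  congr 1
  ext ξ
  rw [smul_eq_mul, expChar, real_inner_comm]
  congr 2
  push_cast
  ring

lemma fourierS_fourierInvS (f : 𝓢(RD d, ℂ)) : fourierS (fourierInvS f) = f := by
  change FourierTransform.fourier (FourierTransformInv.fourierInv f) = f
  exact FourierTransform.fourier_fourierInv_eq f

lemma fourierInvS_fourierS (f : 𝓢(RD d, ℂ)) : fourierInvS (fourierS f) = f := by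
  change FourierTransformInv.fourierInv (FourierTransform.fourier f) = f
  exact FourierTransform.fourierInv_fourier_eq f

lemma integral_fourierS_mul (f g : 𝓢(RD d, ℂ)) :
    ∫ ξ, fourierS f ξ * g ξ = ∫ x, f x * fourierS g x :=
  SchwartzMap.integral_fourier_mul_eq f g

/-- The reflected, dilated and translated kernel `y ↦ Λ^d η(Λ(x-y))` as a Schwartz function. -/
def kernelS (η : 𝓢(RD d, ℂ)) (Λ : ℝ) (hΛ : Λ ≠ 0) (x : RD d) : 𝓢(RD d, ℂ) :=
  ((Λ ^ d : ℝ) : ℂ) • SchwartzMap.compSubConstCLM ℂ x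
    (SchwartzMap.compCLMOfContinuousLinearEquiv ℂ
      (ContinuousLinearEquiv.smulLeft (Units.mk0 (-Λ) (neg_ne_zero.2 hΛ)) : RD d ≃L[ℝ] RD d) η)

lemma kernelS_apply (η : 𝓢(RD d, ℂ)) (Λ : ℝ) (hΛ : Λ ≠ 0) (x y : RD d) :
    kernelS η Λ hΛ x y = ((Λ ^ d : ℝ) : ℂ) * η (Λ • (x - y)) := by
  have : (-Λ) • (y - x) = Λ • (x - y) := by rw [neg_smul, ← smul_neg, neg_sub]
  simp [kernelS, Units.smul_def, ← this]

lemma integral_dilate (f : RD d → ℂ) {Λ : ℝ} (hΛ : 0 < Λ) :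
    ∫ y, ((Λ ^ d : ℝ) : ℂ) * f (Λ • y) = ∫ y, f y := by
  rw [integral_const_mul, Measure.integral_comp_smul_of_nonneg volume f Λ (hR := hΛ.le),
    finrank_euclideanSpace_fin, Complex.real_smul, ← mul_assoc, ← Complex.ofReal_mul,
    mul_inv_cancel₀ (by positivity), Complex.ofReal_one, one_mul]

lemma fourierInvS_kernelS (η : 𝓢(RD d, ℂ)) {Λ : ℝ} (hΛ : 0 < Λ) (x ξ : RD d) :
    fourierInvS (kernelS η Λ hΛ.ne' x) ξ = fourierS η (Λ⁻¹ • ξ) * expChar ⟪x, ξ⟫ := by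
  rw [fourierInvS_eq, fourierS_eq, ← integral_sub_left_eq_self _ _ x]
  have : ∀ z : RD d, expChar ⟪ξ, x - z⟫ * kernelS η Λ hΛ.ne' x (x - z)
      = expChar ⟪x, ξ⟫ * (((Λ ^ d : ℝ) : ℂ) *
        (fun w => expChar (-⟪w, Λ⁻¹ • ξ⟫) * η w) (Λ • z)) := by
    intro z
    have h1 : (⟪Λ • z, Λ⁻¹ • ξ⟫ : ℝ) = ⟪z, ξ⟫ := by
      rw [real_inner_smul_left, real_inner_smul_right, ← mul_assoc, mul_inv_cancel₀ hΛ.ne', one_mul]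
    simp only [h1]
    rw [kernelS_apply, sub_sub_cancel, inner_sub_right, sub_eq_add_neg, expChar_add,
      real_inner_comm x ξ, real_inner_comm z ξ]
    ring
  rw [integral_congr_ae (.of_forall this), integral_const_mul,
    integral_dilate (fun w => expChar (-⟪w, Λ⁻¹ • ξ⟫) * η w) hΛ, mul_comm]

lemma fourierS_kernelS (η : 𝓢(RD d, ℂ)) {Λ : ℝ} (hΛ : 0 < Λ) (ξ : RD d) :
    ∫ y, ((Λ ^ d : ℝ) : ℂ) * η (Λ • y) * expChar (-⟪y, ξ⟫) = fourierS η (Λ⁻¹ • ξ) := by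
  rw [fourierS_eq, ← integral_dilate (fun x => expChar (-⟪x, Λ⁻¹ • ξ⟫) * η x) hΛ]
  congr 1
  ext y
  rw [real_inner_smul_left, real_inner_smul_right, mul_inv_cancel_left₀ hΛ.ne']
  ring

/-- Convolution with a dilated kernel, computed on the Fourier side. -/
lemma integral_mul_kernelS (U η : 𝓢(RD d, ℂ)) {Λ : ℝ} (hΛ : 0 < Λ) (x : RD d) :
    ∫ y, U y * kernelS η Λ hΛ.ne' x y
      = ∫ ξ, fourierS U ξ * (fourierS η (Λ⁻¹ • ξ) * expChar ⟪x, ξ⟫) := by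
  have h := integral_fourierS_mul U (fourierInvS (kernelS η Λ hΛ.ne' x))
  rw [fourierS_fourierInvS] at h
  rw [← h]
  congr 1
  ext ξ
  rw [fourierInvS_kernelS η hΛ x ξ]

/-! ### Littlewood–Paley kernels -/

/-- The mother function of the `k`-th Littlewood–Paley kernel. -/
def LPbase (D : LPData d) : ℕ → 𝓢(RD d, ℂ)
  | 0 => D.Φ
  | (_ + 1) => D.φ

lemma LPkernel_eq (D : LPData d) (k : ℕ) (y : RD d) :
    LPkernel D k y = ((((2 : ℝ) ^ k) ^ d : ℝ) : ℂ) * LPbase D k ((2 : ℝ) ^ k • y) := by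
  cases k with
  | zero => simp [LPkernel, LPbase]
  | succ k => simp only [LPkernel, LPbase, pow_mul]

lemma LPhat_eq (D : LPData d) (k : ℕ) (ξ : RD d) :
    LPhat D k ξ = fourierS (LPbase D k) (((2 : ℝ) ^ k)⁻¹ • ξ) := by
  cases k with
  | zero => simp [LPhat, LPbase]
  | succ k => simp only [LPhat, LPbase]

lemma pairing_coe (u : TD d) (ψ : 𝓢(RD d, ℂ)) : pairing u ψ = u ψ := by
  have h : ∃ ψ' : 𝓢(RD d, ℂ), ⇑ψ' = ψ := ⟨ψ, rfl⟩
  rw [show pairing u ψ = u h.choose from dif_pos h]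
  congr 1
  exact DFunLike.coe_injective h.choose_spec

lemma pairing_of_eq (u : TD d) (ψ : 𝓢(RD d, ℂ)) (g : RD d → ℂ) (h : ∀ y, ψ y = g y) :
    pairing u g = u ψ := by
  rw [← pairing_coe u ψ, funext h]

lemma two_pow_ne (k : ℕ) : (2 : ℝ) ^ k ≠ 0 := by positivity

/-- The Littlewood–Paley kernel `y ↦ φ_k(x-y)` as a Schwartz function. -/
def LPkernelS (D : LPData d) (k : ℕ) (x : RD d) : 𝓢(RD d, ℂ) :=
  kernelS (LPbase D k) ((2 : ℝ) ^ k) (two_pow_ne k) x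

lemma LPdist_eq (D : LPData d) (k : ℕ) (u : TD d) (x : RD d) :
    LPdist D k u x = u (LPkernelS D k x) := by
  refine pairing_of_eq _ _ _ fun y => ?_
  rw [LPkernelS, kernelS_apply, LPkernel_eq]

lemma integral_LPkernel_mul_expChar (D : LPData d) (k : ℕ) (ξ : RD d) :
    ∫ y, LPkernel D k y * expChar (-⟪y, ξ⟫) = LPhat D k ξ := by
  simp_rw [LPhat_eq, LPkernel_eq]
  exact fourierS_kernelS _ (by positivity) ξ

lemma integral_mul_LPkernelS (D : LPData d) (U : 𝓢(RD d, ℂ)) (k : ℕ) (x : RD d) :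
    ∫ y, U y * LPkernelS D k x y = ∫ ξ, fourierS U ξ * (LPhat D k ξ * expChar ⟪x, ξ⟫) := by
  simp_rw [LPhat_eq]
  exact integral_mul_kernelS U _ (by positivity) x

lemma fourierS_φ_zero (D : LPData d) : fourierS D.φ 0 = 0 := by
  by_contra h
  have := (D.supp_φ 0 h).1
  norm_num at this

lemma summable_fourierS_φ (D : LPData d) (ξ : RD d) :
    Summable fun k : ℕ => fourierS D.φ (((2 : ℝ) ^ (k + 1))⁻¹ • ξ) := by
  by_cases hξ : ξ = 0
  · simp [hξ, fourierS_φ_zero, summable_zero]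
  · have h := (D.sum_φ ξ hξ).summable.comp_injective
      (i := fun k : ℕ => ((k : ℤ) + 1)) (fun a b h => by simpa using h)
    refine h.congr fun k => ?_
    simp only [Function.comp_apply, zpow_neg]
    norm_cast

lemma sum_LPhat (D : LPData d) (N : ℕ) (ξ : RD d) :
    ∑ k ∈ Finset.range (N + 1), LPhat D k ξ = fourierS D.Φ (((2 : ℝ) ^ N)⁻¹ • ξ) := by
  have h := (summable_fourierS_φ D ξ).sum_add_tsum_nat_add N
  rw [Finset.sum_range_succ']
  simp only [LPhat]
  rw [D.Φ_def ξ, D.Φ_def, ← h]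
  have : ∀ k : ℕ, ((2 : ℝ) ^ (k + 1))⁻¹ • ((2 : ℝ) ^ N)⁻¹ • ξ = ((2 : ℝ) ^ (k + N + 1))⁻¹ • ξ := by
    intro k
    rw [smul_smul, ← mul_inv, ← pow_add]
    congr 3
    omega
  simp_rw [this]
  ring

lemma fourierS_Φ_eq_one (D : LPData d) {ξ : RD d} (hξ : ‖ξ‖ < 1) : fourierS D.Φ ξ = 1 := by
  have : ∀ k : ℕ, fourierS D.φ (((2 : ℝ) ^ (k + 1))⁻¹ • ξ) = 0 := by
    intro k
    by_contra h
    have h1 := (D.supp_φ _ h).1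
    rw [norm_smul, norm_inv, norm_pow, Real.norm_ofNat] at h1
    have h2 : (2 : ℝ) ≤ 2 ^ (k + 1) := by
      rw [pow_succ]; nlinarith [one_le_pow₀ (one_le_two (α := ℝ)) (n := k)]
    have h3 : ((2 : ℝ) ^ (k + 1))⁻¹ ≤ 2⁻¹ := inv_anti₀ (by norm_num) h2
    nlinarith [norm_nonneg ξ]
  rw [D.Φ_def]
  simp [this]

lemma fourierS_Φ_eq_zero (D : LPData d) {ξ : RD d} (hξ : 2 < ‖ξ‖) : fourierS D.Φ ξ = 0 := by
  have h0 : ξ ≠ 0 := by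
    rintro rfl
    norm_num at hξ
  have hinj : Function.Injective (fun k : ℕ => ((k : ℤ) + 1)) := fun a b h => by simpa using h
  have h := (hinj.hasSum_iff (f := fun k : ℤ => fourierS D.φ ((2 : ℝ) ^ (-k) • ξ)) (a := 1) ?_).2
    (D.sum_φ ξ h0)
  · have h2 : ∀ k : ℕ, fourierS D.φ (((2 : ℝ) ^ (k + 1))⁻¹ • ξ)
        = ((fun k : ℤ => fourierS D.φ ((2 : ℝ) ^ (-k) • ξ)) ∘ fun k : ℕ => ((k : ℤ) + 1)) k := by
      intro k
      simp only [Function.comp_apply, zpow_neg]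
      norm_cast
    rw [D.Φ_def, tsum_congr h2, h.tsum_eq, sub_self]
  · intro k hk
    by_contra hne
    have h1 := (D.supp_φ _ hne).2
    have hk' : k ≤ 0 := by
      by_contra hpos
      exact hk ⟨(k - 1).toNat, by simp only; omega⟩
    have h3 : (1 : ℝ) ≤ (2 : ℝ) ^ (-k) := one_le_zpow₀ (by norm_num) (by omega)
    rw [norm_smul, norm_zpow, Real.norm_ofNat] at h1
    nlinarith

lemma norm_le_of_LPhat_ne_zero (D : LPData d) {k : ℕ} {ξ : RD d} (h : LPhat D k ξ ≠ 0) :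
    ‖ξ‖ ≤ 2 ^ (k + 1) := by
  cases k with
  | zero =>
    by_contra h'
    exact h (fourierS_Φ_eq_zero D (by simpa using h'))
  | succ k =>
    have h1 := (D.supp_φ _ h).2
    rw [norm_smul, norm_inv, norm_pow, Real.norm_ofNat, inv_mul_le_iff₀ (by positivity)] at h1
    exact h1.trans_eq (by ring)

lemma le_norm_of_LPhat_ne_zero (D : LPData d) {k : ℕ} {ξ : RD d} (h : LPhat D (k + 1) ξ ≠ 0) :
    2 ^ k ≤ ‖ξ‖ := by
  have h1 := (D.supp_φ _ h).1
  rw [norm_smul, norm_inv, norm_pow, Real.norm_ofNat, le_inv_mul_iff₀ (by positivity)] at h1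
  exact h1.trans_eq' (by ring)

lemma contDiff_LPhat (D : LPData d) (k : ℕ) : ContDiff ℝ ∞ (LPhat D k) := by
  have : LPhat D k = fun ξ => fourierS (LPbase D k) (((2 : ℝ) ^ k)⁻¹ • ξ) :=
    funext (LPhat_eq D k)
  rw [this]
  exact ((fourierS (LPbase D k)).smooth ⊤).comp (contDiff_const_smul _)

lemma hasCompactSupport_LPhat (D : LPData d) (k : ℕ) : HasCompactSupport (LPhat D k) := by
  refine HasCompactSupport.intro (isCompact_closedBall (0 : RD d) (2 ^ (k + 1))) fun ξ hξ => ?_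
  by_contra h
  exact hξ (by simpa using norm_le_of_LPhat_ne_zero D h)

lemma exists_φ_ne_zero (hd : 1 ≤ d) (D : LPData d) : ∃ y : RD d, D.φ y ≠ 0 := by
  by_contra! h
  have h0 : D.φ = 0 := by ext y; exact h y
  have h1 := D.sum_φ (EuclideanSpace.single ⟨0, hd⟩ 1) (by
    intro h; simpa using congrArg (fun v : RD d => v ⟨0, hd⟩) h)
  have h2 : fourierS D.φ = 0 := by rw [h0]; exact map_zero _
  simp only [h2, zero_apply] at h1
  exact one_ne_zero (h1.unique hasSum_zero)

end

/-! ### Polynomially decaying weights -/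

section

variable {d : ℕ}

lemma one_add_mul_norm_le_mul {lam : ℝ} (hl : 0 ≤ lam) (x y z : RD d) :
    1 + lam * ‖x - z‖ ≤ (1 + lam * ‖x - y‖) * (1 + lam * ‖y - z‖) := by
  have h : ‖x - z‖ ≤ ‖x - y‖ + ‖y - z‖ := norm_sub_le_norm_sub_add_norm_sub x y z
  have h2 : 0 ≤ (lam * ‖x - y‖) * (lam * ‖y - z‖) := by positivity
  nlinarith [mul_le_mul_of_nonneg_left h hl]

lemma integrable_norm_mul_one_add_norm_pow (η : 𝓢(RD d, ℂ)) (M : ℕ) :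
    Integrable fun w => ‖η w‖ * (1 + ‖w‖) ^ M := by
  have h1 : Integrable fun w : RD d => 2 ^ (M - 1) * (‖w‖ ^ 0 * ‖η w‖ + ‖w‖ ^ M * ‖η w‖) :=
    ((η.integrable_pow_mul volume 0).add (η.integrable_pow_mul volume M)).const_mul _
  refine h1.mono' (by fun_prop) (.of_forall fun w => ?_)
  rw [Real.norm_of_nonneg (by positivity)]
  have := add_pow_le zero_le_one (norm_nonneg w) M
  rw [one_pow] at this
  calc ‖η w‖ * (1 + ‖w‖) ^ M ≤ ‖η w‖ * (2 ^ (M - 1) * (1 + ‖w‖ ^ M)) := by gcongr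
    _ = _ := by ring

/-- Averaging against an `L¹`-normalised kernel at scale `Λ⁻¹` preserves decay at any coarser
scale. -/
lemma exists_norm_integral_mul_kernelS_le (η : 𝓢(RD d, ℂ)) (M : ℕ) :
    ∃ K : ℝ, 0 ≤ K ∧ ∀ (Λ lam : ℝ) (hΛ : 0 < Λ), 0 ≤ lam → lam ≤ 2 * Λ →
      ∀ (A : ℝ) (x₀ : RD d) (G : RD d → ℂ), 0 ≤ A →
      (∀ z, ‖G z‖ ≤ A * ((1 + lam * ‖z - x₀‖) ^ M)⁻¹) →
      ∀ x, ‖∫ y, G y * kernelS η Λ hΛ.ne' x y‖ ≤ K * A * ((1 + lam * ‖x - x₀‖) ^ M)⁻¹ := by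
  set F : RD d → ℝ := fun w => ‖η w‖ * (1 + ‖w‖) ^ M with hF
  have hFi : Integrable F := integrable_norm_mul_one_add_norm_pow η M
  have hF0 : 0 ≤ ∫ w, F w := integral_nonneg fun w => by positivity
  refine ⟨2 ^ M * ∫ w, F w, by positivity, ?_⟩
  intro Λ lam hΛ hl hlam A x₀ G hA hG x
  set Q : ℝ := ((1 + lam * ‖x - x₀‖) ^ M)⁻¹ with hQ
  have hQ0 : 0 ≤ Q := by positivity
  have hInt : ∫ y, Λ ^ d * F (Λ • (x - y)) = ∫ w, F w := by
    rw [integral_const_mul, integral_sub_left_eq_self (fun y => F (Λ • y)) volume x,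
      Measure.integral_comp_smul_of_nonneg volume F Λ (hR := hΛ.le), finrank_euclideanSpace_fin,
      smul_eq_mul, mul_inv_cancel_left₀ (by positivity)]
  have hi : Integrable fun y => Λ ^ d * F (Λ • (x - y)) :=
    ((hFi.comp_smul hΛ.ne').comp_sub_left x).const_mul _
  have key : ∀ y, ‖G y * kernelS η Λ hΛ.ne' x y‖
      ≤ (A * 2 ^ M * Q) * (Λ ^ d * F (Λ • (x - y))) := by
    intro y
    rw [norm_mul, kernelS_apply, norm_mul, Complex.norm_real, Real.norm_of_nonneg (by positivity)]
    have h1 : 1 + lam * ‖x - x₀‖ ≤ 2 * (1 + ‖Λ • (x - y)‖) * (1 + lam * ‖y - x₀‖) := by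
      refine (one_add_mul_norm_le_mul hl x y x₀).trans ?_
      gcongr
      rw [norm_smul, Real.norm_of_nonneg hΛ.le]
      nlinarith [norm_nonneg (x - y)]
    have h2 : ((1 + lam * ‖y - x₀‖) ^ M)⁻¹ ≤ 2 ^ M * (1 + ‖Λ • (x - y)‖) ^ M * Q := by
      rw [hQ, ← mul_pow, ← div_eq_mul_inv, le_div_iff₀ (by positivity),
        inv_mul_le_iff₀ (by positivity), ← mul_pow]
      gcongr
      linarith
    calc ‖G y‖ * (Λ ^ d * ‖η (Λ • (x - y))‖)
        ≤ (A * (2 ^ M * (1 + ‖Λ • (x - y)‖) ^ M * Q)) * (Λ ^ d * ‖η (Λ • (x - y))‖) := by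
          gcongr
          exact (hG y).trans (by gcongr)
      _ = _ := by rw [hF]; ring
  refine (norm_integral_le_of_norm_le (hi.const_mul _) (.of_forall key)).trans_eq ?_
  rw [integral_const_mul, hInt]
  ring

/-! ### Wave packets -/

/-- A smooth cut-off equal to `1` on `B(0,1/16)` and supported in `B(0,1/8)`. -/
def freqBump (d : ℕ) : ContDiffBump (0 : RD d) := ⟨1 / 16, 1 / 8, by norm_num, by norm_num⟩

lemma freqBump_eq_one {ξ : RD d} (h : ‖ξ‖ ≤ 1 / 16) : freqBump d ξ = 1 :=
  (freqBump d).one_of_mem_closedBall (by simpa [freqBump] using h)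

lemma freqBump_eq_zero {ξ : RD d} (h : 1 / 8 ≤ ‖ξ‖) : freqBump d ξ = 0 :=
  (freqBump d).zero_of_le_dist (by simpa [freqBump] using h)

/-- The Fourier transform of a wave packet. -/
def packetHatFun (c : ℂ) (r : ℕ) (x₀ v ξ : RD d) : ℂ :=
  c * (expChar (-⟪x₀, ξ - v⟫) * (freqBump d (((2 : ℝ) ^ r)⁻¹ • (ξ - v)) : ℂ))

lemma packetHatFun_eq_zero (c : ℂ) (r : ℕ) (x₀ v : RD d) {ξ : RD d}
    (h : 2 ^ r / 8 ≤ ‖ξ - v‖) : packetHatFun c r x₀ v ξ = 0 := by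
  rw [packetHatFun, freqBump_eq_zero]
  · simp
  · rw [norm_smul, norm_inv, norm_pow, Real.norm_ofNat, le_inv_mul_iff₀ (by positivity)]
    linarith

lemma contDiff_packetHatFun (c : ℂ) (r : ℕ) (x₀ v : RD d) :
    ContDiff ℝ ∞ (packetHatFun c r x₀ v) := by
  have h1 : ContDiff ℝ ∞ fun ξ : RD d => (-⟪x₀, ξ - v⟫ : ℝ) :=
    (contDiff_const.inner ℝ (contDiff_id.sub contDiff_const)).neg
  have h2 : ContDiff ℝ ∞ fun ξ : RD d => ((2 : ℝ) ^ r)⁻¹ • (ξ - v) :=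
    (contDiff_id.sub contDiff_const).const_smul _
  exact contDiff_const.mul ((contDiff_expChar.comp h1).mul
    (Complex.ofRealCLM.contDiff.comp ((freqBump d).contDiff.comp h2)))

lemma hasCompactSupport_packetHatFun (c : ℂ) (r : ℕ) (x₀ v : RD d) :
    HasCompactSupport (packetHatFun c r x₀ v) := by
  refine HasCompactSupport.intro (isCompact_closedBall v (2 ^ r / 8)) fun ξ hξ => ?_
  refine packetHatFun_eq_zero c r x₀ v ?_
  rw [Metric.mem_closedBall, dist_eq_norm, not_le] at hξ
  exact hξ.le

/-- `packetHatFun` as a Schwartz function. -/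
def packetHat (c : ℂ) (r : ℕ) (x₀ v : RD d) : 𝓢(RD d, ℂ) :=
  (hasCompactSupport_packetHatFun c r x₀ v).toSchwartzMap (contDiff_packetHatFun c r x₀ v)

/-- The wave packet with amplitude `c`, located at `x₀` at scale `2^{-r}`, with frequency `v`. -/
def packet (c : ℂ) (r : ℕ) (x₀ v : RD d) : 𝓢(RD d, ℂ) := fourierInvS (packetHat c r x₀ v)

lemma fourierS_packet (c : ℂ) (r : ℕ) (x₀ v ξ : RD d) :
    fourierS (packet c r x₀ v) ξ = packetHatFun c r x₀ v ξ := by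
  rw [packet, fourierS_fourierInvS]
  rfl

lemma packet_apply (c : ℂ) (r : ℕ) (x₀ v x : RD d) :
    packet c r x₀ v x = c * (expChar ⟪x, v⟫ * ((((2 : ℝ) ^ r) ^ d : ℝ) *
      packet 1 0 0 0 ((2 : ℝ) ^ r • (x - x₀)))) := by
  have hr : (0 : ℝ) < 2 ^ r := by positivity
  have h2 : ((((2 : ℝ) ^ r) ^ d : ℝ) : ℂ) * (((((2 : ℝ) ^ r)⁻¹) ^ d : ℝ) : ℂ) = 1 := by
    rw [← Complex.ofReal_mul, ← mul_pow, mul_inv_cancel₀ hr.ne', one_pow, Complex.ofReal_one]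
  have key : ∀ ξ : RD d, expChar ⟪x, ξ⟫ * packetHatFun c r x₀ v ξ
      = c * (expChar ⟪x, v⟫ * ((((2 : ℝ) ^ r) ^ d : ℝ) * ((((((2 : ℝ) ^ r)⁻¹) ^ d : ℝ) : ℂ) *
        (expChar ⟪(2 : ℝ) ^ r • (x - x₀), ((2 : ℝ) ^ r)⁻¹ • (ξ - v)⟫ *
          packetHatFun 1 0 0 0 (((2 : ℝ) ^ r)⁻¹ • (ξ - v)))))) := by
    intro ξ
    have h1 : (⟪x, ξ⟫ : ℝ) = ⟪x, v⟫ + (⟪x - x₀, ξ - v⟫ + ⟪x₀, ξ - v⟫) := by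
      rw [inner_sub_left, inner_sub_right x]; ring
    have h3 := expChar_neg_mul_self ⟪x₀, ξ - v⟫
    rw [real_inner_smul_left, real_inner_smul_right, mul_inv_cancel_left₀ hr.ne', h1, expChar_add,
      expChar_add]
    simp only [packetHatFun, pow_zero, inv_one, one_smul, sub_zero, inner_zero_left, neg_zero,
      expChar_zero, one_mul]
    generalize (((2 : ℝ) ^ r) ^ d : ℝ) = X at *
    generalize (((2 : ℝ) ^ r)⁻¹ ^ d : ℝ) = Y at *
    generalize ((freqBump d (((2 : ℝ) ^ r)⁻¹ • (ξ - v)) : ℝ) : ℂ) = R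
    generalize expChar ⟪x, v⟫ = a at *
    generalize expChar ⟪x - x₀, ξ - v⟫ = b at *
    generalize expChar ⟪x₀, ξ - v⟫ = e at *
    generalize expChar (-⟪x₀, ξ - v⟫) = e' at *
    linear_combination (-(c * a * b * R)) * h2 + (c * a * b * R) * h3
  have hI : ∫ ξ, expChar ⟪(2 : ℝ) ^ r • (x - x₀), ξ⟫ * packetHatFun 1 0 0 0 ξ
      = ∫ ξ, (((((2 : ℝ) ^ r)⁻¹) ^ d : ℝ) : ℂ) *
        (expChar ⟪(2 : ℝ) ^ r • (x - x₀), ((2 : ℝ) ^ r)⁻¹ • (ξ - v)⟫ *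
          packetHatFun 1 0 0 0 (((2 : ℝ) ^ r)⁻¹ • (ξ - v))) := by
    rw [← integral_dilate (fun ξ => expChar ⟪(2 : ℝ) ^ r • (x - x₀), ξ⟫ *
      packetHatFun 1 0 0 0 ξ) (inv_pos.2 hr)]
    exact (integral_sub_right_eq_self (fun ξ => (((((2 : ℝ) ^ r)⁻¹) ^ d : ℝ) : ℂ) *
        (expChar ⟪(2 : ℝ) ^ r • (x - x₀), ((2 : ℝ) ^ r)⁻¹ • ξ⟫ *
          packetHatFun 1 0 0 0 (((2 : ℝ) ^ r)⁻¹ • ξ))) v).symm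
  have e1 : packet c r x₀ v x = ∫ ξ, expChar ⟪x, ξ⟫ * packetHatFun c r x₀ v ξ :=
    fourierInvS_eq _ _
  have e2 : packet 1 0 0 0 ((2 : ℝ) ^ r • (x - x₀))
      = ∫ ξ, expChar ⟪(2 : ℝ) ^ r • (x - x₀), ξ⟫ * packetHatFun 1 0 0 0 ξ :=
    fourierInvS_eq _ _
  rw [e1, e2, hI, integral_congr_ae (.of_forall key), integral_const_mul, integral_const_mul,
    integral_const_mul]

lemma exists_norm_packet_le (d M : ℕ) : ∃ B : ℝ, 0 ≤ B ∧ ∀ (c : ℂ) (r : ℕ) (x₀ v x : RD d),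
    ‖packet c r x₀ v x‖ ≤ B * (‖c‖ * (2 ^ r) ^ d) * ((1 + 2 ^ r * ‖x - x₀‖) ^ M)⁻¹ := by
  have hb := SchwartzMap.one_add_le_sup_seminorm_apply (𝕜 := ℝ) (m := (M, 0)) le_rfl le_rfl
    (packet 1 0 0 0 : 𝓢(RD d, ℂ))
  set B := (2 ^ M * (Finset.Iic (M, 0)).sup (fun m => SchwartzMap.seminorm ℝ m.1 m.2)
    (packet 1 0 0 0 : 𝓢(RD d, ℂ)) : ℝ) with hB
  have hB0 : 0 ≤ B := by positivity
  refine ⟨B, hB0, fun c r x₀ v x => ?_⟩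
  have h := hb ((2 : ℝ) ^ r • (x - x₀))
  rw [norm_iteratedFDeriv_zero, norm_smul, norm_pow, Real.norm_ofNat] at h
  rw [packet_apply, norm_mul, norm_mul, norm_expChar, one_mul, norm_mul, Complex.norm_real,
    Real.norm_of_nonneg (by positivity), ← div_eq_mul_inv, le_div_iff₀ (by positivity)]
  calc _ = (‖c‖ * (2 ^ r) ^ d) * ((1 + 2 ^ r * ‖x - x₀‖) ^ M *
        ‖(packet 1 0 0 0 : 𝓢(RD d, ℂ)) ((2 : ℝ) ^ r • (x - x₀))‖) := by ring
    _ ≤ (‖c‖ * (2 ^ r) ^ d) * B := by gcongr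
    _ = _ := by ring

/-! ### Tempered distributions given by series -/

lemma exists_hasSum_integral (w : ℕ → RD d → ℂ) (A : ℝ) (N : ℕ) (hA : 0 ≤ A)
    (hc : ∀ i, Continuous (w i))
    (h : ∀ i x, ‖w i x‖ ≤ A * (1 / 2) ^ i * (1 + ‖x‖) ^ N) :
    ∃ u : TD d, ∀ ψ : 𝓢(RD d, ℂ), HasSum (fun i => ∫ x, w i x * ψ x) (u ψ) := by
  have hb : ∀ i (ψ : 𝓢(RD d, ℂ)) x,
      ‖w i x * ψ x‖ ≤ A * (1 / 2) ^ i * (‖ψ x‖ * (1 + ‖x‖) ^ N) := by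
    intro i ψ x
    rw [norm_mul]
    calc _ ≤ (A * (1 / 2) ^ i * (1 + ‖x‖) ^ N) * ‖ψ x‖ := by gcongr; exact h i x
      _ = _ := by ring
  have hInt : ∀ i (ψ : 𝓢(RD d, ℂ)), Integrable fun x => w i x * ψ x := fun i ψ =>
    ((integrable_norm_mul_one_add_norm_pow ψ N).const_mul _).mono'
      ((hc i).mul ψ.continuous).aestronglyMeasurable (.of_forall (hb i ψ))
  have hn : ∀ i (ψ : 𝓢(RD d, ℂ)),
      ‖∫ x, w i x * ψ x‖ ≤ A * (1 / 2) ^ i * ∫ x, ‖ψ x‖ * (1 + ‖x‖) ^ N := by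
    intro i ψ
    refine (norm_integral_le_of_norm_le ((integrable_norm_mul_one_add_norm_pow ψ N).const_mul _)
      (.of_forall (hb i ψ))).trans_eq ?_
    rw [integral_const_mul]
  have hg : HasSum (fun i : ℕ => (1 / 2 : ℝ) ^ i) 2 := hasSum_geometric_two
  have hsum : ∀ ψ : 𝓢(RD d, ℂ), Summable fun i => ∫ x, w i x * ψ x := fun ψ =>
    Summable.of_norm_bounded ((hg.summable.mul_left A).mul_right _) (hn · ψ)
  have hJ : Integrable fun x : RD d => (1 + ‖x‖) ^ (-((d : ℝ) + 1)) :=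
    integrable_one_add_norm (by simp)
  set J : ℝ := ∫ x : RD d, (1 + ‖x‖) ^ (-((d : ℝ) + 1)) with hJdef
  have hJ0 : 0 ≤ J := integral_nonneg fun x => by positivity
  refine ⟨SchwartzMap.mkCLMtoNormedSpace (fun ψ => ∑' i, ∫ x, w i x * ψ x) ?_ ?_ ?_,
    fun ψ => (hsum ψ).hasSum⟩
  · intro f g
    rw [← (hsum f).tsum_add (hsum g)]
    refine tsum_congr fun i => ?_
    rw [← integral_add (hInt i f) (hInt i g)]
    simp [mul_add]
  · intro a f
    rw [smul_eq_mul, ← tsum_mul_left]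
    refine tsum_congr fun i => ?_
    rw [← integral_const_mul]
    simp [mul_left_comm]
  · refine ⟨Finset.Iic (N + d + 1, 0), A * 2 * (2 ^ (N + d + 1) * J), by positivity, fun ψ => ?_⟩
    have hψ := SchwartzMap.one_add_le_sup_seminorm_apply (𝕜 := ℂ) (m := (N + d + 1, 0))
      le_rfl le_rfl ψ
    set S : ℝ := (Finset.Iic (N + d + 1, 0)).sup (schwartzSeminormFamily ℂ (RD d) ℂ) ψ
    have h1 : ∫ x, ‖ψ x‖ * (1 + ‖x‖) ^ N ≤ 2 ^ (N + d + 1) * S * J := by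
      rw [hJdef, ← integral_const_mul]
      refine integral_mono (integrable_norm_mul_one_add_norm_pow ψ N) (hJ.const_mul _) fun x => ?_
      have h2 := hψ x
      rw [norm_iteratedFDeriv_zero] at h2
      have h3 : (1 + ‖x‖) ^ (-((d : ℝ) + 1)) = ((1 + ‖x‖) ^ (d + 1))⁻¹ := by
        rw [Real.rpow_neg (by positivity)]
        norm_cast
      simp only []
      rw [h3, ← div_eq_mul_inv, le_div_iff₀ (by positivity)]
      refine le_trans (le_of_eq ?_) h2
      rw [show N + d + 1 = N + (d + 1) by ring, pow_add]
      ring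
    calc ‖∑' i, ∫ x, w i x * ψ x‖
        ≤ A * 2 * ∫ x, ‖ψ x‖ * (1 + ‖x‖) ^ N :=
          tsum_of_norm_bounded ((hg.mul_left A).mul_right _) (hn · ψ)
      _ ≤ A * 2 * (2 ^ (N + d + 1) * S * J) := by gcongr
      _ = A * 2 * (2 ^ (N + d + 1) * J) * S := by ring

end

/-! ### The symbol -/

section

variable {d : ℕ}

lemma norm_iteratedFDeriv_comp_clm_le {E F G : Type*} [NormedAddCommGroup E] [NormedSpace ℝ E]
    [NormedAddCommGroup F] [NormedSpace ℝ F] [NormedAddCommGroup G] [NormedSpace ℝ G]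
    (g : E →L[ℝ] F) {f : F → G} (hf : ContDiff ℝ ∞ f) (n : ℕ) (x : E) :
    ‖iteratedFDeriv ℝ n (fun y => f (g y)) x‖ ≤ ‖iteratedFDeriv ℝ n f (g x)‖ * ‖g‖ ^ n := by
  change ‖iteratedFDeriv ℝ n (f ∘ g) x‖ ≤ _
  rw [g.iteratedFDeriv_comp_right hf x (mod_cast le_top)]
  refine (ContinuousMultilinearMap.norm_compContinuousLinearMap_le _ _).trans_eq ?_
  simp

/-- Frequencies, scales, positions and amplitudes of a lacunary family of wave packets. -/
structure Blocks where
  ℓ : ℕ → ℕ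
  r : ℕ → ℕ
  p : ℕ → ℕ
  C : ℕ → ℝ
  L : ℕ
  gap : ∀ i, ℓ i + 3 ≤ ℓ (i + 1)
  r_le : ∀ i, r i ≤ ℓ i
  le_p : ∀ i, ℓ i ≤ p i
  C_nonneg : ∀ i, 0 ≤ C i
  C_le : ∀ i, C i ≤ 2 ^ (L * ℓ i)

lemma Blocks.gap_lt (P : Blocks) {i i' : ℕ} (h : i < i') : P.ℓ i + 3 ≤ P.ℓ i' := by
  induction i', h using Nat.le_induction with
  | base => exact P.gap i
  | succ n _ ih => exact ih.trans ((Nat.le_add_right _ 3).trans (P.gap n))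

lemma Blocks.eq_of_close (P : Blocks) {i i' : ℕ} (h : P.ℓ i < P.ℓ i' + 3)
    (h' : P.ℓ i' < P.ℓ i + 3) : i = i' := by
  rcases lt_trichotomy i i' with h1 | h1 | h1
  · have := P.gap_lt h1; omega
  · exact h1
  · have := P.gap_lt h1; omega

lemma Blocks.le_ℓ (P : Blocks) (i : ℕ) : i ≤ P.ℓ i := by
  induction i with
  | zero => exact Nat.zero_le _
  | succ n ih => have := P.gap n; omega

/-- A smooth cut-off near the unit vector `e`. -/
def shellBump (e : RD d) : ContDiffBump e := ⟨1 / 8, 1 / 4, by norm_num, by norm_num⟩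

lemma shellBump_eq_one {e ξ : RD d} (h : ‖ξ - e‖ ≤ 1 / 8) : shellBump e ξ = 1 :=
  (shellBump e).one_of_mem_closedBall (by simpa [shellBump, dist_eq_norm] using h)

lemma norm_of_mem_tsupport_shellBump {e ξ : RD d} (he : ‖e‖ = 1)
    (h : ξ ∈ tsupport (shellBump e)) : 3 / 4 ≤ ‖ξ‖ ∧ ‖ξ‖ ≤ 5 / 4 := by
  rw [(shellBump e).tsupport_eq, Metric.mem_closedBall, dist_eq_norm] at h
  have h : ‖ξ - e‖ ≤ 1 / 4 := h
  have h1 := norm_le_norm_add_norm_sub' ξ e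
  have h2 := norm_le_norm_add_norm_sub ξ e
  constructor <;> linarith

/-- The cut-off to frequencies close to `2^ℓ e`. -/
def shellCut (e : RD d) (l : ℕ) (ξ : RD d) : ℝ := shellBump e (((2 : ℝ) ^ l)⁻¹ • ξ)

lemma contDiff_shellCut (e : RD d) (l : ℕ) : ContDiff ℝ ∞ (shellCut e l) :=
  (shellBump e).contDiff.comp (contDiff_const_smul _)

lemma norm_of_mem_tsupport_of_smul {e ξ : RD d} (he : ‖e‖ = 1) {l : ℕ}
    (h : ((2 : ℝ) ^ l)⁻¹ • ξ ∈ tsupport (shellBump e)) :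
    3 / 4 * 2 ^ l ≤ ‖ξ‖ ∧ ‖ξ‖ ≤ 5 / 4 * 2 ^ l := by
  have h1 := norm_of_mem_tsupport_shellBump he h
  rw [norm_smul, norm_inv, norm_pow, Real.norm_ofNat, le_inv_mul_iff₀ (by positivity),
    inv_mul_le_iff₀ (by positivity)] at h1
  constructor <;> linarith

lemma norm_of_shellCut_ne_zero {e ξ : RD d} (he : ‖e‖ = 1) {l : ℕ} (h : shellCut e l ξ ≠ 0) :
    3 / 4 * 2 ^ l ≤ ‖ξ‖ ∧ ‖ξ‖ ≤ 5 / 4 * 2 ^ l :=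
  norm_of_mem_tsupport_of_smul he (subset_tsupport _ h)

lemma shellCut_eq_one {e ξ : RD d} {l : ℕ} (h : ‖ξ - (2 : ℝ) ^ l • e‖ ≤ 2 ^ l / 8) :
    shellCut e l ξ = 1 := by
  refine shellBump_eq_one ?_
  have : ((2 : ℝ) ^ l)⁻¹ • ξ - e = ((2 : ℝ) ^ l)⁻¹ • (ξ - (2 : ℝ) ^ l • e) := by
    rw [smul_sub, inv_smul_smul₀ (by positivity)]
  rw [this, norm_smul, norm_inv, norm_pow, Real.norm_ofNat, inv_mul_le_iff₀ (by positivity)]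
  linarith

/-- A lacunary sum of frequency cut-offs with coefficients `κ`. -/
def shellSum (P : Blocks) (e : RD d) (κ : ℕ → ℂ) (ξ : RD d) : ℂ :=
  ∑' i, κ i * (shellCut e (P.ℓ i) ξ : ℂ)

lemma Blocks.exists_eventually_shellCut_eq_zero (P : Blocks) {e : RD d} (he : ‖e‖ = 1)
    (ξ₀ : RD d) :
    ∃ i, ∀ᶠ ξ in nhds ξ₀, ∀ i', i' ≠ i → shellCut e (P.ℓ i') ξ = 0 := by
  by_cases hex : ∃ i, 5 / 8 * 2 ^ P.ℓ i < ‖ξ₀‖ ∧ ‖ξ₀‖ < 3 / 2 * 2 ^ P.ℓ i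
  · obtain ⟨i, h1, h2⟩ := hex
    refine ⟨i, ?_⟩
    filter_upwards [continuous_norm.tendsto ξ₀ |>.eventually (lt_mem_nhds h1),
      continuous_norm.tendsto ξ₀ |>.eventually (gt_mem_nhds h2)] with ξ h3 h4 i' hi'
    by_contra hne
    obtain ⟨h5, h6⟩ := norm_of_shellCut_ne_zero he hne
    have e1 : (2 : ℝ) ^ P.ℓ i < 2 ^ (P.ℓ i' + 1) := by rw [pow_succ]; linarith
    have e2 : (2 : ℝ) ^ P.ℓ i' < 2 ^ (P.ℓ i + 1) := by rw [pow_succ]; linarith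
    have e3 := (pow_lt_pow_iff_right₀ (one_lt_two (α := ℝ))).1 e1
    have e4 := (pow_lt_pow_iff_right₀ (one_lt_two (α := ℝ))).1 e2
    exact hi' (P.eq_of_close (by omega) (by omega))
  · push Not at hex
    refine ⟨0, ?_⟩
    filter_upwards [continuous_norm.tendsto ξ₀ |>.eventually
        (lt_mem_nhds (show ‖ξ₀‖ - 1 / 16 < ‖ξ₀‖ by linarith)),
      continuous_norm.tendsto ξ₀ |>.eventually
        (gt_mem_nhds (show ‖ξ₀‖ < ‖ξ₀‖ + 1 / 16 by linarith))] with ξ h3 h4 i' _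
    by_contra hne
    obtain ⟨h5, h6⟩ := norm_of_shellCut_ne_zero he hne
    have h7 : (1 : ℝ) ≤ 2 ^ P.ℓ i' := one_le_pow₀ one_le_two
    have := hex i' (by linarith)
    linarith

lemma shellSum_eq_of_forall (P : Blocks) {e ξ : RD d} {i : ℕ} (κ : ℕ → ℂ)
    (h : ∀ i', i' ≠ i → shellCut e (P.ℓ i') ξ = 0) :
    shellSum P e κ ξ = κ i * (shellCut e (P.ℓ i) ξ : ℂ) :=
  tsum_eq_single i fun i' hi' => by rw [h i' hi']; simp

lemma shellSum_eq_coeff (P : Blocks) {e ξ : RD d} (he : ‖e‖ = 1) {i : ℕ} (κ : ℕ → ℂ)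
    (h : ‖ξ - (2 : ℝ) ^ P.ℓ i • e‖ ≤ 2 ^ P.ℓ i / 8) : shellSum P e κ ξ = κ i := by
  have h1 := shellCut_eq_one h
  obtain ⟨j, hj⟩ := P.exists_eventually_shellCut_eq_zero he ξ
  have hj := hj.self_of_nhds
  have hij : i = j := by
    by_contra hne
    rw [hj i hne] at h1
    exact zero_ne_one h1
  subst hij
  rw [shellSum_eq_of_forall P κ hj, h1, Complex.ofReal_one, mul_one]

lemma contDiff_shellSum (P : Blocks) {e : RD d} (he : ‖e‖ = 1) (κ : ℕ → ℂ) :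
    ContDiff ℝ ∞ (shellSum P e κ) := by
  refine contDiff_iff_contDiffAt.2 fun ξ₀ => ?_
  obtain ⟨i, hi⟩ := P.exists_eventually_shellCut_eq_zero he ξ₀
  refine ContDiffAt.congr_of_eventuallyEq (f := fun ξ => κ i * (shellCut e (P.ℓ i) ξ : ℂ)) ?_
    (hi.mono fun ξ hξ => shellSum_eq_of_forall P κ hξ)
  exact (contDiff_const.mul
    (Complex.ofRealCLM.contDiff.comp (contDiff_shellCut e (P.ℓ i)))).contDiffAt

/-- The oscillating coefficients of the symbol. -/
def symbolCoeff (P : Blocks) (m : ℝ) (e : RD d) (x : RD d) (i : ℕ) : ℂ :=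
  (((2 : ℝ) ^ (m * P.ℓ i) : ℝ) : ℂ) * expChar (-⟪x, (2 : ℝ) ^ P.ℓ i • e⟫)

/-- The symbol `Σ_i 2^{mℓ_i} e^{-2πi⟨x,2^{ℓ_i}e⟩} χ(2^{-ℓ_i}ξ)`. -/
def blockSymbol (P : Blocks) (m : ℝ) (e : RD d) (x ξ : RD d) : ℂ :=
  shellSum P e (symbolCoeff P m e x) ξ

lemma contDiff_symbolCoeff (P : Blocks) (m : ℝ) (e : RD d) (i : ℕ) :
    ContDiff ℝ ∞ fun x : RD d => symbolCoeff P m e x i :=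
  contDiff_const.mul (contDiff_expChar.comp (contDiff_id.inner ℝ contDiff_const).neg)

lemma norm_iteratedFDeriv_symbolCoeff_le (P : Blocks) (m : ℝ) {e : RD d} (he : ‖e‖ = 1) (i n : ℕ)
    (x : RD d) : ‖iteratedFDeriv ℝ n (fun x => symbolCoeff P m e x i) x‖
      ≤ (2 : ℝ) ^ (m * P.ℓ i) * ((2 * Real.pi) ^ n * (2 ^ P.ℓ i) ^ n) := by
  set g : RD d →L[ℝ] ℝ := -(innerSL ℝ ((2 : ℝ) ^ P.ℓ i • e)) with hg
  have hgn : ‖g‖ = 2 ^ P.ℓ i := by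
    rw [hg, norm_neg, innerSL_apply_norm, norm_smul, he, norm_pow, Real.norm_ofNat, mul_one]
  have h1 : (fun x => symbolCoeff P m e x i)
      = ((2 : ℝ) ^ (m * P.ℓ i) : ℝ) • fun y => expChar (g y) := by
    ext y
    simp only [Pi.smul_apply, Complex.real_smul, symbolCoeff]
    congr 2
    rw [hg, neg_apply, innerSL_apply_apply, real_inner_comm]
  have h2 := norm_iteratedFDeriv_comp_clm_le g contDiff_expChar n x
  rw [norm_iteratedFDeriv_expChar, hgn] at h2
  rw [h1, iteratedFDeriv_const_smul_apply, norm_smul, Real.norm_of_nonneg (by positivity)]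
  · gcongr
  · exact ((contDiff_expChar.comp g.contDiff).contDiffAt).of_le (mod_cast le_top)

lemma rpow_mul_le_of_comparable {N t : ℝ} {l : ℕ} (h1 : 3 / 4 * 2 ^ l ≤ N)
    (h2 : N ≤ 5 / 4 * 2 ^ l) : (2 : ℝ) ^ (l * t) ≤ 3 ^ |t| * (1 + N) ^ t := by
  have hl : (1 : ℝ) ≤ 2 ^ l := one_le_pow₀ one_le_two
  have hN : 0 ≤ N := le_trans (by positivity) h1
  rw [Real.rpow_mul (by norm_num), Real.rpow_natCast]
  rcases le_total 0 t with ht | ht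
  · rw [abs_of_nonneg ht, ← Real.mul_rpow (by norm_num) (by positivity)]
    exact Real.rpow_le_rpow (by positivity) (by linarith) ht
  · rw [abs_of_nonpos ht, Real.rpow_neg (by norm_num), ← Real.inv_rpow (by norm_num),
      ← Real.mul_rpow (by norm_num) (by positivity)]
    exact Real.rpow_le_rpow_of_nonpos (by positivity) (by linarith) ht

lemma exists_norm_iteratedFDeriv_shellCut_le {e : RD d} (he : ‖e‖ = 1) (n : ℕ) :
    ∃ B : ℝ, 0 ≤ B ∧ ∀ (l : ℕ) (ξ : RD d),
      ‖iteratedFDeriv ℝ n (shellCut e l) ξ‖ ≤ B * (((2 : ℝ) ^ l)⁻¹) ^ n ∧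
      (iteratedFDeriv ℝ n (shellCut e l) ξ ≠ 0 →
        3 / 4 * 2 ^ l ≤ ‖ξ‖ ∧ ‖ξ‖ ≤ 5 / 4 * 2 ^ l) := by
  have hsm : ContDiff ℝ ∞ (shellBump e) := (shellBump e).contDiff
  obtain ⟨B, hB⟩ := (hsm.continuous_iteratedFDeriv (m := n)
    (mod_cast le_top)).bounded_above_of_compact_support
    ((shellBump e).hasCompactSupport.iteratedFDeriv n)
  refine ⟨B, (norm_nonneg _).trans (hB 0), fun l ξ => ?_⟩
  set g : RD d →L[ℝ] RD d := ((2 : ℝ) ^ l)⁻¹ • ContinuousLinearMap.id ℝ (RD d) with hg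
  have hgn : ‖g‖ ≤ ((2 : ℝ) ^ l)⁻¹ := by
    rw [hg, norm_smul, norm_inv, norm_pow, Real.norm_ofNat]
    exact mul_le_of_le_one_right (by positivity) ContinuousLinearMap.norm_id_le
  have h := norm_iteratedFDeriv_comp_clm_le g hsm n ξ
  change ‖iteratedFDeriv ℝ n (shellCut e l) ξ‖ ≤ _ at h
  refine ⟨h.trans ?_, fun hne => ?_⟩
  · exact mul_le_mul (hB _) (by gcongr) (by positivity) ((norm_nonneg _).trans (hB 0))
  · refine norm_of_mem_tsupport_of_smul he (support_iteratedFDeriv_subset (𝕜 := ℝ) n ?_)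
    intro h0
    change iteratedFDeriv ℝ n (shellBump e) (g ξ) = 0 at h0
    rw [h0, norm_zero, zero_mul] at h
    exact hne (norm_le_zero_iff.1 h)

lemma isSymbolS11_blockSymbol (P : Blocks) (m : ℝ) {e : RD d} (he : ‖e‖ = 1) :
    IsSymbolS11 d m (blockSymbol P m e) := by
  refine ⟨contDiff_iff_contDiffAt.2 fun p₀ => ?_, fun α β => ?_⟩
  · obtain ⟨i, hi⟩ := P.exists_eventually_shellCut_eq_zero he p₀.2
    refine ContDiffAt.congr_of_eventuallyEq
      (f := fun p : RD d × RD d => symbolCoeff P m e p.1 i * (shellCut e (P.ℓ i) p.2 : ℂ)) ?_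
      ((continuous_snd.tendsto p₀).eventually hi |>.mono fun p hp => shellSum_eq_of_forall P _ hp)
    exact (((contDiff_symbolCoeff P m e i).comp contDiff_fst).mul
      (Complex.ofRealCLM.contDiff.comp
        ((contDiff_shellCut e (P.ℓ i)).comp contDiff_snd))).contDiffAt
  · obtain ⟨B, hB0, hB⟩ := exists_norm_iteratedFDeriv_shellCut_le he α
    set t : ℝ := m - α + β with ht
    refine ⟨B * (2 * Real.pi) ^ β * 3 ^ |t|, fun x ξ => ?_⟩
    obtain ⟨i, hi⟩ := P.exists_eventually_shellCut_eq_zero he ξ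
    set W := iteratedFDeriv ℝ β (fun x => symbolCoeff P m e x i) x with hW
    set T := ContinuousLinearMap.toSpanSingleton ℝ W with hT
    have heq : (fun ξ' => iteratedFDeriv ℝ β (fun x' => blockSymbol P m e x' ξ') x)
        =ᶠ[nhds ξ] (T ∘ shellCut e (P.ℓ i)) := by
      filter_upwards [hi] with ξ' hξ'
      have : (fun x' => blockSymbol P m e x' ξ')
          = (shellCut e (P.ℓ i) ξ') • fun x' => symbolCoeff P m e x' i := by
        ext x'
        rw [blockSymbol, shellSum_eq_of_forall P _ hξ', Pi.smul_apply, Complex.real_smul, mul_comm]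
      rw [this, iteratedFDeriv_const_smul_apply]
      · rfl
      · exact (contDiff_symbolCoeff P m e i).contDiffAt.of_le (mod_cast le_top)
    rw [(heq.iteratedFDeriv ℝ α).self_of_nhds]
    have h1 := T.norm_iteratedFDeriv_comp_left (x := ξ) (n := α)
      (contDiff_shellCut e (P.ℓ i)).contDiffAt (mod_cast le_top)
    rw [hT, ContinuousLinearMap.norm_toSpanSingleton, ← hT] at h1
    refine h1.trans ?_
    obtain ⟨h2, h3⟩ := hB (P.ℓ i) ξ
    by_cases h0 : iteratedFDeriv ℝ α (shellCut e (P.ℓ i)) ξ = 0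
    · rw [h0, norm_zero, mul_zero]
      positivity
    · obtain ⟨h4, h5⟩ := h3 h0
      have h6 : (2 : ℝ) ^ (m * P.ℓ i) * (((2 : ℝ) ^ P.ℓ i)⁻¹ ^ α * (2 ^ P.ℓ i) ^ β)
          = 2 ^ (P.ℓ i * t) := by
        rw [← Real.rpow_natCast _ β, ← Real.rpow_natCast _ α, ← Real.rpow_natCast 2 (P.ℓ i),
          ← Real.rpow_neg (by norm_num), ← Real.rpow_mul (by norm_num),
          ← Real.rpow_mul (by norm_num), ← Real.rpow_add (by norm_num),
          ← Real.rpow_add (by norm_num), ht]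
        congr 1
        ring
      calc ‖W‖ * ‖iteratedFDeriv ℝ α (shellCut e (P.ℓ i)) ξ‖
          ≤ ((2 : ℝ) ^ (m * P.ℓ i) * ((2 * Real.pi) ^ β * (2 ^ P.ℓ i) ^ β)) *
            (B * (((2 : ℝ) ^ P.ℓ i)⁻¹) ^ α) :=
            mul_le_mul (norm_iteratedFDeriv_symbolCoeff_le P m he i β x) h2 (norm_nonneg _)
              (by positivity)
        _ = B * (2 * Real.pi) ^ β * 2 ^ (P.ℓ i * t) := by rw [← h6]; ring
        _ ≤ B * (2 * Real.pi) ^ β * (3 ^ |t| * (1 + ‖ξ‖) ^ t) := by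
            gcongr
            exact rpow_mul_le_of_comparable h4 h5
        _ = _ := by ring

end

/-! ### The operator applied to a lacunary series of wave packets -/

section

variable {d : ℕ}

lemma Blocks.exists_dominated (P : Blocks) (d : ℕ) (t : ℝ) :
    ∃ M₀ : ℕ, ∀ M, M₀ ≤ M → ∀ (i : ℕ) (X x : RD d), 2 ^ P.ℓ i ≤ ‖X‖ →
      (2 : ℝ) ^ (t * P.ℓ i) * P.C i * (2 ^ P.r i) ^ d * ((1 + 2 ^ P.r i * ‖x - X‖) ^ M)⁻¹
        ≤ (1 / 2) ^ i * (1 + ‖x‖) ^ M := by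
  obtain ⟨T, hT⟩ := exists_nat_ge t
  refine ⟨T + P.L + d + 1, fun M hM i X x hX => ?_⟩
  have hℓ : (1 : ℝ) ≤ 2 ^ P.ℓ i := one_le_pow₀ one_le_two
  have hr : (1 : ℝ) ≤ 2 ^ P.r i := one_le_pow₀ one_le_two
  have h1 : (2 : ℝ) ^ P.ℓ i ≤ (1 + ‖x‖) * (1 + 2 ^ P.r i * ‖x - X‖) := by
    have := one_add_mul_norm_le_mul (zero_le_one) 0 x X
    simp only [one_mul, zero_sub, norm_neg] at this
    calc (2 : ℝ) ^ P.ℓ i ≤ (1 + ‖x‖) * (1 + ‖x - X‖) := by linarith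
      _ ≤ _ := by
        gcongr
        nlinarith [norm_nonneg (x - X)]
  have h2 : ((1 + 2 ^ P.r i * ‖x - X‖) ^ M)⁻¹ ≤ (1 + ‖x‖) ^ M * (((2 : ℝ) ^ P.ℓ i) ^ M)⁻¹ := by
    rw [← div_eq_mul_inv, le_div_iff₀ (by positivity), inv_mul_le_iff₀ (by positivity), ← mul_pow]
    gcongr
    linarith
  have h3 : (2 : ℝ) ^ (t * P.ℓ i) ≤ (2 ^ P.ℓ i) ^ T := by
    rw [← pow_mul, ← Real.rpow_natCast]
    refine Real.rpow_le_rpow_of_exponent_le one_le_two ?_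
    push_cast
    nlinarith [Nat.cast_nonneg (α := ℝ) (P.ℓ i)]
  have h4 : P.C i ≤ (2 ^ P.ℓ i) ^ P.L := by
    rw [← pow_mul, mul_comm]
    exact P.C_le i
  have h5 : ((2 : ℝ) ^ P.r i) ^ d ≤ (2 ^ P.ℓ i) ^ d := by
    have := P.r_le i
    gcongr
    exact one_le_two
  have h6 : ((2 : ℝ) ^ P.ℓ i)⁻¹ ≤ (1 / 2) ^ i := by
    rw [one_div, inv_pow]
    have := P.le_ℓ i
    gcongr
    exact one_le_two
  have hC := P.C_nonneg i
  calc _ ≤ (2 ^ P.ℓ i) ^ T * (2 ^ P.ℓ i) ^ P.L * (2 ^ P.ℓ i) ^ d *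
        ((1 + ‖x‖) ^ M * (((2 : ℝ) ^ P.ℓ i) ^ M)⁻¹) := by gcongr
    _ = ((2 ^ P.ℓ i) ^ (T + P.L + d + 1) * (((2 : ℝ) ^ P.ℓ i) ^ M)⁻¹) *
        ((2 : ℝ) ^ P.ℓ i)⁻¹ * (1 + ‖x‖) ^ M := by
      rw [pow_add _ _ 1, pow_add, pow_add, pow_one]
      field_simp
    _ ≤ 1 * (1 / 2) ^ i * (1 + ‖x‖) ^ M := by
      gcongr
      rw [mul_inv_le_iff₀ (by positivity), one_mul]
      exact pow_le_pow_right₀ hℓ hM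
    _ = _ := by rw [one_mul]

/-- The `i`-th wave packet of the input. -/
def inPacket (P : Blocks) (m : ℝ) (e : RD d) (X : ℕ → RD d) (i : ℕ) : 𝓢(RD d, ℂ) :=
  packet (((2 : ℝ) ^ (-m * P.ℓ i) * P.C i : ℝ) : ℂ) (P.r i) (X i) ((2 : ℝ) ^ P.ℓ i • e)

/-- The `i`-th wave packet of the output. -/
def outPacket (P : Blocks) (X : ℕ → RD d) (i : ℕ) : 𝓢(RD d, ℂ) :=
  packet ((P.C i : ℝ) : ℂ) (P.r i) (X i) 0

lemma symbolCoeff_mul_inPacket (P : Blocks) (m : ℝ) (e : RD d) (X : ℕ → RD d) (i : ℕ) (x : RD d) :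
    symbolCoeff P m e x i * inPacket P m e X i x = outPacket P X i x := by
  rw [inPacket, outPacket, packet_apply, packet_apply ((P.C i : ℝ) : ℂ) _ _ 0, symbolCoeff, inner_zero_right,
    expChar_zero]
  have h1 := expChar_neg_mul_self ⟪x, (2 : ℝ) ^ P.ℓ i • e⟫
  have h2 : (((2 : ℝ) ^ (m * P.ℓ i) : ℝ) : ℂ) * (((2 : ℝ) ^ (-m * P.ℓ i) : ℝ) : ℂ) = 1 := by
    rw [← Complex.ofReal_mul, ← Real.rpow_add two_pos, neg_mul, add_neg_cancel, Real.rpow_zero,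
      Complex.ofReal_one]
  rw [Complex.ofReal_mul]
  generalize (((2 : ℝ) ^ (m * P.ℓ i) : ℝ) : ℂ) = a at *
  generalize (((2 : ℝ) ^ (-m * P.ℓ i) : ℝ) : ℂ) = b at *
  generalize expChar ⟪x, (2 : ℝ) ^ P.ℓ i • e⟫ = y at *
  generalize expChar (-⟪x, (2 : ℝ) ^ P.ℓ i • e⟫) = z at *
  generalize ((((2 : ℝ) ^ P.r i) ^ d : ℝ) : ℂ) * _ = R
  linear_combination (a * b * P.C i * R) * h1 + (P.C i * R) * h2

lemma norm_symbolCoeff (P : Blocks) (m : ℝ) (e : RD d) (i : ℕ) (x : RD d) :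
    ‖symbolCoeff P m e x i‖ = 2 ^ (m * P.ℓ i) := by
  rw [symbolCoeff, norm_mul, norm_expChar, mul_one, Complex.norm_real,
    Real.norm_of_nonneg (by positivity)]

lemma symbolPiece_blockSymbol (D : LPData d) (P : Blocks) (m : ℝ) {e : RD d} (he : ‖e‖ = 1)
    (j k : ℕ) (x ξ : RD d) :
    symbolPiece D (blockSymbol P m e) j k x ξ
      = shellSum P e (fun i => symbolCoeff P m e x i * LPhat D j (-((2 : ℝ) ^ P.ℓ i • e))) ξ
        * LPhat D k ξ := by
  obtain ⟨i, hi⟩ := P.exists_eventually_shellCut_eq_zero he ξ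
  have hi := hi.self_of_nhds
  rw [symbolPiece, shellSum_eq_of_forall P _ hi]
  congr 1
  rw [← integral_LPkernel_mul_expChar, mul_right_comm, ← integral_const_mul]
  congr 1
  ext y
  rw [blockSymbol, shellSum_eq_of_forall P _ hi, symbolCoeff, symbolCoeff, inner_neg_right, neg_neg,
    inner_sub_left, neg_sub, sub_eq_neg_add, expChar_add]
  ring

lemma norm_lt_of_fourierS_inPacket_ne_zero (P : Blocks) (m : ℝ) (e : RD d) (X : ℕ → RD d) (i : ℕ)
    {ξ : RD d} (h : fourierS (inPacket P m e X i) ξ ≠ 0) :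
    ‖ξ - (2 : ℝ) ^ P.ℓ i • e‖ < 2 ^ P.ℓ i / 8 := by
  by_contra! h'
  refine h ?_
  rw [inPacket, fourierS_packet]
  refine packetHatFun_eq_zero _ _ _ _ (le_trans ?_ h')
  have := P.r_le i
  gcongr
  exact one_le_two

lemma hasSum_pdoPieceD (D : LPData d) (P : Blocks) (m : ℝ) {e : RD d} (he : ‖e‖ = 1)
    (X : ℕ → RD d) (u : TD d)
    (hu : ∀ ψ : 𝓢(RD d, ℂ), HasSum (fun i => ∫ x, inPacket P m e X i x * ψ x) (u ψ))
    (j k : ℕ) (x : RD d) :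
    HasSum (fun i => symbolCoeff P m e x i * LPhat D j (-((2 : ℝ) ^ P.ℓ i • e)) *
      ∫ ξ, fourierS (inPacket P m e X i) ξ * (LPhat D k ξ * expChar ⟪x, ξ⟫))
      (pdoPieceD D (blockSymbol P m e) j k u x) := by
  set κ : ℕ → ℂ := fun i => symbolCoeff P m e x i * LPhat D j (-((2 : ℝ) ^ P.ℓ i • e)) with hκ
  set F : RD d → ℂ := fun ξ => (shellSum P e κ ξ * LPhat D k ξ) * expChar ⟪x, ξ⟫ with hF
  have hFs : ContDiff ℝ ∞ F := ((contDiff_shellSum P he κ).mul (contDiff_LPhat D k)).mul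
    (contDiff_expChar.comp (contDiff_const.inner ℝ contDiff_id))
  have hFc : HasCompactSupport F := ((hasCompactSupport_LPhat D k).mul_left).mul_right
  have h1 : pdoPieceD D (blockSymbol P m e) j k u x = u (fourierS (hFc.toSchwartzMap hFs)) := by
    refine pairing_of_eq (fourierTD u) (hFc.toSchwartzMap hFs) _ fun ξ => ?_
    rw [symbolPiece_blockSymbol D P m he]
    rfl
  rw [h1]
  refine (hu _).congr_fun ?_
  intro i
  rw [← integral_fourierS_mul, ← integral_const_mul]
  congr 1
  ext ξ
  by_cases h0 : fourierS (inPacket P m e X i) ξ = 0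
  · simp [h0]
  · change _ = _ * ((shellSum P e κ ξ * LPhat D k ξ) * expChar ⟪x, ξ⟫)
    rw [shellSum_eq_coeff P he κ (norm_lt_of_fourierS_inPacket_ne_zero P m e X i h0).le]
    ring

/-- The contribution of the `i`-th wave packet to the `N`-th partial sum of `T_a f`. -/
def partialTerm (D : LPData d) (P : Blocks) (m : ℝ) (e : RD d) (X : ℕ → RD d) (N i : ℕ)
    (x : RD d) : ℂ :=
  symbolCoeff P m e x i * fourierS D.Φ (((2 : ℝ) ^ N)⁻¹ • -((2 : ℝ) ^ P.ℓ i • e)) *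
    ∫ ξ, fourierS (inPacket P m e X i) ξ *
      (fourierS D.Φ (((2 : ℝ) ^ N)⁻¹ • ξ) * expChar ⟪x, ξ⟫)

lemma integrable_fourierS_mul_LPhat (D : LPData d) (U : 𝓢(RD d, ℂ)) (k : ℕ) (x : RD d) :
    Integrable fun ξ => fourierS U ξ * (LPhat D k ξ * expChar ⟪x, ξ⟫) := by
  refine Continuous.integrable_of_hasCompactSupport ?_
    ((hasCompactSupport_LPhat D k).mul_right.mul_left)
  exact (fourierS U).continuous.mul ((contDiff_LPhat D k).continuous.mul
    (continuous_expChar.comp (by fun_prop)))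

lemma hasSum_pdoPartial (D : LPData d) (P : Blocks) (m : ℝ) {e : RD d} (he : ‖e‖ = 1)
    (X : ℕ → RD d) (u : TD d)
    (hu : ∀ ψ : 𝓢(RD d, ℂ), HasSum (fun i => ∫ x, inPacket P m e X i x * ψ x) (u ψ))
    (N : ℕ) (x : RD d) :
    HasSum (fun i => partialTerm D P m e X N i x) (pdoPartial D (blockSymbol P m e) N u x) := by
  have h := hasSum_sum (s := Finset.range (N + 1)) fun j _ =>
    hasSum_sum (s := Finset.range (N + 1)) fun k _ => hasSum_pdoPieceD D P m he X u hu j k x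
  refine h.congr_fun ?_
  intro i
  rw [partialTerm, ← sum_LPhat D N (-((2 : ℝ) ^ P.ℓ i • e)), Finset.mul_sum, Finset.sum_mul]
  refine Finset.sum_congr rfl fun j _ => ?_
  rw [← Finset.mul_sum, ← integral_finsetSum _ fun k _ => integrable_fourierS_mul_LPhat D _ k x]
  congr 2
  ext ξ
  rw [← sum_LPhat, Finset.sum_mul, Finset.mul_sum]

lemma continuous_partialTerm (D : LPData d) (P : Blocks) (m : ℝ) (e : RD d) (X : ℕ → RD d)
    (N i : ℕ) : Continuous (partialTerm D P m e X N i) := by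
  have hs : ContDiff ℝ ∞ fun ξ => fourierS (inPacket P m e X i) ξ *
      fourierS D.Φ (((2 : ℝ) ^ N)⁻¹ • ξ) :=
    ((fourierS (inPacket P m e X i)).smooth ⊤).mul
      (((fourierS D.Φ).smooth ⊤).comp (contDiff_const_smul _))
  have hc : HasCompactSupport fun ξ => fourierS (inPacket P m e X i) ξ *
      fourierS D.Φ (((2 : ℝ) ^ N)⁻¹ • ξ) := by
    refine HasCompactSupport.mul_right ?_
    rw [inPacket, packet, fourierS_fourierInvS]
    exact hasCompactSupport_packetHatFun _ _ _ _
  have h : partialTerm D P m e X N i = fun x => symbolCoeff P m e x i *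
      fourierS D.Φ (((2 : ℝ) ^ N)⁻¹ • -((2 : ℝ) ^ P.ℓ i • e)) *
      fourierInvS (hc.toSchwartzMap hs) x := by
    ext x
    rw [partialTerm, fourierInvS_eq]
    congr 2
    ext ξ
    change _ = _ * (fourierS (inPacket P m e X i) ξ * fourierS D.Φ (((2 : ℝ) ^ N)⁻¹ • ξ))
    ring
  rw [h]
  exact ((contDiff_symbolCoeff P m e i).continuous.mul continuous_const).mul
    (fourierInvS (hc.toSchwartzMap hs)).continuous

lemma norm_two_pow_inv_smul (N l : ℕ) {e : RD d} (he : ‖e‖ = 1) :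
    ‖((2 : ℝ) ^ N)⁻¹ • -((2 : ℝ) ^ l • e)‖ = 2 ^ l / 2 ^ N := by
  rw [norm_smul, norm_neg, norm_smul, he, norm_inv, norm_pow, norm_pow, Real.norm_ofNat]
  ring

lemma partialTerm_eq_outPacket (D : LPData d) (P : Blocks) (m : ℝ) {e : RD d} (he : ‖e‖ = 1)
    (X : ℕ → RD d) {N i : ℕ} (hN : P.ℓ i + 1 ≤ N) (x : RD d) :
    partialTerm D P m e X N i x = outPacket P X i x := by
  have hp : (2 : ℝ) * 2 ^ P.ℓ i ≤ 2 ^ N := by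
    rw [← pow_succ']
    exact pow_le_pow_right₀ one_le_two hN
  have hpos : (0 : ℝ) < 2 ^ P.ℓ i := by positivity
  rw [← symbolCoeff_mul_inPacket P m e, partialTerm, fourierS_Φ_eq_one D, mul_one]
  · congr 1
    conv_rhs => rw [← fourierInvS_fourierS (inPacket P m e X i), fourierInvS_eq]
    congr 1
    ext ξ
    by_cases h0 : fourierS (inPacket P m e X i) ξ = 0
    · simp [h0]
    · rw [fourierS_Φ_eq_one D, one_mul, mul_comm]
      have h1 := norm_lt_of_fourierS_inPacket_ne_zero P m e X i h0
      have h2 := norm_le_norm_add_norm_sub' ξ ((2 : ℝ) ^ P.ℓ i • e)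
      rw [norm_smul ((2 : ℝ) ^ P.ℓ i), he, norm_pow, Real.norm_ofNat, mul_one] at h2
      rw [norm_smul, norm_inv, norm_pow, Real.norm_ofNat, inv_mul_lt_iff₀ (by positivity)]
      linarith
  · rw [norm_two_pow_inv_smul N _ he, div_lt_one (by positivity)]
    linarith

lemma exists_norm_partialTerm_le (D : LPData d) (P : Blocks) (m : ℝ) {e : RD d} (he : ‖e‖ = 1)
    (X : ℕ → RD d) (hX : ∀ i, 2 ^ P.ℓ i ≤ ‖X i‖) :
    ∃ (A : ℝ) (M : ℕ), 0 ≤ A ∧ ∀ N i x,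
      ‖partialTerm D P m e X N i x‖ ≤ A * (1 / 2) ^ i * (1 + ‖x‖) ^ M := by
  obtain ⟨M, hM⟩ := P.exists_dominated d 0
  obtain ⟨B, hB0, hB⟩ := exists_norm_packet_le d M
  obtain ⟨K, hK0, hK⟩ := exists_norm_integral_mul_kernelS_le D.Φ M
  obtain ⟨S, hS⟩ : ∃ S : ℝ, ∀ ξ, ‖fourierS D.Φ ξ‖ ≤ S :=
    ⟨_, fun ξ => SchwartzMap.norm_le_seminorm ℝ (fourierS D.Φ) ξ⟩
  have hS0 : 0 ≤ S := (norm_nonneg _).trans (hS 0)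
  refine ⟨S * K * B, M, by positivity, fun N i x => ?_⟩
  by_cases h0 : fourierS D.Φ (((2 : ℝ) ^ N)⁻¹ • -((2 : ℝ) ^ P.ℓ i • e)) = 0
  · rw [partialTerm, h0, mul_zero, zero_mul, norm_zero]
    positivity
  have hle : (2 : ℝ) ^ P.ℓ i ≤ 2 * 2 ^ N := by
    by_contra! h
    refine h0 (fourierS_Φ_eq_zero D ?_)
    rw [norm_two_pow_inv_smul N _ he, lt_div_iff₀ (by positivity)]
    exact h
  have hr : (2 : ℝ) ^ P.r i ≤ 2 ^ P.ℓ i := pow_le_pow_right₀ one_le_two (P.r_le i)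
  have hC := P.C_nonneg i
  have h1 := hK (2 ^ N) (2 ^ P.r i) (by positivity) (by positivity) (hr.trans hle)
    (B * (‖(((2 : ℝ) ^ (-m * P.ℓ i) * P.C i : ℝ) : ℂ)‖ * (2 ^ P.r i) ^ d)) (X i)
    (inPacket P m e X i) (by positivity) (fun z => hB _ _ _ _ z) x
  rw [integral_mul_kernelS _ _ (by positivity), Complex.norm_real, Real.norm_of_nonneg (by positivity)] at h1
  have h2 := hM M le_rfl i (X i) x (hX i)
  rw [zero_mul, Real.rpow_zero, one_mul] at h2
  have h3 : (2 : ℝ) ^ (m * P.ℓ i) * 2 ^ (-m * P.ℓ i) = 1 := by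
    rw [← Real.rpow_add two_pos, neg_mul, add_neg_cancel, Real.rpow_zero]
  rw [partialTerm, norm_mul, norm_mul, norm_symbolCoeff]
  calc _ ≤ (2 : ℝ) ^ (m * P.ℓ i) * S * (K * (B * ((2 : ℝ) ^ (-m * P.ℓ i) * P.C i *
        (2 ^ P.r i) ^ d)) * ((1 + 2 ^ P.r i * ‖x - X i‖) ^ M)⁻¹) := by
        gcongr
        exact hS _
    _ = ((2 : ℝ) ^ (m * P.ℓ i) * 2 ^ (-m * P.ℓ i)) * (S * K * B) * (P.C i *
        (2 ^ P.r i) ^ d * ((1 + 2 ^ P.r i * ‖x - X i‖) ^ M)⁻¹) := by ring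
    _ ≤ 1 * (S * K * B) * ((1 / 2) ^ i * (1 + ‖x‖) ^ M) := by rw [h3]; gcongr
    _ = _ := by ring

lemma convergesInSPrime_blockSymbol (D : LPData d) (P : Blocks) (m : ℝ) {e : RD d} (he : ‖e‖ = 1)
    (X : ℕ → RD d) (hX : ∀ i, 2 ^ P.ℓ i ≤ ‖X i‖) (u Tf : TD d)
    (hu : ∀ ψ : 𝓢(RD d, ℂ), HasSum (fun i => ∫ x, inPacket P m e X i x * ψ x) (u ψ))
    (hT : ∀ ψ : 𝓢(RD d, ℂ), HasSum (fun i => ∫ x, outPacket P X i x * ψ x) (Tf ψ)) :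
    ConvergesInSPrime D (blockSymbol P m e) u Tf := by
  intro ψ
  obtain ⟨A, M, hA, hb⟩ := exists_norm_partialTerm_le D P m he X hX
  have hI := integrable_norm_mul_one_add_norm_pow ψ M
  set J : ℝ := ∫ x, ‖ψ x‖ * (1 + ‖x‖) ^ M with hJ
  have hpt : ∀ N i x, ‖partialTerm D P m e X N i x * ψ x‖
      ≤ A * (1 / 2) ^ i * (‖ψ x‖ * (1 + ‖x‖) ^ M) := by
    intro N i x
    rw [norm_mul]
    calc _ ≤ (A * (1 / 2) ^ i * (1 + ‖x‖) ^ M) * ‖ψ x‖ := by gcongr; exact hb N i x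
      _ = _ := by ring
  have hInt : ∀ N i, Integrable fun x => partialTerm D P m e X N i x * ψ x := fun N i =>
    (hI.const_mul _).mono'
      ((continuous_partialTerm D P m e X N i).mul ψ.continuous).aestronglyMeasurable
      (.of_forall (hpt N i))
  have hnorm : ∀ N i, ∫ x, ‖partialTerm D P m e X N i x * ψ x‖ ≤ A * (1 / 2) ^ i * J := by
    intro N i
    rw [hJ, ← integral_const_mul]
    exact integral_mono (hInt N i).norm (hI.const_mul _) (hpt N i)
  have hgs : Summable fun i : ℕ => A * (1 / 2 : ℝ) ^ i * J :=
    (summable_geometric_two.mul_left A).mul_right J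
  have hsum : ∀ N, ∫ x, pdoPartial D (blockSymbol P m e) N u x * ψ x
      = ∑' i, ∫ x, partialTerm D P m e X N i x * ψ x := by
    intro N
    rw [integral_tsum_of_summable_integral_norm (hInt N)
      (hgs.of_nonneg_of_le (fun i => integral_nonneg fun x => norm_nonneg _) (hnorm N))]
    congr 1
    ext x
    rw [tsum_mul_right, (hasSum_pdoPartial D P m he X u hu N x).tsum_eq]
  simp_rw [hsum]
  rw [← (hT ψ).tsum_eq]
  refine tendsto_tsum_of_dominated_convergence hgs (fun i => ?_)
    (.of_forall fun N i => (norm_integral_le_integral_norm _).trans (hnorm N i))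
  refine tendsto_const_nhds.congr' ?_
  filter_upwards [eventually_ge_atTop (P.ℓ i + 1)] with N hN
  simp_rw [partialTerm_eq_outPacket D P m he X hN]

end

/-! ### The input series and the finiteness of its norm -/

section

variable {d : ℕ}

lemma norm_packet_coeff (P : Blocks) (t : ℝ) (i : ℕ) :
    ‖(((2 : ℝ) ^ (t * P.ℓ i) * P.C i : ℝ) : ℂ)‖ = (2 : ℝ) ^ (t * P.ℓ i) * P.C i := by
  have := P.C_nonneg i
  rw [Complex.norm_real, Real.norm_of_nonneg (by positivity)]

lemma exists_hasSum_packet (P : Blocks) (t : ℝ) (X v : ℕ → RD d)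
    (hX : ∀ i, 2 ^ P.ℓ i ≤ ‖X i‖) :
    ∃ u : TD d, ∀ ψ : 𝓢(RD d, ℂ), HasSum (fun i => ∫ x,
      packet (((2 : ℝ) ^ (t * P.ℓ i) * P.C i : ℝ) : ℂ) (P.r i) (X i) (v i) x * ψ x) (u ψ) := by
  obtain ⟨M, hM⟩ := P.exists_dominated d t
  obtain ⟨B, hB0, hB⟩ := exists_norm_packet_le d M
  refine exists_hasSum_integral
    (fun i => packet (((2 : ℝ) ^ (t * P.ℓ i) * P.C i : ℝ) : ℂ) (P.r i) (X i) (v i))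
    B M hB0 (fun i => (packet _ _ _ _).continuous) fun i x => ?_
  refine (hB _ _ _ _ _).trans ?_
  rw [norm_packet_coeff, mul_assoc, mul_assoc B]
  exact mul_le_mul_of_nonneg_left (hM M le_rfl i (X i) x (hX i)) hB0

lemma exists_inDist (P : Blocks) (m : ℝ) (e : RD d) (X : ℕ → RD d)
    (hX : ∀ i, 2 ^ P.ℓ i ≤ ‖X i‖) :
    ∃ u : TD d, ∀ ψ : 𝓢(RD d, ℂ), HasSum (fun i => ∫ x, inPacket P m e X i x * ψ x) (u ψ) :=
  exists_hasSum_packet P (-m) X _ hX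

lemma exists_outDist (P : Blocks) (X : ℕ → RD d) (hX : ∀ i, 2 ^ P.ℓ i ≤ ‖X i‖) :
    ∃ u : TD d, ∀ ψ : 𝓢(RD d, ℂ), HasSum (fun i => ∫ x, outPacket P X i x * ψ x) (u ψ) := by
  obtain ⟨u, hu⟩ := exists_hasSum_packet P 0 X (fun _ => 0) hX
  refine ⟨u, fun ψ => ?_⟩
  simpa [outPacket] using hu ψ

/-- The `i`-th wave packet only contributes to Littlewood–Paley pieces of frequency `≈ 2^{ℓ_i}`. -/
lemma close_of_integral_inPacket_ne_zero (D : LPData d) (P : Blocks) (m : ℝ) {e : RD d}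
    (he : ‖e‖ = 1) (X : ℕ → RD d) {i k : ℕ} {x : RD d}
    (h : ∫ y, inPacket P m e X i y * LPkernelS D k x y ≠ 0) :
    P.ℓ i ≤ k + 1 ∧ k ≤ P.ℓ i + 1 := by
  rw [integral_mul_LPkernelS] at h
  obtain ⟨ξ, hξ⟩ : ∃ ξ, fourierS (inPacket P m e X i) ξ * (LPhat D k ξ * expChar ⟪x, ξ⟫) ≠ 0 := by
    by_contra! h'
    exact h (by simp [h'])
  have h1 := norm_lt_of_fourierS_inPacket_ne_zero P m e X i (left_ne_zero_of_mul hξ)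
  have h2 := left_ne_zero_of_mul (right_ne_zero_of_mul hξ)
  have h3 := norm_le_norm_add_norm_sub' ξ ((2 : ℝ) ^ P.ℓ i • e)
  have h4 := norm_le_norm_add_norm_sub ξ ((2 : ℝ) ^ P.ℓ i • e)
  rw [norm_smul ((2 : ℝ) ^ P.ℓ i), he, norm_pow, Real.norm_ofNat, mul_one] at h3 h4
  have hpos : (0 : ℝ) < 2 ^ P.ℓ i := by positivity
  constructor
  · have h5 := norm_le_of_LPhat_ne_zero D h2
    have h6 : (2 : ℝ) ^ P.ℓ i < 2 ^ (k + 2) := by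
      rw [pow_succ _ (k + 1)]; linarith
    have := (pow_lt_pow_iff_right₀ (one_lt_two (α := ℝ))).1 h6
    omega
  · cases k with
    | zero => omega
    | succ k =>
      have h5 := le_norm_of_LPhat_ne_zero D h2
      have h6 : (2 : ℝ) ^ k < 2 ^ (P.ℓ i + 1) := by rw [pow_succ]; linarith
      have := (pow_lt_pow_iff_right₀ (one_lt_two (α := ℝ))).1 h6
      omega

lemma LPdist_eq_zero_of_not_close (D : LPData d) (P : Blocks) (m : ℝ) {e : RD d} (he : ‖e‖ = 1)
    (X : ℕ → RD d) (u : TD d)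
    (hu : ∀ ψ : 𝓢(RD d, ℂ), HasSum (fun i => ∫ x, inPacket P m e X i x * ψ x) (u ψ))
    {k : ℕ} (hk : ∀ i, ¬(P.ℓ i ≤ k + 1 ∧ k ≤ P.ℓ i + 1)) (x : RD d) : LPdist D k u x = 0 := by
  rw [LPdist_eq]
  refine (hu _).unique ?_
  have : ∀ i, ∫ y, inPacket P m e X i y * LPkernelS D k x y = 0 := fun i => by
    by_contra h
    exact hk i (close_of_integral_inPacket_ne_zero D P m he X h)
  simp_rw [this]
  exact hasSum_zero

lemma LPdist_eq_of_close (D : LPData d) (P : Blocks) (m : ℝ) {e : RD d} (he : ‖e‖ = 1)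
    (X : ℕ → RD d) (u : TD d)
    (hu : ∀ ψ : 𝓢(RD d, ℂ), HasSum (fun i => ∫ x, inPacket P m e X i x * ψ x) (u ψ))
    {i k : ℕ} (hk : P.ℓ i ≤ k + 1 ∧ k ≤ P.ℓ i + 1) (x : RD d) :
    LPdist D k u x = ∫ y, inPacket P m e X i y * LPkernelS D k x y := by
  rw [LPdist_eq]
  refine (hu _).unique (hasSum_single i fun i' hi' => ?_)
  by_contra h
  have := close_of_integral_inPacket_ne_zero D P m he X h
  exact hi' (P.eq_of_close (by omega) (by omega))

lemma two_rpow_eq_ofReal (t : ℝ) : (2 : ℝ≥0∞) ^ t = ENNReal.ofReal (2 ^ t) := by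
  rw [← ENNReal.ofReal_rpow_of_pos two_pos, ENNReal.ofReal_ofNat]

lemma nnnorm_rpow_eq_ofReal (z : ℂ) {q : ℝ} (hq : 0 ≤ q) :
    (‖z‖₊ : ℝ≥0∞) ^ q = ENNReal.ofReal (‖z‖ ^ q) := by
  rw [← ENNReal.ofReal_rpow_of_nonneg (norm_nonneg z) hq, ofReal_norm, enorm_eq_nnnorm]

/-- The `L^q` mass of a decaying weight. -/
def weightMass (d M : ℕ) (q : ℝ) : ℝ≥0∞ :=
  ∫⁻ x : RD d, ENNReal.ofReal ((((1 + ‖x‖) ^ M)⁻¹) ^ q)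

lemma weightMass_ne_top {M : ℕ} {q : ℝ} (h : d < M * q) : weightMass d M q ≠ ⊤ := by
  have h1 := finite_integral_one_add_norm (E := RD d) (μ := volume) (r := M * q) (by simpa using h)
  refine (lt_of_eq_of_lt ?_ h1).ne
  refine lintegral_congr fun x => ?_
  rw [← Real.rpow_natCast, ← Real.rpow_neg (by positivity), ← Real.rpow_mul (by positivity),
    neg_mul]

lemma lintegral_weight (M : ℕ) (q : ℝ) {lam : ℝ} (hl : 0 < lam) (X : RD d) :
    ∫⁻ x : RD d, ENNReal.ofReal ((((1 + lam * ‖x - X‖) ^ M)⁻¹) ^ q)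
      = ENNReal.ofReal (lam ^ d)⁻¹ * weightMass d M q := by
  rw [lintegral_sub_right_eq_self
    (fun x : RD d => ENNReal.ofReal ((((1 + lam * ‖x‖) ^ M)⁻¹) ^ q)) X]
  have hm : Measurable fun x : RD d => ENNReal.ofReal ((((1 + ‖x‖) ^ M)⁻¹) ^ q) := by fun_prop
  have h1 : ∀ x : RD d, ENNReal.ofReal ((((1 + lam * ‖x‖) ^ M)⁻¹) ^ q)
      = (fun x : RD d => ENNReal.ofReal ((((1 + ‖x‖) ^ M)⁻¹) ^ q)) (lam • x) := by
    intro x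
    simp only [norm_smul, Real.norm_of_nonneg hl.le]
  rw [lintegral_congr h1, ← lintegral_map hm (measurable_const_smul lam),
    Measure.map_addHaar_smul volume hl.ne', lintegral_smul_measure, finrank_euclideanSpace_fin,
    abs_of_pos (by positivity), smul_eq_mul, weightMass]

lemma two_rpow_mul_le_of_close (t : ℝ) {k l : ℕ} (h1 : l ≤ k + 1) (h2 : k ≤ l + 1) :
    (2 : ℝ) ^ (t * k) ≤ 2 ^ |t| * 2 ^ (t * l) := by
  rw [← Real.rpow_add two_pos]
  refine Real.rpow_le_rpow_of_exponent_le one_le_two ?_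
  have h3 : (l : ℝ) ≤ k + 1 := by exact_mod_cast h1
  have h4 : (k : ℝ) ≤ l + 1 := by exact_mod_cast h2
  have h5 : |t * (k - l)| ≤ |t| * 1 := by
    rw [abs_mul]
    gcongr
    rw [abs_le]
    constructor <;> linarith
  have h6 := le_abs_self (t * (k - l : ℝ))
  linarith

lemma lintegral_LPdist_ne_top (D : LPData d) (P : Blocks) (m : ℝ) {e : RD d} (he : ‖e‖ = 1)
    (X : ℕ → RD d) (u : TD d)
    (hu : ∀ ψ : 𝓢(RD d, ℂ), HasSum (fun i => ∫ x, inPacket P m e X i x * ψ x) (u ψ))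
    {μ : ℕ} (hμ : 1 ≤ μ) {s q : ℝ} (hq : 0 < q)
    (hS : Summable fun i => (2 : ℝ) ^ (s * P.ℓ i * q) * P.C i ^ q *
      (((2 : ℝ) ^ P.r i) ^ d) ^ (q - 1)) :
    ∫⁻ x, ∑' j : ℕ, (2 : ℝ≥0∞) ^ ((s + m) * ((μ : ℝ) + (j : ℝ)) * q) *
      (‖LPdist D (μ + j) u x‖₊ : ℝ≥0∞) ^ q ≠ ⊤ := by
  obtain ⟨M, hM⟩ := exists_nat_gt ((d : ℝ) / q)
  rw [div_lt_iff₀ hq] at hM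
  obtain ⟨B, hB0, hB⟩ := exists_norm_packet_le d M
  obtain ⟨K, hK0, hK⟩ := exists_norm_integral_mul_kernelS_le D.φ M
  set Q : ℕ → ℝ := fun i => K * (B * ((2 : ℝ) ^ (-m * P.ℓ i) * P.C i * (2 ^ P.r i) ^ d)) with hQ
  set w : ℕ → RD d → ℝ := fun i x => ((1 + 2 ^ P.r i * ‖x - X i‖) ^ M)⁻¹ with hw
  have hC := P.C_nonneg
  have hQ0 : ∀ i, 0 ≤ Q i := fun i => by have := hC i; positivity
  have hw0 : ∀ i x, 0 ≤ w i x := fun i x => by positivity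
  have hpiece : ∀ i k x, 1 ≤ k → P.ℓ i ≤ k + 1 → k ≤ P.ℓ i + 1 →
      ‖LPdist D k u x‖ ≤ Q i * w i x := by
    intro i k x hk h1 h2
    rw [LPdist_eq_of_close D P m he X u hu ⟨h1, h2⟩]
    obtain ⟨k, rfl⟩ : ∃ k', k = k' + 1 := ⟨k - 1, by omega⟩
    have hr : (2 : ℝ) ^ P.r i ≤ 2 * 2 ^ (k + 1) := by
      rw [← pow_succ']
      exact pow_le_pow_right₀ one_le_two ((P.r_le i).trans h1)
    have := hC i
    refine hK (2 ^ (k + 1)) (2 ^ P.r i) (by positivity) (by positivity) hr _ (X i) _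
      (by positivity) (fun z => ?_) x
    rw [← norm_packet_coeff P (-m) i]
    exact hB _ _ _ _ z
  set t : ℝ := (s + m) * q with ht
  set g : ℕ → ℝ := fun i => 2 ^ |t| * 2 ^ (t * P.ℓ i) * Q i ^ q with hg
  have hg0 : ∀ i, 0 ≤ g i := fun i => by have := hQ0 i; positivity
  have hpt : ∀ x, ∑' j : ℕ, (2 : ℝ≥0∞) ^ ((s + m) * ((μ : ℝ) + (j : ℝ)) * q) *
      (‖LPdist D (μ + j) u x‖₊ : ℝ≥0∞) ^ q
      ≤ ∑' i, 3 * (ENNReal.ofReal (g i) * ENNReal.ofReal (w i x ^ q)) := by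
    intro x
    have hone : ∀ k : ℕ, 1 ≤ k → (2 : ℝ≥0∞) ^ (t * k) * (‖LPdist D k u x‖₊ : ℝ≥0∞) ^ q
        ≤ ∑' i, if k ∈ Finset.Icc (P.ℓ i - 1) (P.ℓ i + 1) then
          ENNReal.ofReal (g i) * ENNReal.ofReal (w i x ^ q) else 0 := by
      intro k hk
      by_cases hex : ∃ i, P.ℓ i ≤ k + 1 ∧ k ≤ P.ℓ i + 1
      · obtain ⟨i, h1, h2⟩ := hex
        refine le_trans ?_ (ENNReal.le_tsum i)
        rw [if_pos (Finset.mem_Icc.2 ⟨by omega, h2⟩), two_rpow_eq_ofReal,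
          nnnorm_rpow_eq_ofReal _ hq.le, ← ENNReal.ofReal_mul (by positivity),
          ← ENNReal.ofReal_mul (hg0 i)]
        refine ENNReal.ofReal_le_ofReal ?_
        calc _ ≤ (2 ^ |t| * 2 ^ (t * P.ℓ i)) * (Q i * w i x) ^ q := by
              gcongr
              · exact two_rpow_mul_le_of_close t h1 h2
              · exact hpiece i k x hk h1 h2
          _ = _ := by rw [Real.mul_rpow (hQ0 i) (hw0 i x)]; ring
      · push Not at hex
        rw [LPdist_eq_zero_of_not_close D P m he X u hu
          (fun i hi => absurd (hex i hi.1) (by omega)) x]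
        simp [hq]
    calc _ ≤ ∑' j : ℕ, ∑' i, (fun k => if k ∈ Finset.Icc (P.ℓ i - 1) (P.ℓ i + 1) then
          ENNReal.ofReal (g i) * ENNReal.ofReal (w i x ^ q) else 0) (μ + j) := by
          refine ENNReal.tsum_le_tsum fun j => le_trans (le_of_eq ?_) (hone (μ + j) (by omega))
          congr 2
          push_cast
          rw [ht]
          ring
      _ = ∑' i, ∑' j : ℕ, (fun k => if k ∈ Finset.Icc (P.ℓ i - 1) (P.ℓ i + 1) then
          ENNReal.ofReal (g i) * ENNReal.ofReal (w i x ^ q) else 0) (μ + j) := ENNReal.tsum_comm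
      _ ≤ _ := by
          refine ENNReal.tsum_le_tsum fun i => ?_
          refine (ENNReal.tsum_comp_le_tsum_of_injective (add_right_injective μ)
            (fun k => if k ∈ Finset.Icc (P.ℓ i - 1) (P.ℓ i + 1) then
              ENNReal.ofReal (g i) * ENNReal.ofReal (w i x ^ q) else 0)).trans ?_
          rw [tsum_eq_sum (s := Finset.Icc (P.ℓ i - 1) (P.ℓ i + 1)) (fun k hk => if_neg hk),
            Finset.sum_congr rfl (fun k hk => if_pos hk), Finset.sum_const, nsmul_eq_mul]
          gcongr
          rw [Nat.card_Icc]
          exact_mod_cast (by omega : P.ℓ i + 1 + 1 - (P.ℓ i - 1) ≤ 3)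
  refine ((lintegral_mono hpt).trans_lt ?_).ne
  rw [lintegral_tsum (fun i => by
    refine Measurable.aemeasurable ?_
    simp only [hw]
    fun_prop)]
  have hterm : ∀ i, ∫⁻ x, 3 * (ENNReal.ofReal (g i) * ENNReal.ofReal (w i x ^ q))
      = (3 * ENNReal.ofReal (2 ^ |t| * (K * B) ^ q) * weightMass d M q) *
        ENNReal.ofReal ((2 : ℝ) ^ (s * P.ℓ i * q) * P.C i ^ q *
          (((2 : ℝ) ^ P.r i) ^ d) ^ (q - 1)) := by
    intro i
    rw [lintegral_const_mul' _ _ (by norm_num), lintegral_const_mul' _ _ ENNReal.ofReal_ne_top,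
      lintegral_weight M q (by positivity)]
    have hgi : g i * (((2 : ℝ) ^ P.r i) ^ d)⁻¹ = (2 ^ |t| * (K * B) ^ q) *
        ((2 : ℝ) ^ (s * P.ℓ i * q) * P.C i ^ q * (((2 : ℝ) ^ P.r i) ^ d) ^ (q - 1)) := by
      have hCi := hC i
      have e1 : Q i ^ q = (K * B) ^ q * (2 ^ (-m * P.ℓ i * q) * P.C i ^ q *
          (((2 : ℝ) ^ P.r i) ^ d) ^ q) := by
        rw [Real.rpow_mul two_pos.le, ← Real.mul_rpow (by positivity) hCi,
          ← Real.mul_rpow (by positivity) (by positivity),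
          ← Real.mul_rpow (by positivity) (by positivity)]
        congr 1
        rw [hQ]
        ring
      have e2 : (2 : ℝ) ^ (s * P.ℓ i * q) = 2 ^ (t * P.ℓ i) * 2 ^ (-m * P.ℓ i * q) := by
        rw [← Real.rpow_add two_pos, ht]
        congr 1
        ring
      rw [hg, Real.rpow_sub_one (by positivity), e2]
      simp only [e1]
      ring
    rw [← mul_assoc (ENNReal.ofReal (g i)), ← ENNReal.ofReal_mul (hg0 i), hgi,
      ENNReal.ofReal_mul (by positivity)]
    ring
  rw [tsum_congr hterm, ENNReal.tsum_mul_left]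
  refine ENNReal.mul_lt_top (ENNReal.mul_lt_top (ENNReal.mul_lt_top (by norm_num)
    ENNReal.ofReal_lt_top) (weightMass_ne_top hM).lt_top) ?_
  rw [← ENNReal.ofReal_tsum_of_nonneg (fun i => by have := hC i; positivity) hS]
  exact ENNReal.ofReal_lt_top

lemma input_norm_ne_top (D : LPData d) (P : Blocks) (m : ℝ) {e : RD d} (he : ‖e‖ = 1)
    (X : ℕ → RD d) (u : TD d)
    (hu : ∀ ψ : 𝓢(RD d, ℂ), HasSum (fun i => ∫ x, inPacket P m e X i x * ψ x) (u ψ))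
    {μ : ℕ} (hμ : 1 ≤ μ) (hℓ : ∀ i, μ + 3 ≤ P.ℓ i) {s q : ℝ} (hq : 0 < q)
    (hS : Summable fun i => (2 : ℝ) ^ (s * P.ℓ i * q) * P.C i ^ q *
      (((2 : ℝ) ^ P.r i) ^ d) ^ (q - 1)) :
    ((⨆ k ∈ Finset.range μ,
        (2 : ℝ≥0∞) ^ ((k : ℝ) * (s + m)) * ⨆ x : RD d, (‖LPdist D k u x‖₊ : ℝ≥0∞)) +
      ⨆ n : Fin d → ℤ, cubePiece d μ n μ (s + m) q (fun k x => LPdist D k u x)) ≠ ⊤ := by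
  refine ENNReal.add_ne_top.2 ⟨?_, ?_⟩
  · refine ne_top_of_le_ne_top ENNReal.zero_ne_top (iSup₂_le fun k hk => ?_)
    have hk := Finset.mem_range.1 hk
    have h0 : ∀ x, LPdist D k u x = 0 :=
      LPdist_eq_zero_of_not_close D P m he X u hu fun i hi => by have := hℓ i; omega
    simp [h0]
  · have h := lintegral_LPdist_ne_top D P m he X u hu hμ hq hS
    refine ne_top_of_le_ne_top (ENNReal.rpow_ne_top_of_nonneg (y := 1 / q) (by positivity)
      (ENNReal.mul_ne_top (a := (2 : ℝ≥0∞) ^ ((μ : ℝ) * (d : ℝ))) ?_ h)) (iSup_le fun n => ?_)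
    · rw [two_rpow_eq_ofReal]
      exact ENNReal.ofReal_ne_top
    · rw [cubePiece]
      gcongr
      exact Measure.restrict_le_self

end

/-! ### The output series and the divergence of its norm -/

section

variable {d : ℕ}

/-- The points at which the wave packets are placed. -/
def site (d μ p : ℕ) : RD d :=
  WithLp.toLp 2 fun i => (if (i : ℕ) = 0 then (2 : ℝ) ^ p else 0) + (2 ^ (μ + 1))⁻¹

lemma site_apply (μ p : ℕ) (i : Fin d) :
    site d μ p i = (if (i : ℕ) = 0 then (2 : ℝ) ^ p else 0) + (2 ^ (μ + 1))⁻¹ := rfl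

lemma two_pow_le_norm_site (hd : 1 ≤ d) (μ p : ℕ) : 2 ^ p ≤ ‖site d μ p‖ := by
  refine le_trans ?_ (PiLp.norm_apply_le (site d μ p) ⟨0, hd⟩)
  rw [site_apply, if_pos rfl, Real.norm_of_nonneg (by positivity)]
  exact le_add_of_nonneg_right (by positivity)

lemma two_pow_half_le_norm_site_sub (hd : 1 ≤ d) (μ : ℕ) {p p' : ℕ} (h : p' ≠ p) :
    2 ^ p' / 2 ≤ ‖site d μ p - site d μ p'‖ := by
  refine le_trans ?_ (PiLp.norm_apply_le (site d μ p - site d μ p') ⟨0, hd⟩)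
  rw [PiLp.sub_apply, site_apply, site_apply, if_pos rfl, if_pos rfl, add_sub_add_right_eq_sub,
    Real.norm_eq_abs]
  have hp' : (0 : ℝ) < 2 ^ p' := by positivity
  rcases lt_or_gt_of_ne h with h | h
  · have h1 : (2 : ℝ) ^ (p' + 1) ≤ 2 ^ p := pow_le_pow_right₀ one_le_two h
    rw [pow_succ] at h1
    exact (by linarith : (2 : ℝ) ^ p' / 2 ≤ 2 ^ p - 2 ^ p').trans (le_abs_self _)
  · have h1 : (2 : ℝ) ^ (p + 1) ≤ 2 ^ p' := pow_le_pow_right₀ one_le_two h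
    rw [pow_succ] at h1
    exact (by linarith : (2 : ℝ) ^ p' / 2 ≤ -(2 ^ p - 2 ^ p')).trans (neg_le_abs _)

/-- The index of the dyadic cube of level `μ` centred at `site d μ p`. -/
def siteIndex (d μ p : ℕ) (i : Fin d) : ℤ := if (i : ℕ) = 0 then 2 ^ (p + μ) else 0

lemma mem_dyadicCube_of_norm_sub_site_lt {μ p : ℕ} {x : RD d}
    (h : ‖x - site d μ p‖ < (2 ^ (μ + 1))⁻¹) : x ∈ dyadicCube d μ (siteIndex d μ p) := by
  intro i
  have h1 := (PiLp.norm_apply_le (x - site d μ p) i).trans_lt h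
  rw [PiLp.sub_apply, site_apply, Real.norm_eq_abs, abs_lt] at h1
  have h2 : (siteIndex d μ p i : ℝ) * (2 : ℝ) ^ (-(μ : ℤ)) = if (i : ℕ) = 0 then (2 : ℝ) ^ p else 0 := by
    rw [siteIndex, zpow_neg, zpow_natCast]
    split_ifs
    · push_cast
      rw [pow_add, mul_inv_cancel_right₀ (by positivity)]
    · simp
  have h3 : (2 : ℝ) ^ (-(μ : ℤ)) = 2 * (2 ^ (μ + 1))⁻¹ := by
    rw [zpow_neg, zpow_natCast, pow_succ, mul_inv, mul_comm, mul_assoc, inv_mul_cancel₀ two_ne_zero,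
      mul_one]
  rw [add_mul, one_mul, h2, h3]
  constructor <;> linarith [h1.1, h1.2]

lemma integral_LPhat_mul_expChar (D : LPData d) (k : ℕ) (z : RD d) :
    ∫ ξ, LPhat D k ξ * expChar ⟪z, ξ⟫ = LPkernel D k z := by
  have h := fourierS_eq (fourierInvS (LPkernelS D k z)) 0
  rw [fourierS_fourierInvS, LPkernelS, kernelS_apply, sub_zero, ← LPkernel_eq] at h
  rw [h]
  congr 1
  ext ξ
  rw [fourierInvS_kernelS _ (by positivity : (0 : ℝ) < 2 ^ k), ← LPhat_eq, inner_zero_right,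
    neg_zero, expChar_zero, one_mul]

/-- A wave packet concentrated at a scale finer than `2^{-j}` acts like a multiple of a point mass. -/
lemma integral_outPacket_mul_LPkernelS (D : LPData d) (P : Blocks) (X : ℕ → RD d) {i j : ℕ}
    (h : j + 5 ≤ P.r i) (x : RD d) :
    ∫ y, outPacket P X i y * LPkernelS D j x y = P.C i * LPkernel D j (x - X i) := by
  rw [integral_mul_LPkernelS, ← integral_LPhat_mul_expChar, ← integral_const_mul]
  congr 1
  ext ξ
  by_cases h0 : LPhat D j ξ = 0
  · simp [h0]
  have h1 := norm_le_of_LPhat_ne_zero D h0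
  have h2 : (2 : ℝ) ^ (j + 5) ≤ 2 ^ P.r i := pow_le_pow_right₀ one_le_two h
  rw [outPacket, fourierS_packet, packetHatFun, sub_zero, freqBump_eq_one, inner_sub_left,
    sub_eq_add_neg, expChar_add, Complex.ofReal_one]
  · ring
  · rw [norm_smul, norm_inv, norm_pow, Real.norm_ofNat, inv_mul_le_iff₀ (by positivity)]
    have h3 : (2 : ℝ) ^ (j + 5) = 16 * 2 ^ (j + 1) := by ring
    linarith

/-- Wave packets placed at the other sites are negligible near a given site. -/
lemma exists_norm_integral_outPacket_le (hd : 1 ≤ d) (D : LPData d) (P : Blocks) (μ : ℕ) :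
    ∃ K : ℝ, 0 ≤ K ∧ ∀ (j p i : ℕ) (x : RD d), 1 ≤ j → P.p i ≠ p → ‖x - site d μ p‖ ≤ 1 / 2 →
      ‖∫ y, outPacket P (fun i => site d μ (P.p i)) i y * LPkernelS D j x y‖ ≤ K * (1 / 2) ^ i := by
  set M := P.L + d + 1 with hM
  obtain ⟨B, hB0, hB⟩ := exists_norm_packet_le d M
  obtain ⟨K, hK0, hK⟩ := exists_norm_integral_mul_kernelS_le D.φ M
  refine ⟨K * B * 2 ^ M, by positivity, fun j p i x hj hp hx => ?_⟩
  obtain ⟨j, rfl⟩ := Nat.exists_eq_add_of_le' hj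
  have hC := P.C_nonneg i
  have hr : (1 : ℝ) ≤ 2 ^ P.r i := one_le_pow₀ one_le_two
  have h2j : (1 : ℝ) ≤ 2 ^ (j + 1) := one_le_pow₀ one_le_two
  have h1 : ∀ z, ‖outPacket P (fun i => site d μ (P.p i)) i z‖
      ≤ B * (P.C i * (2 ^ P.r i) ^ d) * ((1 + 1 * ‖z - site d μ (P.p i)‖) ^ M)⁻¹ := by
    intro z
    refine (hB _ _ _ _ _).trans ?_
    rw [Complex.norm_real, Real.norm_of_nonneg hC]
    gcongr
  refine (hK (2 ^ (j + 1)) 1 (by positivity) zero_le_one (by linarith) _ _ _ (by positivity) h1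
    x).trans ?_
  have h3 : (2 : ℝ) ^ P.ℓ i / 2 ≤ 1 + 1 * ‖x - site d μ (P.p i)‖ := by
    have h4 := two_pow_half_le_norm_site_sub hd μ hp
    have h5 := norm_sub_le_norm_sub_add_norm_sub (site d μ p) x (site d μ (P.p i))
    rw [norm_sub_rev (site d μ p) x] at h5
    have h6 : (2 : ℝ) ^ P.ℓ i ≤ 2 ^ P.p i := pow_le_pow_right₀ one_le_two (P.le_p i)
    linarith
  have h4 : P.C i * (2 ^ P.r i) ^ d ≤ (2 ^ P.ℓ i) ^ (P.L + d) := by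
    rw [pow_add]
    have h5 := P.C_le i
    rw [mul_comm, pow_mul] at h5
    have h6 : (2 : ℝ) ^ P.r i ≤ 2 ^ P.ℓ i := pow_le_pow_right₀ one_le_two (P.r_le i)
    gcongr
  have h7 : ((2 : ℝ) ^ P.ℓ i)⁻¹ ≤ (1 / 2) ^ i := by
    rw [one_div, inv_pow]
    gcongr
    · norm_num
    · exact P.le_ℓ i
  calc K * (B * (P.C i * (2 ^ P.r i) ^ d)) * ((1 + 1 * ‖x - site d μ (P.p i)‖) ^ M)⁻¹
      ≤ K * (B * (2 ^ P.ℓ i) ^ (P.L + d)) * ((2 ^ P.ℓ i / 2) ^ M)⁻¹ := by gcongr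
    _ = K * B * 2 ^ M * (2 ^ P.ℓ i)⁻¹ := by
        rw [hM, div_pow, pow_succ ((2 : ℝ) ^ P.ℓ i)]
        field_simp
    _ ≤ _ := by gcongr

/-- The total amplitude of the wave packets placed at the `p`-th site. -/
def Blocks.mass (P : Blocks) (p : ℕ) : ℝ :=
  ∑ i ∈ (Finset.range (p + 1)).filter (fun i => P.p i = p), P.C i

lemma Blocks.mass_nonneg (P : Blocks) (p : ℕ) : 0 ≤ P.mass p :=
  Finset.sum_nonneg fun i _ => P.C_nonneg i

lemma exists_norm_LPdist_sub_le (hd : 1 ≤ d) (D : LPData d) (P : Blocks) (μ : ℕ) (Tf : TD d)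
    (hT : ∀ ψ : 𝓢(RD d, ℂ),
      HasSum (fun i => ∫ x, outPacket P (fun i => site d μ (P.p i)) i x * ψ x) (Tf ψ)) :
    ∃ K : ℝ, ∀ (j p : ℕ) (x : RD d), 1 ≤ j → (∀ i, P.p i = p → j + 5 ≤ P.r i) →
      ‖x - site d μ p‖ ≤ 1 / 2 →
      ‖LPdist D j Tf x - P.mass p * LPkernel D j (x - site d μ p)‖ ≤ K := by
  obtain ⟨K, hK0, hK⟩ := exists_norm_integral_outPacket_le hd D P μ
  refine ⟨K * 2, fun j p x hj hp hx => ?_⟩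
  have h1 := hT (LPkernelS D j x)
  rw [← LPdist_eq] at h1
  have h2 : HasSum (fun i => if P.p i = p then (P.C i : ℂ) * LPkernel D j (x - site d μ p) else 0)
      (P.mass p * LPkernel D j (x - site d μ p)) := by
    rw [Blocks.mass, Complex.ofReal_sum, Finset.sum_mul, Finset.sum_filter]
    refine hasSum_sum_of_ne_finset_zero fun i hi => if_neg fun h => hi ?_
    have := P.le_ℓ i
    have := P.le_p i
    exact Finset.mem_range.2 (by omega)
  have h3 := hasSum_geometric_two.mul_left K
  rw [← (h1.sub h2).tsum_eq]
  refine tsum_of_norm_bounded h3 fun i => ?_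
  by_cases hi : P.p i = p
  · rw [if_pos hi, integral_outPacket_mul_LPkernelS D P _ (hp i hi), hi, sub_self, norm_zero]
    positivity
  · rw [if_neg hi, sub_zero]
    exact hK j p i x hj hi hx

/-- The Littlewood–Paley kernels are large on a substantial part of small cubes. -/
lemma exists_le_norm_LPkernel (hd : 1 ≤ d) (D : LPData d) (μ : ℕ) :
    ∃ c V : ℝ, 0 < c ∧ 0 < V ∧ ∃ j₀ : ℕ, 1 ≤ j₀ ∧ μ ≤ j₀ ∧ ∀ j, j₀ ≤ j → ∀ X : RD d,
      ∃ E : Set (RD d), MeasurableSet E ∧ volume E = ENNReal.ofReal (V * ((2 ^ j) ^ d)⁻¹) ∧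
        ∀ x ∈ E, ‖x - X‖ < (2 ^ (μ + 1))⁻¹ ∧ c * (2 ^ j) ^ d ≤ ‖LPkernel D j (x - X)‖ := by
  obtain ⟨y₀, hy₀⟩ := exists_φ_ne_zero hd D
  have hy : 0 < ‖D.φ y₀‖ := norm_pos_iff.2 hy₀
  have hnear : ∀ᶠ y in nhds y₀, ‖D.φ y₀‖ / 2 < ‖D.φ y‖ :=
    (D.φ.continuous.norm.tendsto y₀).eventually (lt_mem_nhds (half_lt_self hy))
  obtain ⟨ρ, hρ, hball⟩ := Metric.eventually_nhds_iff_ball.1 hnear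
  obtain ⟨N, hN⟩ := pow_unbounded_of_one_lt ((2 : ℝ) ^ (μ + 1) * (‖y₀‖ + ρ)) one_lt_two
  have hVpos : 0 < volume (Metric.ball (0 : RD d) ρ) := Metric.measure_ball_pos _ _ hρ
  have hVtop : volume (Metric.ball (0 : RD d) ρ) ≠ ⊤ := measure_ball_lt_top.ne
  refine ⟨‖D.φ y₀‖ / 2, (volume (Metric.ball (0 : RD d) ρ)).toReal, by positivity,
    ENNReal.toReal_pos hVpos.ne' hVtop, max N (max 1 μ), by simp, by simp, fun j hj X => ?_⟩
  have hjN : N ≤ j := (le_max_left _ _).trans hj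
  have hj1 : 1 ≤ j := (le_max_left _ _).trans ((le_max_right _ _).trans hj)
  have hpos : (0 : ℝ) < 2 ^ j := by positivity
  refine ⟨Metric.ball (X + ((2 : ℝ) ^ j)⁻¹ • y₀) (((2 : ℝ) ^ j)⁻¹ * ρ), measurableSet_ball, ?_,
    fun x hx => ?_⟩
  · rw [Measure.addHaar_ball_mul_of_pos volume _ (by positivity), finrank_euclideanSpace_fin,
      ENNReal.ofReal_mul ENNReal.toReal_nonneg, ENNReal.ofReal_toReal hVtop, mul_comm, inv_pow]
  · obtain ⟨z, hz⟩ : ∃ z, z = (2 : ℝ) ^ j • (x - X) := ⟨_, rfl⟩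
    have hxz : x - X = ((2 : ℝ) ^ j)⁻¹ • z := by rw [hz, inv_smul_smul₀ hpos.ne']
    have hzb : z ∈ Metric.ball y₀ ρ := by
      rw [Metric.mem_ball, dist_eq_norm, ← sub_sub, hxz, ← smul_sub, norm_smul, norm_inv, norm_pow,
        Real.norm_ofNat] at hx
      rw [Metric.mem_ball, dist_eq_norm]
      exact lt_of_mul_lt_mul_left hx (by positivity)
    have hzn : ‖z‖ < ‖y₀‖ + ρ := by
      rw [Metric.mem_ball, dist_eq_norm] at hzb
      have := norm_le_norm_add_norm_sub' z y₀
      linarith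
    constructor
    · rw [hxz, norm_smul, norm_inv, norm_pow, Real.norm_ofNat, inv_mul_lt_iff₀ hpos,
        ← div_eq_mul_inv, lt_div_iff₀ (by positivity)]
      have h1 : (2 : ℝ) ^ N ≤ 2 ^ j := pow_le_pow_right₀ one_le_two hjN
      have h2 := mul_lt_mul_of_pos_left hzn (by positivity : (0 : ℝ) < 2 ^ (μ + 1))
      linarith
    · obtain ⟨j, rfl⟩ := Nat.exists_eq_add_of_le' hj1
      rw [LPkernel_eq, norm_mul, Complex.norm_real, Real.norm_of_nonneg (by positivity), mul_comm,
        ← hz]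
      exact mul_le_mul_of_nonneg_left (hball z hzb).le (by positivity)

lemma sum_lintegral_le_lintegral_sum {α ι : Type*} [MeasurableSpace α] (ν : Measure α)
    (J : Finset ι) (f : ι → α → ℝ≥0∞) :
    ∑ j ∈ J, ∫⁻ x, f j x ∂ν ≤ ∫⁻ x, ∑ j ∈ J, f j x ∂ν := by
  classical
  induction J using Finset.induction_on with
  | empty => simp
  | insert a J ha ih =>
    simp_rw [Finset.sum_insert ha]
    exact (add_le_add_right ih _).trans (le_lintegral_add _ _)

/-- The norm of the output diverges as soon as the packets at suitable sites carry enough mass at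
suitable scales. -/
lemma output_norm_eq_top (hd : 1 ≤ d) (D : LPData d) (μ : ℕ) :
    ∃ j₀ : ℕ, 1 ≤ j₀ ∧ ∀ (P : Blocks) (Tf : TD d),
      (∀ ψ : 𝓢(RD d, ℂ),
        HasSum (fun i => ∫ x, outPacket P (fun i => site d μ (P.p i)) i x * ψ x) (Tf ψ)) →
      ∀ s q : ℝ, 0 < q →
      (∀ K R : ℝ, ∃ (p : ℕ) (J : Finset ℕ),
        (∀ j ∈ J, j₀ ≤ j ∧ (∀ i, P.p i = p → j + 5 ≤ P.r i) ∧ K ≤ P.mass p * (2 ^ j) ^ d) ∧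
        R ≤ ∑ j ∈ J, (2 : ℝ) ^ (s * j * q) * (P.mass p ^ q * (((2 : ℝ) ^ j) ^ d) ^ (q - 1))) →
      (⨆ n : Fin d → ℤ, cubePiece d μ n μ s q (fun k x => LPdist D k Tf x)) = ⊤ := by
  obtain ⟨c, V, hc, hV, j₀, hj₀1, hj₀μ, hE⟩ := exists_le_norm_LPkernel hd D μ
  refine ⟨j₀, hj₀1, fun P Tf hT s q hq hbig => ?_⟩
  obtain ⟨K, hK⟩ := exists_norm_LPdist_sub_le hd D P μ Tf hT
  have hpiece : ∀ p j : ℕ, j₀ ≤ j → (∀ i, P.p i = p → j + 5 ≤ P.r i) →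
      2 * K / c ≤ P.mass p * (2 ^ j) ^ d →
      ENNReal.ofReal (V * (c / 2) ^ q * ((2 : ℝ) ^ (s * j * q) *
        (P.mass p ^ q * (((2 : ℝ) ^ j) ^ d) ^ (q - 1)))) ≤
      ∫⁻ x in dyadicCube d μ (siteIndex d μ p),
        (2 : ℝ≥0∞) ^ (s * j * q) * (‖LPdist D j Tf x‖₊ : ℝ≥0∞) ^ q := by
    intro p j hj hp hmass
    obtain ⟨E, hEm, hEv, hEx⟩ := hE j hj (site d μ p)
    have hS := P.mass_nonneg p
    have hμ1 : ((2 : ℝ) ^ (μ + 1))⁻¹ ≤ 1 / 2 := by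
      rw [one_div, pow_succ]
      gcongr
      exact le_mul_of_one_le_left two_pos.le (one_le_pow₀ one_le_two)
    have hlow : ∀ x ∈ E, ENNReal.ofReal ((2 : ℝ) ^ (s * j * q) *
        (P.mass p * (c / 2) * (2 ^ j) ^ d) ^ q) ≤
        (2 : ℝ≥0∞) ^ (s * j * q) * (‖LPdist D j Tf x‖₊ : ℝ≥0∞) ^ q := by
      intro x hx
      obtain ⟨hx1, hx2⟩ := hEx x hx
      have h1 := hK j p x (hj₀1.trans hj) hp (hx1.le.trans hμ1)
      have h2 : P.mass p * (c * (2 ^ j) ^ d) ≤ ‖(P.mass p : ℂ) * LPkernel D j (x - site d μ p)‖ := by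
        rw [norm_mul, Complex.norm_real, Real.norm_of_nonneg hS]
        gcongr
      have h3 := norm_le_norm_add_norm_sub (LPdist D j Tf x)
        ((P.mass p : ℂ) * LPkernel D j (x - site d μ p))
      rw [div_le_iff₀ hc] at hmass
      rw [two_rpow_eq_ofReal, nnnorm_rpow_eq_ofReal _ hq.le, ← ENNReal.ofReal_mul (by positivity)]
      refine ENNReal.ofReal_le_ofReal ?_
      gcongr
      linarith
    calc _ = ENNReal.ofReal ((2 : ℝ) ^ (s * j * q) * (P.mass p * (c / 2) * (2 ^ j) ^ d) ^ q) *
          volume E := by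
          rw [hEv, ← ENNReal.ofReal_mul (by positivity), Real.mul_rpow (by positivity)
            (by positivity), Real.mul_rpow hS (by positivity), Real.rpow_sub_one (by positivity)]
          congr 1
          ring
      _ = ∫⁻ _ in E, ENNReal.ofReal ((2 : ℝ) ^ (s * j * q) *
          (P.mass p * (c / 2) * (2 ^ j) ^ d) ^ q) := (setLIntegral_const _ _).symm
      _ ≤ ∫⁻ x in E, (2 : ℝ≥0∞) ^ (s * j * q) * (‖LPdist D j Tf x‖₊ : ℝ≥0∞) ^ q :=
          setLIntegral_mono' hEm hlow
      _ ≤ _ := lintegral_mono_set fun x hx => mem_dyadicCube_of_norm_sub_site_lt (hEx x hx).1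
  refine ENNReal.eq_top_of_forall_nnreal_le fun T => ?_
  obtain ⟨p, J, hJ, hR⟩ := hbig (2 * K / c) ((T : ℝ) ^ q / (V * (c / 2) ^ q))
  refine le_trans ?_ (le_iSup _ (siteIndex d μ p))
  rw [div_le_iff₀' (by positivity), Finset.mul_sum] at hR
  have hsum : (T : ℝ≥0∞) ^ q ≤ ∫⁻ x in dyadicCube d μ (siteIndex d μ p),
      ∑' j : ℕ, (2 : ℝ≥0∞) ^ (s * ((μ : ℝ) + (j : ℝ)) * q) *
        (‖LPdist D (μ + j) Tf x‖₊ : ℝ≥0∞) ^ q := by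
    have hS := P.mass_nonneg p
    calc (T : ℝ≥0∞) ^ q = ENNReal.ofReal ((T : ℝ) ^ q) := by
          rw [← ENNReal.ofReal_rpow_of_nonneg T.coe_nonneg hq.le, ENNReal.ofReal_coe_nnreal]
      _ ≤ _ := ENNReal.ofReal_le_ofReal hR
      _ = _ := ENNReal.ofReal_sum_of_nonneg fun j _ => by positivity
      _ ≤ ∑ j ∈ J, ∫⁻ x in dyadicCube d μ (siteIndex d μ p),
          (2 : ℝ≥0∞) ^ (s * j * q) * (‖LPdist D j Tf x‖₊ : ℝ≥0∞) ^ q :=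
          Finset.sum_le_sum fun j hj => hpiece p j (hJ j hj).1 (hJ j hj).2.1 (hJ j hj).2.2
      _ ≤ _ := sum_lintegral_le_lintegral_sum _ _ _
      _ ≤ _ := lintegral_mono fun x => ?_
    have hinj : Set.InjOn (fun j => j - μ) (J : Set ℕ) := by
      intro a ha b hb hab
      have := (hJ a ha).1
      have := (hJ b hb).1
      simp only at hab
      omega
    refine le_trans (le_of_eq ?_) (ENNReal.sum_le_tsum (J.image fun j => j - μ))
    rw [Finset.sum_image hinj]
    refine Finset.sum_congr rfl fun j hj => ?_
    have hμj : μ ≤ j := hj₀μ.trans (hJ j hj).1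
    rw [Nat.add_sub_cancel' hμj, Nat.cast_sub hμj, add_sub_cancel]
  rw [cubePiece, one_div, ENNReal.le_rpow_inv_iff hq]
  refine hsum.trans (le_mul_of_one_le_left zero_le ?_)
  rw [two_rpow_eq_ofReal]
  exact ENNReal.one_le_ofReal.2 (Real.one_le_rpow one_le_two (by positivity))

end

/-! ### Choice of the parameters -/

section

lemma Blocks.C_le_mass (P : Blocks) (i : ℕ) : P.C i ≤ P.mass (P.p i) := by
  refine Finset.single_le_sum (f := P.C) (fun i _ => P.C_nonneg i) ?_
  have h1 := P.le_ℓ i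
  have h2 := P.le_p i
  simp only [Finset.mem_filter, Finset.mem_range, and_true]
  omega

/-- For `s ≤ d/q - d` each site carries one packet, which is felt at many scales. -/
lemma exists_blocks_of_le {d : ℕ} (hd : 1 ≤ d) (μ j₀ : ℕ) {q s : ℝ} (hq : 0 < q)
    (hs : s ≤ d / q - d) :
    ∃ P : Blocks, (∀ i, μ + 3 ≤ P.ℓ i) ∧
      (Summable fun i => (2 : ℝ) ^ (s * P.ℓ i * q) * P.C i ^ q * (((2 : ℝ) ^ P.r i) ^ d) ^ (q - 1)) ∧
      ∀ K R : ℝ, ∃ (p : ℕ) (J : Finset ℕ),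
        (∀ j ∈ J, j₀ ≤ j ∧ (∀ i, P.p i = p → j + 5 ≤ P.r i) ∧ K ≤ P.mass p * (2 ^ j) ^ d) ∧
        R ≤ ∑ j ∈ J, (2 : ℝ) ^ (s * j * q) * (P.mass p ^ q * (((2 : ℝ) ^ j) ^ d) ^ (q - 1)) := by
  obtain ⟨L, hL⟩ := exists_nat_ge (d / q - d - s)
  obtain ⟨N, hN⟩ := exists_nat_ge (1 / q)
  set τ : ℝ := d / q - d with hτ
  have hτq : τ * q = d - d * q := by rw [hτ]; field_simp
  set l : ℕ → ℕ := fun i => μ + j₀ + 5 + 3 * 4 ^ i with hl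
  have hpow : ∀ (j : ℕ) (t : ℝ), (((2 : ℝ) ^ j) ^ d) ^ t = 2 ^ (j * d * t) := by
    intro j t
    rw [← pow_mul, ← Real.rpow_natCast, ← Real.rpow_mul two_pos.le]
    push_cast
    rfl
  let P : Blocks :=
    { ℓ := l
      r := l
      p := l
      C := fun i => 2 ^ (l i * (τ - s) - i / q)
      L := L
      gap := fun i => by
        have : 1 ≤ 4 ^ i := Nat.one_le_pow _ _ (by norm_num)
        simp only [hl, pow_succ]
        omega
      r_le := fun i => le_rfl
      le_p := fun i => le_rfl
      C_nonneg := fun i => by positivity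
      C_le := fun i => by
        rw [← Real.rpow_natCast]
        refine Real.rpow_le_rpow_of_exponent_le one_le_two ?_
        have h1 : (0 : ℝ) ≤ i / q := by positivity
        have h2 := mul_le_mul_of_nonneg_left hL (Nat.cast_nonneg (α := ℝ) (l i))
        push_cast
        linarith }
  have hPC : ∀ i, P.C i = 2 ^ (l i * (τ - s) - i / q) := fun i => rfl
  have hterm : ∀ i j : ℕ, (2 : ℝ) ^ (s * j * q) * (P.C i ^ q * (((2 : ℝ) ^ j) ^ d) ^ (q - 1))
      = 2 ^ (((l i : ℝ) - j) * (τ - s) * q - i) := by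
    intro i j
    rw [hpow, hPC, ← Real.rpow_mul two_pos.le, ← Real.rpow_add two_pos, ← Real.rpow_add two_pos]
    congr 1
    have h1 : ((i : ℝ) / q) * q = i := div_mul_cancel₀ _ hq.ne'
    linear_combination (j : ℝ) * hτq - h1
  refine ⟨P, fun i => by simp only [P, hl]; omega, ?_, fun K R => ?_⟩
  · refine summable_geometric_two.congr fun i => ?_
    rw [mul_assoc]
    refine Eq.trans ?_ (hterm i (l i)).symm
    rw [sub_self, zero_mul, zero_mul, zero_sub, Real.rpow_neg two_pos.le, Real.rpow_natCast,
      one_div, inv_pow]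
  · obtain ⟨k, hk⟩ := pow_unbounded_of_one_lt K one_lt_two
    obtain ⟨R', hR'⟩ := exists_nat_ge R
    set A : ℕ := max N (max k R') with hA
    have hAN : N ≤ A := le_max_left _ _
    have hAk : k ≤ A := (le_max_left _ _).trans (le_max_right _ _)
    have hAR : R' ≤ A := (le_max_right _ _).trans (le_max_right _ _)
    have hA2 : A < 2 ^ A := Nat.lt_two_pow_self
    have hτs : 0 ≤ τ - s := by linarith
    refine ⟨l A, Finset.Icc (j₀ + N * A + k) (l A - 5), fun j hj => ?_, ?_⟩
    · obtain ⟨hj1, hj2⟩ := Finset.mem_Icc.1 hj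
      refine ⟨by omega, fun i hi => ?_, ?_⟩
      · have : P.r i = l A := hi
        have : 5 ≤ l A := by simp only [hl]; omega
        omega
      · have h1 : ((2 : ℝ) ^ (N * A))⁻¹ ≤ P.mass (l A) := by
          refine le_trans ?_ (P.C_le_mass A)
          rw [hPC, ← Real.rpow_natCast, ← Real.rpow_neg two_pos.le]
          refine Real.rpow_le_rpow_of_exponent_le one_le_two ?_
          have h2 := mul_le_mul_of_nonneg_left hN (Nat.cast_nonneg (α := ℝ) A)
          have h3 : (0 : ℝ) ≤ l A * (τ - s) := by positivity
          rw [mul_one_div] at h2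
          push_cast
          linarith
        have h4 : (2 : ℝ) ^ (N * A + k) ≤ (2 ^ j) ^ d := by
          rw [← pow_mul]
          refine pow_le_pow_right₀ one_le_two ?_
          have := Nat.le_mul_of_pos_right j hd
          omega
        calc K ≤ 2 ^ k := hk.le
          _ = (2 ^ (N * A))⁻¹ * 2 ^ (N * A + k) := by rw [pow_add]; field_simp
          _ ≤ _ := mul_le_mul h1 h4 (by positivity) (P.mass_nonneg _)
    · have hcard : R' * 2 ^ A ≤ (Finset.Icc (j₀ + N * A + k) (l A - 5)).card := by
        rw [Nat.card_Icc]
        have h4 : (4 : ℕ) ^ A = 2 ^ A * 2 ^ A := by norm_num [← mul_pow]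
        have h5 : N * A + k ≤ 2 ^ A * 2 ^ A := by
          calc N * A + k ≤ A * A + A := by gcongr
            _ = A * (A + 1) := by ring
            _ ≤ _ := by gcongr; omega
        have h6 : R' * 2 ^ A ≤ 2 ^ A * 2 ^ A := by gcongr; omega
        simp only [hl]
        omega
      calc R ≤ R' := hR'
        _ = (R' * 2 ^ A : ℕ) * (2 ^ A : ℝ)⁻¹ := by push_cast; field_simp
        _ ≤ ((Finset.Icc (j₀ + N * A + k) (l A - 5)).card : ℝ) * (2 ^ A : ℝ)⁻¹ := by gcongr
        _ = ∑ j ∈ Finset.Icc (j₀ + N * A + k) (l A - 5), (2 ^ A : ℝ)⁻¹ := by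
            rw [Finset.sum_const, nsmul_eq_mul]
        _ ≤ _ := Finset.sum_le_sum fun j hj => ?_
      have hjl : (j : ℝ) ≤ l A := by
        have := (Finset.mem_Icc.1 hj).2
        exact_mod_cast this.trans (Nat.sub_le _ _)
      have h1 : (2 : ℝ) ^ (s * j * q) * (P.C A ^ q * (((2 : ℝ) ^ j) ^ d) ^ (q - 1))
          ≤ 2 ^ (s * j * q) * (P.mass (l A) ^ q * (((2 : ℝ) ^ j) ^ d) ^ (q - 1)) := by
        have h2 := P.C_nonneg A
        have h3 : P.C A ≤ P.mass (l A) := P.C_le_mass A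
        gcongr
      refine le_trans ?_ h1
      rw [hterm, ← Real.rpow_natCast, ← Real.rpow_neg two_pos.le]
      refine Real.rpow_le_rpow_of_exponent_le one_le_two ?_
      have h2 : 0 ≤ ((l A : ℝ) - j) * (τ - s) * q :=
        mul_nonneg (mul_nonneg (by linarith) hτs) hq.le
      linarith

/-- For `1 < q` many packets with slowly decaying amplitudes are placed at each site. -/
lemma exists_blocks_of_one_lt (d μ j₀ : ℕ) {q s : ℝ} (hq : 1 < q) (hs : s ≤ 0) :
    ∃ P : Blocks, (∀ i, μ + 3 ≤ P.ℓ i) ∧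
      (Summable fun i => (2 : ℝ) ^ (s * P.ℓ i * q) * P.C i ^ q * (((2 : ℝ) ^ P.r i) ^ d) ^ (q - 1)) ∧
      ∀ K R : ℝ, ∃ (p : ℕ) (J : Finset ℕ),
        (∀ j ∈ J, j₀ ≤ j ∧ (∀ i, P.p i = p → j + 5 ≤ P.r i) ∧ K ≤ P.mass p * (2 ^ j) ^ d) ∧
        R ≤ ∑ j ∈ J, (2 : ℝ) ^ (s * j * q) * (P.mass p ^ q * (((2 : ℝ) ^ j) ^ d) ^ (q - 1)) := by
  have hq0 : 0 < q := by linarith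
  obtain ⟨α, hα1, hα2⟩ := exists_between ((div_lt_one hq0).2 hq)
  have hα0 : 0 < α := lt_trans (by positivity) hα1
  have hαq : 1 < α * q := (div_lt_iff₀ hq0).1 hα1
  set l₀ := μ + j₀ + 5 with hl₀
  let P : Blocks :=
    { ℓ := fun i => l₀ + 3 * i
      r := fun _ => l₀
      p := fun i => l₀ + 3 * 2 ^ (Nat.log 2 (i + 1) + 1)
      C := fun i => ((i + 1 : ℕ) : ℝ) ^ (-α)
      L := 0
      gap := fun i => by omega
      r_le := fun i => by omega
      le_p := fun i => by
        have := Nat.lt_pow_succ_log_self one_lt_two (i + 1)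
        omega
      C_nonneg := fun i => by positivity
      C_le := fun i => by
        rw [zero_mul, pow_zero]
        exact Real.rpow_le_one_of_one_le_of_nonpos (by simp) (by linarith) }
  have hmass : ∀ n : ℕ, (2 : ℝ) ^ ((n : ℝ) * (1 - α) - α) ≤ P.mass (l₀ + 3 * 2 ^ (n + 1)) := by
    intro n
    have hpos : 1 ≤ 2 ^ n := Nat.one_le_two_pow
    have hsub : Finset.Ico (2 ^ n - 1) (2 ^ (n + 1) - 1) ⊆
        (Finset.range (l₀ + 3 * 2 ^ (n + 1) + 1)).filter
          (fun i => P.p i = l₀ + 3 * 2 ^ (n + 1)) := by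
      intro i hi
      obtain ⟨h1, h2⟩ := Finset.mem_Ico.1 hi
      have h3 : Nat.log 2 (i + 1) = n :=
        (Nat.log_eq_iff (Or.inr ⟨one_lt_two, by omega⟩)).2 ⟨by omega, by omega⟩
      simp only [Finset.mem_filter, Finset.mem_range, P, h3, and_true]
      omega
    have hcard : (Finset.Ico (2 ^ n - 1) (2 ^ (n + 1) - 1)).card = 2 ^ n := by
      rw [Nat.card_Ico, pow_succ]
      omega
    calc (2 : ℝ) ^ ((n : ℝ) * (1 - α) - α)
        = 2 ^ (n : ℝ) * ((2 : ℝ) ^ ((n + 1 : ℕ) : ℝ)) ^ (-α) := by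
          rw [← Real.rpow_mul two_pos.le, ← Real.rpow_add two_pos]
          congr 1
          push_cast
          ring
      _ = ∑ i ∈ Finset.Ico (2 ^ n - 1) (2 ^ (n + 1) - 1), ((2 : ℝ) ^ (n + 1)) ^ (-α) := by
          rw [Finset.sum_const, hcard, nsmul_eq_mul, Real.rpow_natCast, Real.rpow_natCast]
          push_cast
          rfl
      _ ≤ ∑ i ∈ Finset.Ico (2 ^ n - 1) (2 ^ (n + 1) - 1), P.C i := by
          refine Finset.sum_le_sum fun i hi => ?_
          have h2 : i + 1 ≤ 2 ^ (n + 1) := by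
            have := (Finset.mem_Ico.1 hi).2
            omega
          refine Real.rpow_le_rpow_of_nonpos (by positivity) ?_ (by linarith)
          exact_mod_cast h2
      _ ≤ _ := Finset.sum_le_sum_of_subset_of_nonneg hsub fun i _ _ => P.C_nonneg i
  have htop : Tendsto (fun n : ℕ => P.mass (l₀ + 3 * 2 ^ (n + 1))) atTop atTop := by
    refine tendsto_atTop_mono hmass ?_
    refine (tendsto_rpow_atTop_of_base_gt_one 2 one_lt_two).comp ?_
    exact tendsto_atTop_add_const_right _ _
      (tendsto_natCast_atTop_atTop.atTop_mul_const (by linarith))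
  refine ⟨P, fun i => by simp only [P]; omega, ?_, fun K R => ?_⟩
  · have h1 : Summable fun i : ℕ => ((i : ℕ) : ℝ) ^ (-(α * q)) :=
      Real.summable_nat_rpow.2 (by linarith)
    have h2 := ((summable_nat_add_iff 1).2 h1).mul_right ((((2 : ℝ) ^ l₀) ^ d) ^ (q - 1))
    refine Summable.of_nonneg_of_le (fun i => ?_) (fun i => ?_) h2
    · have := P.C_nonneg i
      positivity
    · have h3 : P.C i ^ q = ((i + 1 : ℕ) : ℝ) ^ (-(α * q)) := by
        rw [← neg_mul, Real.rpow_mul (by positivity)]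
      have h4 : (2 : ℝ) ^ (s * P.ℓ i * q) ≤ 1 := by
        refine Real.rpow_le_one_of_one_le_of_nonpos one_le_two ?_
        exact mul_nonpos_of_nonpos_of_nonneg
          (mul_nonpos_of_nonpos_of_nonneg hs (by positivity)) hq0.le
      rw [h3]
      refine mul_le_mul_of_nonneg_right ?_ (by positivity)
      exact mul_le_of_le_one_left (by positivity) h4
  · have hpow := (tendsto_rpow_atTop hq0).comp htop
    obtain ⟨n, hn1, hn2⟩ := ((htop.eventually_ge_atTop K).and
      (hpow.eventually_ge_atTop (R / 2 ^ (s * j₀ * q)))).exists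
    have hone : (1 : ℝ) ≤ (2 ^ j₀) ^ d := one_le_pow₀ (one_le_pow₀ one_le_two)
    refine ⟨l₀ + 3 * 2 ^ (n + 1), {j₀}, fun j hj => ?_, ?_⟩
    · rw [Finset.mem_singleton] at hj
      subst hj
      refine ⟨le_rfl, fun i _ => by simp only [P]; omega, hn1.trans ?_⟩
      exact le_mul_of_one_le_right (P.mass_nonneg _) hone
    · rw [Finset.sum_singleton]
      rw [div_le_iff₀' (by positivity)] at hn2
      refine hn2.trans (mul_le_mul_of_nonneg_left ?_ (by positivity))
      exact le_mul_of_one_le_right (Real.rpow_nonneg (P.mass_nonneg _) _)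
        (Real.one_le_rpow hone (by linarith))

lemma exists_blocks {d : ℕ} (hd : 1 ≤ d) (μ j₀ : ℕ) {q s : ℝ} (hq : 0 < q)
    (hs : s ≤ d / min 1 q - d) :
    ∃ P : Blocks, (∀ i, μ + 3 ≤ P.ℓ i) ∧
      (Summable fun i => (2 : ℝ) ^ (s * P.ℓ i * q) * P.C i ^ q * (((2 : ℝ) ^ P.r i) ^ d) ^ (q - 1)) ∧
      ∀ K R : ℝ, ∃ (p : ℕ) (J : Finset ℕ),
        (∀ j ∈ J, j₀ ≤ j ∧ (∀ i, P.p i = p → j + 5 ≤ P.r i) ∧ K ≤ P.mass p * (2 ^ j) ^ d) ∧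
        R ≤ ∑ j ∈ J, (2 : ℝ) ^ (s * j * q) * (P.mass p ^ q * (((2 : ℝ) ^ j) ^ d) ^ (q - 1)) := by
  rcases le_or_gt q 1 with h | h
  · exact exists_blocks_of_le hd μ j₀ hq (by rwa [min_eq_right h] at hs)
  · exact exists_blocks_of_one_lt d μ j₀ h (by rwa [min_eq_left h.le, div_one, sub_self] at hs)

end

/-- if `s ≤ τ_q` then there are `a ∈ S^m_{1,1}` and a tempered distribution
`f` for which `T_a f` converges in `S'`, the level-`μ` quantities of `f` are finite, while
the level-`μ` quantity of `T_a f` is infinite. -/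
theorem statement6 (d : ℕ) (hd : 1 ≤ d) (q : ℝ) (hq : 0 < q) (m : ℝ)
    (μ : ℕ) (hμ : 1 ≤ μ) (s : ℝ) (hs : s ≤ (d : ℝ) / min 1 q - d)
    (D : LPData d) :
    ∃ a : RD d → RD d → ℂ, IsSymbolS11 d m a ∧
      ∃ u Tf : TD d, ConvergesInSPrime D a u Tf ∧
        ((⨆ k ∈ Finset.range μ,
            (2:ℝ≥0∞)^((k:ℝ)*(s+m)) * ⨆ x : RD d, (‖LPdist D k u x‖₊ : ℝ≥0∞)) +
          ⨆ n : Fin d → ℤ, cubePiece d μ n μ (s+m) q (fun k x => LPdist D k u x)) ≠ ⊤ ∧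
        (⨆ n : Fin d → ℤ, cubePiece d μ n μ s q (fun k x => LPdist D k Tf x)) = ⊤ := by
  obtain ⟨j₀, -, hout⟩ := output_norm_eq_top hd D μ
  obtain ⟨P, hℓ, hsum, hbig⟩ := exists_blocks hd μ j₀ hq hs
  have he : ‖(EuclideanSpace.single ⟨0, hd⟩ 1 : RD d)‖ = 1 := by simp
  have hX : ∀ i, 2 ^ P.ℓ i ≤ ‖site d μ (P.p i)‖ := fun i =>
    (pow_le_pow_right₀ one_le_two (P.le_p i)).trans (two_pow_le_norm_site hd μ (P.p i))
  obtain ⟨u, hu⟩ := exists_inDist P m (EuclideanSpace.single ⟨0, hd⟩ 1)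
    (fun i => site d μ (P.p i)) hX
  obtain ⟨Tf, hT⟩ := exists_outDist P (fun i => site d μ (P.p i)) hX
  exact ⟨blockSymbol P m (EuclideanSpace.single ⟨0, hd⟩ 1), isSymbolS11_blockSymbol P m he, u, Tf,
    convergesInSPrime_blockSymbol D P m he _ hX u Tf hu hT,
    input_norm_ne_top D P m he _ u hu hμ hℓ hq hsum, hout P Tf hT s q hq hbig⟩

end
end

section
/- Let d ≥ 1, 0 < q < ∞, s ∈ ℝ, and A > 1. Then there exist h ∈ ℕ (depending only on A) and a constant C (independent of μ, P, and the family (f_k)) such that the following holds: for every μ ∈ ℕ, every dyadic cube P ∈ D_μ, and every sequence (f_k)_{k≥0} of tempered distributions with supp f̂_0 ⊂ {ξ : |ξ| ≤ A} and supp f̂_k ⊂ {ξ : 2^k/A ≤ |ξ| ≤ A·2^k} for k ≥ 1 (so that each f_k is a smooth function of polynomial growth) such that Σ_{k=0}^∞ f_k converges in S′, one has (|P|^{−1} ∫_P Σ_{n=μ}^∞ 2^{snq} |Π_n (Σ_{k=0}^∞ f_k)(x)|^q dx)^{1/q} ≤ C · sup_{R∈D_μ} (|R|^{−1} ∫_R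 Σ_{k=max(0,μ−h)}^∞ 2^{skq} |f_k(x)|^q dx)^{1/q}. -/
noncomputable section

open MeasureTheory SchwartzMap Complex RealInnerProductSpace Filter
open scoped ENNReal NNReal ContDiff SchwartzMap

open FourierTransform in
/-- Translating a Schwartz function on the Fourier side modulates its Fourier transform. -/
lemma exists_fourierS_eq_modulate {d : ℕ} (f : 𝓢(RD d, ℂ)) (ξ : RD d) :
    ∃ ψ : 𝓢(RD d, ℂ), (∀ η, ψ η = (𝓕⁻ f : 𝓢(RD d, ℂ)) (η - ξ)) ∧
      ∀ z, fourierS ψ z = Complex.exp (((-2 * Real.pi * ⟪z, ξ⟫ : ℝ) : ℂ) * Complex.I) * f z := by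
  have hg : Function.HasTemperateGrowth (fun η : RD d => η - ξ) := by fun_prop
  have ha : AntilipschitzWith 1 (fun η : RD d => η - ξ) :=
    AntilipschitzWith.of_le_mul_dist fun a b => by simp
  set u : 𝓢(RD d, ℂ) := 𝓕⁻ f with hu
  have hf : f = 𝓕 u := by rw [hu, FourierTransform.fourier_fourierInv_eq]
  refine ⟨SchwartzMap.compCLMOfAntilipschitz ℂ hg ha u, fun η => rfl, fun z => ?_⟩
  rw [hf, fourierS, SchwartzMap.fourierTransformCLM_apply, SchwartzMap.fourier_coe,
    SchwartzMap.fourier_coe, Real.fourier_eq', Real.fourier_eq']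
  simp only [SchwartzMap.compCLMOfAntilipschitz_apply, Function.comp_apply, smul_eq_mul]
  rw [← integral_const_mul, ← integral_add_right_eq_self _ ξ]
  refine integral_congr_ae (Eventually.of_forall fun v => ?_)
  simp only [add_sub_cancel_right]
  rw [← mul_assoc, ← Complex.exp_add, inner_add_left, real_inner_comm ξ z]
  congr 2
  push_cast
  ring

/-- The reflected translate `z ↦ K_l(x - z)` of the `l`-th Littlewood–Paley kernel is a Schwartz
function, and its inverse Fourier transform lives on the annulus of radius `2^l`. -/
lemma exists_LPkernel_translate {d : ℕ} (D : LPData d) (l : ℕ) (hl : 1 ≤ l) (x : RD d) :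
    ∃ f : 𝓢(RD d, ℂ), (∀ z, f z = LPkernel D l (x - z)) ∧
      ∀ η, (FourierTransformInv.fourierInv f : 𝓢(RD d, ℂ)) η ≠ 0 →
        (2:ℝ) ^ l / 2 ≤ ‖η‖ ∧ ‖η‖ ≤ 2 * (2:ℝ) ^ l := by
  obtain ⟨l, rfl⟩ : ∃ j, l = j + 1 := ⟨l - 1, by omega⟩
  have hpos : (0:ℝ) < 2 ^ (l + 1) := by positivity
  have hg : Function.HasTemperateGrowth (fun z : RD d => (2:ℝ) ^ (l + 1) • (x - z)) := by fun_prop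
  have ha : AntilipschitzWith 1 (fun z : RD d => (2:ℝ) ^ (l + 1) • (x - z)) := by
    refine AntilipschitzWith.of_le_mul_dist fun a b => ?_
    rw [dist_smul₀, dist_sub_left, NNReal.coe_one, one_mul, Real.norm_of_nonneg hpos.le]
    exact le_mul_of_one_le_left dist_nonneg (one_le_pow₀ (by norm_num))
  refine ⟨(((2:ℝ) ^ ((l + 1) * d) : ℝ) : ℂ) • SchwartzMap.compCLMOfAntilipschitz ℂ hg ha D.φ,
    fun z => by simp [LPkernel], fun η hη => ?_⟩
  have key : (FourierTransformInv.fourierInv ((((2:ℝ) ^ ((l + 1) * d) : ℝ) : ℂ) •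
      SchwartzMap.compCLMOfAntilipschitz ℂ hg ha D.φ) : 𝓢(RD d, ℂ)) η =
      Complex.exp (((2 * Real.pi * ⟪x, η⟫ : ℝ) : ℂ) * Complex.I) *
        fourierS D.φ (((2:ℝ) ^ (l + 1))⁻¹ • η) := by
    rw [fourierS, SchwartzMap.fourierTransformCLM_apply, SchwartzMap.fourier_coe,
      SchwartzMap.fourierInv_coe, Real.fourier_eq', Real.fourierInv_eq']
    simp only [_root_.smul_apply, SchwartzMap.compCLMOfAntilipschitz_apply,
      Function.comp_apply, smul_eq_mul]
    have h1 := Measure.integral_comp_smul (volume : Measure (RD d))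
      (fun v => Complex.exp (((-2 * Real.pi * ⟪v, ((2:ℝ) ^ (l + 1))⁻¹ • η⟫ : ℝ) : ℂ) * Complex.I) *
        D.φ v) ((2:ℝ) ^ (l + 1))
    rw [finrank_euclideanSpace_fin, abs_of_pos (by positivity), ← pow_mul] at h1
    have h2 : ∫ v, Complex.exp (((-2 * Real.pi * ⟪v, ((2:ℝ) ^ (l + 1))⁻¹ • η⟫ : ℝ) : ℂ) *
        Complex.I) * D.φ v = (((2:ℝ) ^ ((l + 1) * d) : ℝ) : ℂ) *
        ∫ v, Complex.exp (((-2 * Real.pi * ⟪(2:ℝ) ^ (l + 1) • v, ((2:ℝ) ^ (l + 1))⁻¹ • η⟫ : ℝ) : ℂ)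
          * Complex.I) * D.φ ((2:ℝ) ^ (l + 1) • v) := by
      rw [h1, Complex.real_smul, ← mul_assoc, ← Complex.ofReal_mul, mul_inv_cancel₀ (by positivity),
        Complex.ofReal_one, one_mul]
    rw [h2, ← integral_sub_left_eq_self _ volume x, ← integral_const_mul, ← integral_const_mul]
    refine integral_congr_ae (Eventually.of_forall fun v => ?_)
    simp only [sub_sub_cancel]
    rw [real_inner_smul_left, real_inner_smul_right, ← mul_assoc ((2:ℝ) ^ (l + 1)),
      mul_inv_cancel₀ hpos.ne', one_mul, inner_sub_left,
      show (((2 * Real.pi * (⟪x, η⟫ - ⟪v, η⟫) : ℝ) : ℂ) * Complex.I) =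
        ((2 * Real.pi * ⟪x, η⟫ : ℝ) : ℂ) * Complex.I +
        ((-2 * Real.pi * ⟪v, η⟫ : ℝ) : ℂ) * Complex.I by push_cast; ring, Complex.exp_add]
    ring
  rw [key] at hη
  have h3 := D.supp_φ _ (right_ne_zero_of_mul hη)
  rw [norm_smul, Real.norm_of_nonneg (by positivity), inv_mul_eq_div,
    le_div_iff₀ hpos, div_le_iff₀ hpos] at h3
  exact ⟨by linarith [h3.1], h3.2⟩

/-- The product `F · K_l(x - ·)` is a Schwartz function whose Fourier transform vanishes at `ξ`
as soon as the Fourier support of `F` does not meet the annulus of radius `2^l` around `ξ`. -/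
lemma exists_mul_LPkernel {d : ℕ} (D : LPData d) (l : ℕ) (hl : 1 ≤ l) (x : RD d)
    {F : RD d → ℂ} (hF : Function.HasTemperateGrowth F) :
    ∃ G : 𝓢(RD d, ℂ), (∀ z, G z = F z * LPkernel D l (x - z)) ∧
      ∀ (K : Set (RD d)) (_ : HasFourierSupportIn F K) (ξ : RD d),
        (∀ η ∈ K, ¬ ((2:ℝ) ^ l / 2 ≤ ‖η - ξ‖ ∧ ‖η - ξ‖ ≤ 2 * (2:ℝ) ^ l)) →
        fourierS G ξ = 0 := by
  obtain ⟨f, hf, hfs⟩ := exists_LPkernel_translate D l hl x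
  refine ⟨SchwartzMap.smulLeftCLM ℂ F f,
    fun z => by rw [SchwartzMap.smulLeftCLM_apply_apply hF, hf, smul_eq_mul], ?_⟩
  intro K hK ξ hξ
  obtain ⟨ψ, hψ, hψF⟩ := exists_fourierS_eq_modulate f ξ
  have hsub : tsupport ⇑ψ ⊆ {η | (2:ℝ) ^ l / 2 ≤ ‖η - ξ‖ ∧ ‖η - ξ‖ ≤ 2 * (2:ℝ) ^ l} := by
    refine closure_minimal (fun η hη => hfs _ (by rwa [← hψ])) ?_
    have hc : Continuous fun η : RD d => ‖η - ξ‖ := by fun_prop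
    exact (isClosed_le continuous_const hc).inter (isClosed_le hc continuous_const)
  have h0 := hK ψ (by
    ext η
    simp only [Set.mem_inter_iff, Set.mem_empty_iff_false, iff_false, not_and]
    exact fun h1 h2 => hξ η h2 (hsub h1))
  rw [fourierS, SchwartzMap.fourierTransformCLM_apply, SchwartzMap.fourier_coe, Real.fourier_eq',
    ← h0]
  refine integral_congr_ae (Eventually.of_forall fun v => ?_)
  simp only [hψF, SchwartzMap.smulLeftCLM_apply_apply hF, smul_eq_mul]
  ring

/-- The Littlewood–Paley piece of `F` is the integral of `F · K_l(x - ·)`. -/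
lemma LP_eq_integral {d : ℕ} (D : LPData d) (l : ℕ) (F : RD d → ℂ) (x : RD d) :
    LP D l F x = ∫ z, F z * LPkernel D l (x - z) := by
  rw [LP, ← integral_sub_left_eq_self _ volume x]
  simp [mul_comm]

/-- `Π_l F = 0` if the Fourier support of `F` does not meet the annulus of radius `2^l`. -/
lemma LP_eq_zero {d : ℕ} (D : LPData d) (l : ℕ) (hl : 1 ≤ l) {F : RD d → ℂ}
    (hF : Function.HasTemperateGrowth F) {K : Set (RD d)} (hK : HasFourierSupportIn F K)
    (hd : ∀ η ∈ K, ¬ ((2:ℝ) ^ l / 2 ≤ ‖η‖ ∧ ‖η‖ ≤ 2 * (2:ℝ) ^ l)) (x : RD d) :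
    LP D l F x = 0 := by
  obtain ⟨G, hG, hGs⟩ := exists_mul_LPkernel D l hl x hF
  have h := hGs K hK 0 (by simpa using hd)
  rw [fourierS, SchwartzMap.fourierTransformCLM_apply, SchwartzMap.fourier_coe,
    Real.fourier_eq'] at h
  rw [LP_eq_integral, ← h]
  simp [hG]

/-- A Schwartz function whose Fourier transform is supported in a ball of radius `R` is bounded by
the volume of that ball times its `L¹` norm. -/
lemma enorm_le_volume_mul_lintegral {d : ℕ} (G : 𝓢(RD d, ℂ)) (R : ℝ)
    (hG : ∀ ξ, R < ‖ξ‖ → fourierS G ξ = 0) (w : RD d) :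
    ‖G w‖ₑ ≤ volume (Metric.closedBall (0 : RD d) R) * ∫⁻ z, ‖G z‖ₑ := by
  have hinv : G = FourierTransformInv.fourierInv (fourierS G) := by
    rw [fourierS, SchwartzMap.fourierTransformCLM_apply, FourierTransform.fourierInv_fourier_eq]
  have hsup : ∀ ξ, ‖fourierS G ξ‖ₑ ≤ ∫⁻ z, ‖G z‖ₑ := fun ξ => by
    rw [fourierS, SchwartzMap.fourierTransformCLM_apply, SchwartzMap.fourier_coe,
      Real.fourier_eq']
    refine (enorm_integral_le_lintegral_enorm _).trans (lintegral_mono fun z => ?_)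
    rw [smul_eq_mul, enorm_mul, ← ofReal_norm, Complex.norm_exp_ofReal_mul_I]
    simp
  calc ‖G w‖ₑ = ‖(FourierTransformInv.fourierInv (fourierS G) : 𝓢(RD d, ℂ)) w‖ₑ := by
        rw [← hinv]
    _ ≤ ∫⁻ ξ, ‖fourierS G ξ‖ₑ := by
        rw [SchwartzMap.fourierInv_coe, Real.fourierInv_eq']
        refine (enorm_integral_le_lintegral_enorm _).trans (lintegral_mono fun z => ?_)
        rw [smul_eq_mul, enorm_mul, ← ofReal_norm, Complex.norm_exp_ofReal_mul_I]
        simp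
    _ ≤ ∫⁻ ξ, (Metric.closedBall (0 : RD d) R).indicator (fun _ => ∫⁻ z, ‖G z‖ₑ) ξ := by
        refine lintegral_mono fun ξ => ?_
        by_cases hξ : ξ ∈ Metric.closedBall (0 : RD d) R
        · rw [Set.indicator_of_mem hξ]
          exact hsup ξ
        · rw [mem_closedBall_zero_iff, not_le] at hξ
          simp [hG ξ hξ]
    _ = _ := by
        rw [lintegral_indicator Metric.isClosed_closedBall.measurableSet, setLIntegral_const,
          mul_comm]

/-- Nikol'skii's inequality between `L¹` and `L^q`, `q ≤ 1`, for band-limited functions. -/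
lemma lintegral_enorm_rpow_le {d : ℕ} (G : 𝓢(RD d, ℂ)) (R : ℝ)
    (hG : ∀ ξ, R < ‖ξ‖ → fourierS G ξ = 0) {q : ℝ} (hq : 0 < q) (hq1 : q ≤ 1) :
    (∫⁻ z, ‖G z‖ₑ) ^ q ≤
      volume (Metric.closedBall (0 : RD d) R) ^ (1 - q) * ∫⁻ z, ‖G z‖ₑ ^ q := by
  set I := ∫⁻ z, ‖G z‖ₑ with hI
  set V := volume (Metric.closedBall (0 : RD d) R)
  have hItop : I ≠ ⊤ := (G.integrable (μ := volume)).2.ne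
  rcases eq_or_ne I 0 with h0 | h0
  · rw [h0, ENNReal.zero_rpow_of_pos hq]
    exact zero_le
  have h1 : I ≤ (V * I) ^ (1 - q) * ∫⁻ z, ‖G z‖ₑ ^ q := by
    have hV : V ≠ ⊤ := measure_closedBall_lt_top.ne
    rw [← lintegral_const_mul' _ _
      (ENNReal.rpow_ne_top_of_nonneg (by linarith) (ENNReal.mul_ne_top hV hItop))]
    refine lintegral_mono fun z => ?_
    calc ‖G z‖ₑ = ‖G z‖ₑ ^ (1 - q) * ‖G z‖ₑ ^ q := by
          rw [← ENNReal.rpow_add_of_nonneg _ _ (by linarith) hq.le, sub_add_cancel,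
            ENNReal.rpow_one]
      _ ≤ _ := by
          gcongr
          exact enorm_le_volume_mul_lintegral G R hG z
  have h2 : I ^ (1 - q) * I ^ q ≤ I ^ (1 - q) * (V ^ (1 - q) * ∫⁻ z, ‖G z‖ₑ ^ q) := by
    rw [← ENNReal.rpow_add_of_nonneg _ _ (by linarith) hq.le, sub_add_cancel, ENNReal.rpow_one]
    refine h1.trans (le_of_eq ?_)
    rw [ENNReal.mul_rpow_of_nonneg _ _ (by linarith)]
    ring
  refine (ENNReal.mul_le_mul_iff_right ?_ ?_).1 h2
  · exact (ENNReal.rpow_pos (pos_iff_ne_zero.2 h0) hItop).ne'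
  · exact ENNReal.rpow_ne_top_of_nonneg (by linarith) hItop

/-- The integrable weight `(1 + ‖y‖)^{-(d+1)}`. -/
def decayWeight (d : ℕ) (y : RD d) : ℝ≥0∞ := ENNReal.ofReal ((1 + ‖y‖) ^ (-((d : ℝ) + 1)))

lemma measurable_decayWeight (d : ℕ) : Measurable (decayWeight d) := by
  unfold decayWeight
  fun_prop

lemma lintegral_decayWeight_ne_top (d : ℕ) : ∫⁻ y, decayWeight d y ≠ ⊤ :=
  (finite_integral_one_add_norm (E := RD d) (μ := volume) (r := (d : ℝ) + 1) (by simp)).ne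

/-- Any positive power of a Schwartz function is dominated by the square of `decayWeight`. -/
lemma exists_enorm_rpow_le_decayWeight_sq {d : ℕ} (f : 𝓢(RD d, ℂ)) {r : ℝ} (hr : 0 < r) :
    ∃ C : ℝ≥0, ∀ y, ‖f y‖ₑ ^ r ≤ C * decayWeight d y ^ 2 := by
  obtain ⟨N, hN⟩ := exists_nat_ge (2 * ((d : ℝ) + 1) / r)
  rw [div_le_iff₀ hr] at hN
  set c : ℝ := 2 ^ N * ((Finset.Iic (N, 0)).sup fun m => SchwartzMap.seminorm ℝ m.1 m.2) f with hc
  have hc0 : 0 ≤ c := by positivity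
  refine ⟨Real.toNNReal (c ^ r), fun y => ?_⟩
  have hy : 1 ≤ 1 + ‖y‖ := by linarith [norm_nonneg y]
  have hy0 : 0 < 1 + ‖y‖ := by linarith
  have h := SchwartzMap.one_add_le_sup_seminorm_apply (𝕜 := ℝ) (m := (N, 0)) (k := N) (n := 0)
    le_rfl le_rfl f y
  rw [norm_iteratedFDeriv_zero] at h
  have h1 : ‖f y‖ ≤ c * (1 + ‖y‖) ^ (-(N : ℝ)) := by
    rw [Real.rpow_neg hy0.le, Real.rpow_natCast, ← div_eq_mul_inv, le_div_iff₀ (by positivity),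
      mul_comm]
    exact h
  have h2 : ‖f y‖ ^ r ≤ c ^ r * ((1 + ‖y‖) ^ (-((d : ℝ) + 1))) ^ 2 := by
    calc ‖f y‖ ^ r ≤ (c * (1 + ‖y‖) ^ (-(N : ℝ))) ^ r := by gcongr
      _ = c ^ r * (1 + ‖y‖) ^ (-(N : ℝ) * r) := by
          rw [Real.mul_rpow hc0 (by positivity), ← Real.rpow_mul hy0.le]
      _ ≤ c ^ r * (1 + ‖y‖) ^ (-((d : ℝ) + 1) * (2 : ℕ)) := by
          refine mul_le_mul_of_nonneg_left (Real.rpow_le_rpow_of_exponent_le hy ?_) (by positivity)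
          push_cast
          linarith
      _ = _ := by rw [Real.rpow_mul hy0.le, Real.rpow_natCast]
  rw [← ofReal_norm, ENNReal.ofReal_rpow_of_nonneg (norm_nonneg _) hr.le, decayWeight,
    ← ENNReal.ofReal_pow (by positivity)]
  change _ ≤ ENNReal.ofReal (c ^ r) * _
  rw [← ENNReal.ofReal_mul (by positivity)]
  exact ENNReal.ofReal_le_ofReal h2

/-- `L¹`-normalised dilations preserve lower integrals. -/
lemma lintegral_dilate {d : ℕ} (l : ℕ) {g : RD d → ℝ≥0∞} (hg : Measurable g) :
    ∫⁻ z, (2:ℝ≥0∞) ^ (l * d) * g ((2:ℝ) ^ l • z) = ∫⁻ z, g z := by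
  have h2 : (2:ℝ) ^ l ≠ 0 := by positivity
  have hm : Measurable (fun z : RD d => (2:ℝ) ^ l • z) := by fun_prop
  rw [lintegral_const_mul _ (show Measurable fun z => g ((2:ℝ) ^ l • z) from hg.comp hm),
    ← lintegral_map hg hm, Measure.map_addHaar_smul _ h2,
    lintegral_smul_measure, smul_eq_mul, ← mul_assoc, finrank_euclideanSpace_fin,
    abs_of_pos (by positivity), ENNReal.ofReal_inv_of_pos (by positivity), ← pow_mul,
    ENNReal.ofReal_pow (by norm_num), ENNReal.ofReal_ofNat, ENNReal.mul_inv_cancel (by simp)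
      (by simp), one_mul]

lemma enorm_LPkernel {d : ℕ} (D : LPData d) {l : ℕ} (hl : 1 ≤ l) (y : RD d) :
    ‖LPkernel D l y‖ₑ = (2:ℝ≥0∞) ^ (l * d) * ‖D.φ ((2:ℝ) ^ l • y)‖ₑ := by
  obtain ⟨l, rfl⟩ : ∃ j, l = j + 1 := ⟨l - 1, by omega⟩
  rw [LPkernel, enorm_mul, ← ofReal_norm, Complex.norm_real, Real.norm_of_nonneg (by positivity),
    ENNReal.ofReal_pow (by norm_num), ENNReal.ofReal_ofNat]

/-- The case `1 ≤ q` of the pointwise bound, by Hölder's inequality. -/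
lemma enorm_LP_rpow_le_of_one_le {d : ℕ} (D : LPData d) {l : ℕ} (hl : 1 ≤ l) {q : ℝ} (hq : 1 ≤ q)
    {F : RD d → ℂ} (hF : Continuous F) (x : RD d) :
    ‖LP D l F x‖ₑ ^ q ≤ (∫⁻ y, ‖D.φ y‖ₑ) ^ (q - 1) *
      ∫⁻ z, ‖F z‖ₑ ^ q * ((2:ℝ≥0∞) ^ (l * d) * ‖D.φ ((2:ℝ) ^ l • (x - z))‖ₑ) := by
  have hq0 : 0 < q := by linarith
  have hs : (1 : ℝ) / q ≤ 1 := by rw [div_le_one hq0]; exact hq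
  set κ : RD d → ℝ≥0∞ := fun z => (2:ℝ≥0∞) ^ (l * d) * ‖D.φ ((2:ℝ) ^ l • (x - z))‖ₑ with hκ
  have hφ : Measurable fun y => ‖D.φ y‖ₑ := D.φ.continuous.enorm.measurable
  have hκm : Measurable κ := (hφ.comp (by fun_prop)).const_mul _
  have hκi : ∫⁻ z, κ z = ∫⁻ y, ‖D.φ y‖ₑ := by
    rw [← lintegral_dilate l hφ, ← lintegral_sub_left_eq_self _ x]
    simp [hκ]
  have hFm : Measurable fun z => ‖F z‖ₑ := hF.enorm.measurable
  have h1 : ‖LP D l F x‖ₑ ≤ ∫⁻ z, κ z ^ (1 - 1 / q) * (‖F z‖ₑ ^ q * κ z) ^ (1 / q) := by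
    rw [LP_eq_integral]
    refine (enorm_integral_le_lintegral_enorm _).trans (lintegral_mono fun z => ?_)
    change _ ≤ κ z ^ (1 - 1 / q) * _
    rw [enorm_mul, enorm_LPkernel D hl, ENNReal.mul_rpow_of_nonneg (_ ^ q) _ (by positivity),
      ← ENNReal.rpow_mul, mul_one_div_cancel hq0.ne', ENNReal.rpow_one,
      mul_left_comm (κ z ^ (1 - 1 / q)),
      ← ENNReal.rpow_add_of_nonneg _ _ (by linarith) (by positivity), sub_add_cancel,
      ENNReal.rpow_one]
  have h2 := h1.trans (ENNReal.lintegral_mul_norm_pow_le hκm.aemeasurable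
    (show Measurable fun z => ‖F z‖ₑ ^ q * κ z from (hFm.pow_const q).mul hκm).aemeasurable (sub_nonneg.2 hs) (by positivity)
    (sub_add_cancel _ _))
  calc ‖LP D l F x‖ₑ ^ q ≤ _ := ENNReal.rpow_le_rpow h2 hq0.le
    _ = _ := by
      rw [hκi, ENNReal.mul_rpow_of_nonneg _ _ hq0.le, ← ENNReal.rpow_mul, ← ENNReal.rpow_mul,
        sub_mul, one_mul, one_div_mul_cancel hq0.ne', ENNReal.rpow_one]

/-- The case `q ≤ 1` of the pointwise bound, by Nikol'skii's inequality. -/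
lemma enorm_LP_rpow_le_of_le_one {d : ℕ} (D : LPData d) {l : ℕ} (hl : 1 ≤ l) {q : ℝ} (hq : 0 < q)
    (hq1 : q ≤ 1) {B : ℝ} (hB : 0 ≤ B) {F : RD d → ℂ} (hF : Function.HasTemperateGrowth F)
    {K : Set (RD d)} (hK : HasFourierSupportIn F K) (hKB : ∀ η ∈ K, ‖η‖ ≤ B * 2 ^ l) (x : RD d) :
    ‖LP D l F x‖ₑ ^ q ≤ volume (Metric.closedBall (0 : RD d) (B + 2)) ^ (1 - q) *
      ∫⁻ z, ‖F z‖ₑ ^ q * ((2:ℝ≥0∞) ^ (l * d) * ‖D.φ ((2:ℝ) ^ l • (x - z))‖ₑ ^ q) := by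
  obtain ⟨G, hG, hGs⟩ := exists_mul_LPkernel D l hl x hF
  have hsupp : ∀ ξ, (B + 2) * 2 ^ l < ‖ξ‖ → fourierS G ξ = 0 := by
    refine fun ξ hξ => hGs K hK ξ fun η hη h => ?_
    have h3 : ‖ξ‖ ≤ ‖η‖ + ‖η - ξ‖ := by
      rw [norm_sub_rev]; simpa using norm_add_le η (ξ - η)
    nlinarith [hKB η hη, h.2]
  have hvol : volume (Metric.closedBall (0 : RD d) ((B + 2) * 2 ^ l)) =
      (2:ℝ≥0∞) ^ (l * d) * volume (Metric.closedBall (0 : RD d) (B + 2)) := by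
    rw [Measure.addHaar_closedBall _ _ (by positivity), Measure.addHaar_closedBall _ _
      (by positivity), finrank_euclideanSpace_fin, mul_pow, ← pow_mul,
      ENNReal.ofReal_mul (by positivity), ENNReal.ofReal_pow (p := (2:ℝ)) (by norm_num),
      ENNReal.ofReal_ofNat]
    ring
  have h1 : ‖LP D l F x‖ₑ ≤ ∫⁻ z, ‖G z‖ₑ := by
    rw [LP_eq_integral]
    refine (enorm_integral_le_lintegral_enorm _).trans_eq ?_
    simp only [hG]
  have hp : ((2:ℝ≥0∞) ^ (l * d)) ^ (1 - q) * ((2:ℝ≥0∞) ^ (l * d)) ^ q = (2:ℝ≥0∞) ^ (l * d) := by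
    rw [← ENNReal.rpow_add_of_nonneg _ _ (by linarith) hq.le, sub_add_cancel, ENNReal.rpow_one]
  calc ‖LP D l F x‖ₑ ^ q ≤ (∫⁻ z, ‖G z‖ₑ) ^ q := by gcongr
    _ ≤ _ := lintegral_enorm_rpow_le G _ hsupp hq hq1
    _ = _ := by
      rw [hvol, ENNReal.mul_rpow_of_nonneg _ _ (by linarith), mul_comm (_ ^ (1 - q)), mul_assoc,
        ← lintegral_const_mul' _ _ (ENNReal.rpow_ne_top_of_nonneg (by linarith) (by simp))]
      congr 1
      refine lintegral_congr fun z => ?_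
      rw [hG, enorm_mul, enorm_LPkernel D hl, ENNReal.mul_rpow_of_nonneg _ _ hq.le,
        ENNReal.mul_rpow_of_nonneg _ _ hq.le, mul_left_comm, ← mul_assoc (_ ^ (1 - q)), hp]

/-- Pointwise bound of `|Π_l F|^q` by a mean of `|F|^q`, for `F` with Fourier support in a ball of
radius comparable to `2^l`. -/
lemma exists_enorm_LP_rpow_le {d : ℕ} (D : LPData d) {q : ℝ} (hq : 0 < q) {B : ℝ} (hB : 0 ≤ B) :
    ∃ C : ℝ≥0, ∀ (l : ℕ), 1 ≤ l → ∀ (F : RD d → ℂ) (K : Set (RD d)),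
      Function.HasTemperateGrowth F → HasFourierSupportIn F K → (∀ η ∈ K, ‖η‖ ≤ B * 2 ^ l) →
      ∀ x, ‖LP D l F x‖ₑ ^ q ≤ C * ∫⁻ z, ‖F z‖ₑ ^ q *
        ((2:ℝ≥0∞) ^ (l * d) * decayWeight d ((2:ℝ) ^ l • (x - z)) ^ 2) := by
  rcases le_total q 1 with hq1 | hq1
  · obtain ⟨C, hC⟩ := exists_enorm_rpow_le_decayWeight_sq D.φ hq
    have htop : volume (Metric.closedBall (0 : RD d) (B + 2)) ^ (1 - q) ≠ ⊤ :=
      ENNReal.rpow_ne_top_of_nonneg (by linarith) measure_closedBall_lt_top.ne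
    refine ⟨(volume (Metric.closedBall (0 : RD d) (B + 2)) ^ (1 - q)).toNNReal * C,
      fun l hl F K hF hK hKB x => ?_⟩
    refine (enorm_LP_rpow_le_of_le_one D hl hq hq1 hB hF hK hKB x).trans ?_
    rw [ENNReal.coe_mul, ENNReal.coe_toNNReal htop, mul_assoc,
      ← lintegral_const_mul' _ _ ENNReal.coe_ne_top]
    gcongr _ * ∫⁻ z, ?_ with z
    calc _ ≤ ‖F z‖ₑ ^ q * ((2:ℝ≥0∞) ^ (l * d) * (C * decayWeight d ((2:ℝ) ^ l • (x - z)) ^ 2)) := by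
          gcongr
          exact hC _
      _ = _ := by ring
  · obtain ⟨C, hC⟩ := exists_enorm_rpow_le_decayWeight_sq D.φ one_pos
    have htop : (∫⁻ y, ‖D.φ y‖ₑ) ^ (q - 1) ≠ ⊤ :=
      ENNReal.rpow_ne_top_of_nonneg (by linarith) (D.φ.integrable (μ := volume)).2.ne
    refine ⟨((∫⁻ y, ‖D.φ y‖ₑ) ^ (q - 1)).toNNReal * C, fun l hl F K hF hK hKB x => ?_⟩
    refine (enorm_LP_rpow_le_of_one_le D hl hq1 hF.1.continuous x).trans ?_
    rw [ENNReal.coe_mul, ENNReal.coe_toNNReal htop, mul_assoc,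
      ← lintegral_const_mul' _ _ ENNReal.coe_ne_top]
    gcongr _ * ∫⁻ z, ?_ with z
    calc _ ≤ ‖F z‖ₑ ^ q * ((2:ℝ≥0∞) ^ (l * d) * (C * decayWeight d ((2:ℝ) ^ l • (x - z)) ^ 2)) := by
          gcongr
          simpa using hC ((2:ℝ) ^ l • (x - z))
      _ = _ := by ring

/-- The lattice weight `(1 + ‖m‖)^{-(d+1)}` on `ℤ^d`. -/
def latticeWeight (d : ℕ) (m : Fin d → ℤ) : ℝ≥0∞ :=
  ENNReal.ofReal ((1 + ‖m‖) ^ (-((d : ℝ) + 1)))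

lemma tsum_latticeWeight_ne_top (d : ℕ) : ∑' m : Fin d → ℤ, latticeWeight d m ≠ ⊤ := by
  have hs : Summable fun m : Fin d → ℤ => (1 + ‖m‖) ^ (-((d : ℝ) + 1)) := by
    set L := Submodule.span ℤ (Set.range (Pi.basisFun ℝ (Fin d))) with hL
    have hmem : ∀ m : Fin d → ℤ, (fun i => (m i : ℝ)) ∈ L := fun m => by
      rw [hL, Module.Basis.mem_span_iff_repr_mem]
      exact fun i => ⟨m i, by simp⟩
    have hsum : Summable fun z : L => ‖z‖ ^ (-((d : ℝ) + 1)) := by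
      refine ZLattice.summable_norm_rpow L _ ?_
      rw [ZLattice.rank ℝ L]
      simp
    have hinj : Function.Injective fun m : Fin d → ℤ => (⟨_, hmem m⟩ : L) := by
      intro m m' h
      ext i
      simpa using congrFun (congrArg Subtype.val h) i
    have hsum' := hsum.comp_injective hinj
    refine Summable.of_norm_bounded_eventually hsum' ?_
    filter_upwards [(Set.finite_singleton (0 : Fin d → ℤ)).compl_mem_cofinite] with m hm
    have hnorm : ‖(⟨_, hmem m⟩ : L)‖ = ‖m‖ := by
      simp only [Submodule.coe_norm, Pi.norm_def]
      congr! 3 with i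
    have hm0 : 0 < ‖m‖ := norm_pos_iff.2 hm
    simp only [Function.comp_apply, hnorm]
    rw [Real.norm_of_nonneg (by positivity)]
    exact Real.rpow_le_rpow_of_nonpos hm0 (by linarith) (by linarith [d.cast_nonneg (α := ℝ)])
  exact hs.tsum_ofReal_ne_top

lemma tsum_latticeWeight_sub (d : ℕ) (n : Fin d → ℤ) :
    ∑' n' : Fin d → ℤ, latticeWeight d (n - n') = ∑' m : Fin d → ℤ, latticeWeight d m :=
  (Equiv.subLeft n).tsum_eq (latticeWeight d)

lemma measurableSet_dyadicCube (d : ℕ) (ν : ℤ) (n : Fin d → ℤ) :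
    MeasurableSet (dyadicCube d ν n) := by
  have : dyadicCube d ν n = ⋂ i, {x : RD d | (n i : ℝ) * (2:ℝ) ^ (-ν) ≤ x i} ∩
      {x : RD d | x i < ((n i : ℝ) + 1) * (2:ℝ) ^ (-ν)} := by
    ext x
    simp [dyadicCube]
  rw [this]
  refine MeasurableSet.iInter fun i => ?_
  have hi : Measurable fun x : RD d => x i := by fun_prop
  exact (measurableSet_le measurable_const hi).inter (measurableSet_lt hi measurable_const)

/-- Membership in a dyadic cube, rescaled to unit size. -/
lemma mem_dyadicCube_natCast {d : ℕ} {μ : ℕ} {n : Fin d → ℤ} {x : RD d} :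
    x ∈ dyadicCube d μ n ↔ ∀ i, (n i : ℝ) ≤ 2 ^ μ * x i ∧ 2 ^ μ * x i < n i + 1 := by
  have h2 : (0:ℝ) < 2 ^ μ := by positivity
  simp only [dyadicCube, Set.mem_ofPred_eq, zpow_neg, zpow_natCast, ← div_eq_mul_inv,
    div_le_iff₀ h2, lt_div_iff₀ h2, mul_comm]

lemma iUnion_dyadicCube (d μ : ℕ) : ⋃ n, dyadicCube d μ n = Set.univ := by
  refine Set.eq_univ_of_forall fun x => Set.mem_iUnion.2 ⟨fun i => ⌊2 ^ μ * x i⌋, ?_⟩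
  rw [mem_dyadicCube_natCast]
  exact fun i => ⟨Int.floor_le _, Int.lt_floor_add_one _⟩

/-- The distance between points of two cubes controls the distance of their indices. -/
lemma decayWeight_le_latticeWeight {d μ l : ℕ} (hl : μ ≤ l) {n n' : Fin d → ℤ} {x z : RD d}
    (hx : x ∈ dyadicCube d μ n) (hz : z ∈ dyadicCube d μ n') :
    decayWeight d ((2:ℝ) ^ l • (x - z)) ≤ 2 ^ (d + 1) * latticeWeight d (n - n') := by
  rw [mem_dyadicCube_natCast] at hx hz
  have hnorm : ‖(2:ℝ) ^ l • (x - z)‖ = 2 ^ l * ‖x - z‖ := by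
    rw [norm_smul, Real.norm_of_nonneg (by positivity)]
  have h1 : ‖n - n'‖ ≤ 1 + 2 ^ l * ‖x - z‖ := by
    rw [pi_norm_le_iff_of_nonneg (by positivity)]
    intro i
    have hi : |x i - z i| ≤ ‖x - z‖ := by
      simpa using PiLp.norm_apply_le (x - z) i
    have h2 : (2:ℝ) ^ μ * |x i - z i| ≤ 2 ^ l * ‖x - z‖ := by
      gcongr
      norm_num
    have h3 : |(2:ℝ) ^ μ * x i - 2 ^ μ * z i| = 2 ^ μ * |x i - z i| := by
      rw [← mul_sub, abs_mul, abs_of_pos (by positivity : (0:ℝ) < 2 ^ μ)]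
    rw [Pi.sub_apply, Int.norm_eq_abs, Int.cast_sub]
    have h4 := abs_le.1 (h3.trans_le h2)
    rw [abs_le]
    constructor <;> linarith [hx i, hz i, (hx i).1, (hx i).2, (hz i).1, (hz i).2]
  have h0 : 0 ≤ ‖n - n'‖ := norm_nonneg _
  have h2 : (2:ℝ≥0∞) ^ (d + 1) = ENNReal.ofReal ((2⁻¹ : ℝ) ^ (-((d : ℝ) + 1))) := by
    rw [Real.inv_rpow (by norm_num), Real.rpow_neg (by norm_num), inv_inv,
      ← Nat.cast_add_one, Real.rpow_natCast, ENNReal.ofReal_pow (by norm_num),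
      ENNReal.ofReal_ofNat]
  rw [decayWeight, latticeWeight, h2, ← ENNReal.ofReal_mul (by positivity),
    ← Real.mul_rpow (by norm_num) (by positivity), hnorm]
  refine ENNReal.ofReal_le_ofReal (Real.rpow_le_rpow_of_nonpos (by positivity) ?_
    (by linarith [d.cast_nonneg (α := ℝ)]))
  have : 0 ≤ 2 ^ l * ‖x - z‖ := by positivity
  linarith

/-- Averages at scale `2^{-l}` of `g`, integrated over a cube of level `μ ≤ l`, are controlled by
the integrals of `g` over all cubes of level `μ` with summable weights. -/
lemma setLIntegral_mean_le {d μ l : ℕ} (hl : μ ≤ l) (n : Fin d → ℤ) {g : RD d → ℝ≥0∞}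
    (hg : Measurable g) :
    ∫⁻ x in dyadicCube d μ n, ∫⁻ z, g z *
        ((2:ℝ≥0∞) ^ (l * d) * decayWeight d ((2:ℝ) ^ l • (x - z)) ^ 2) ≤
      2 ^ (d + 1) * (∫⁻ y, decayWeight d y) *
        ∑' n', latticeWeight d (n - n') * ∫⁻ z in dyadicCube d μ n', g z := by
  have hW := measurable_decayWeight d
  have hmeas : Measurable (Function.uncurry fun x z : RD d => g z *
      ((2:ℝ≥0∞) ^ (l * d) * decayWeight d ((2:ℝ) ^ l • (x - z)) ^ 2)) := by
    refine (hg.comp measurable_snd).mul (measurable_const.mul ((hW.comp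
      (show Measurable fun p : RD d × RD d => (2:ℝ) ^ l • (p.1 - p.2) by fun_prop)).pow_const 2))
  have htrans : ∀ z, ∫⁻ x, (2:ℝ≥0∞) ^ (l * d) * decayWeight d ((2:ℝ) ^ l • (x - z)) =
      ∫⁻ y, decayWeight d y := fun z => by
    rw [lintegral_sub_right_eq_self
      (fun y => (2:ℝ≥0∞) ^ (l * d) * decayWeight d ((2:ℝ) ^ l • y)) z, lintegral_dilate l hW]
  rw [lintegral_lintegral_swap hmeas.aemeasurable, ← setLIntegral_univ, ← iUnion_dyadicCube d μ,
    ← ENNReal.tsum_mul_left]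
  refine (lintegral_iUnion_le _ _).trans (ENNReal.tsum_le_tsum fun n' => ?_)
  have hu : latticeWeight d (n - n') ≠ ⊤ := ENNReal.ofReal_ne_top
  calc _ ≤ ∫⁻ z in dyadicCube d μ n', 2 ^ (d + 1) * (∫⁻ y, decayWeight d y) *
        latticeWeight d (n - n') * g z := by
        refine setLIntegral_mono' (measurableSet_dyadicCube d μ n') fun z hz => ?_
        calc _ ≤ ∫⁻ x in dyadicCube d μ n, (g z * (2 ^ (d + 1) * latticeWeight d (n - n'))) *
              ((2:ℝ≥0∞) ^ (l * d) * decayWeight d ((2:ℝ) ^ l • (x - z))) := by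
              refine setLIntegral_mono' (measurableSet_dyadicCube d μ n) fun x hx => ?_
              calc _ = g z * (decayWeight d ((2:ℝ) ^ l • (x - z))) *
                    ((2:ℝ≥0∞) ^ (l * d) * decayWeight d ((2:ℝ) ^ l • (x - z))) := by ring
                _ ≤ _ := by
                    gcongr
                    exact decayWeight_le_latticeWeight hl hx hz
          _ ≤ ∫⁻ x, (g z * (2 ^ (d + 1) * latticeWeight d (n - n'))) *
              ((2:ℝ≥0∞) ^ (l * d) * decayWeight d ((2:ℝ) ^ l • (x - z))) :=
              setLIntegral_le_lintegral _ _
          _ = _ := by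
              have hm : Measurable fun x : RD d =>
                  (2:ℝ≥0∞) ^ (l * d) * decayWeight d ((2:ℝ) ^ l • (x - z)) :=
                (hW.comp (by fun_prop)).const_mul _
              rw [lintegral_const_mul _ hm, htrans]
              ring
    _ = _ := by
        rw [lintegral_const_mul' _ _ (ENNReal.mul_ne_top (ENNReal.mul_ne_top (by simp)
          (lintegral_decayWeight_ne_top d)) hu), mul_assoc]

/-- Quasi-triangle inequality for finite sums and an arbitrary positive exponent. -/
lemma enorm_sum_rpow_le {ι : Type*} (T : Finset ι) (a : ι → ℂ) {q : ℝ} (hq : 0 < q) {N : ℕ}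
    (hN : T.card ≤ N) : ‖∑ k ∈ T, a k‖ₑ ^ q ≤ (N : ℝ≥0∞) ^ q * ∑ k ∈ T, ‖a k‖ₑ ^ q := by
  rcases T.eq_empty_or_nonempty with rfl | hT
  · simp [ENNReal.zero_rpow_of_pos hq]
  obtain ⟨m, hm, hmax⟩ := T.exists_max_image (fun k => ‖a k‖ₑ) hT
  calc ‖∑ k ∈ T, a k‖ₑ ^ q ≤ ((N : ℝ≥0∞) * ‖a m‖ₑ) ^ q := by
        gcongr
        refine (enorm_sum_le _ _).trans ((Finset.sum_le_card_nsmul T _ _ hmax).trans ?_)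
        rw [nsmul_eq_mul]
        gcongr
    _ = (N : ℝ≥0∞) ^ q * ‖a m‖ₑ ^ q := ENNReal.mul_rpow_of_nonneg _ _ hq.le
    _ ≤ _ := by
        gcongr
        exact Finset.single_le_sum (f := fun k => ‖a k‖ₑ ^ q) (fun _ _ => zero_le) hm

/-- Summing over windows of width `2h + 1` counts every index at most `2h + 1` times. -/
lemma tsum_window_le (a : ℕ → ℝ≥0∞) (μ h : ℕ) :
    ∑' j : ℕ, ∑ k ∈ Finset.Icc (μ + j - h) (μ + j + h), a k ≤
      ((2 * h + 1 : ℕ) : ℝ≥0∞) * ∑' i : ℕ, a (μ - h + i) := by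
  set b : ℕ → ℝ≥0∞ := fun k => if μ - h ≤ k then a k else 0 with hb
  have h1 : ∀ j, ∑ k ∈ Finset.Icc (μ + j - h) (μ + j + h), a k =
      ∑' k, if k ∈ Finset.Icc (μ + j - h) (μ + j + h) then b k else 0 := fun j => by
    rw [tsum_eq_sum (s := Finset.Icc (μ + j - h) (μ + j + h)) (fun k hk => if_neg hk)]
    refine Finset.sum_congr rfl fun k hk => ?_
    rw [if_pos hk, hb]
    rw [Finset.mem_Icc] at hk
    exact (if_pos (by omega)).symm
  have h2 : ∀ k, (∑' j, if k ∈ Finset.Icc (μ + j - h) (μ + j + h) then b k else 0) ≤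
      ((2 * h + 1 : ℕ) : ℝ≥0∞) * b k := fun k => by
    rw [tsum_eq_sum (s := Finset.Icc (k - h - μ) (k + h - μ))]
    · refine (Finset.sum_le_card_nsmul _ _ (b k) fun j _ => ?_).trans ?_
      · split_ifs <;> simp
      · rw [nsmul_eq_mul, Nat.card_Icc]
        gcongr
        omega
    · intro j hj
      refine if_neg fun hk => hj ?_
      rw [Finset.mem_Icc] at hk ⊢
      omega
  have h3 : ∑' i, a (μ - h + i) = ∑' k, b k := by
    rw [← Function.Injective.tsum_eq (add_right_injective (μ - h)) (f := b)]
    · exact tsum_congr fun i => (if_pos (Nat.le_add_right _ _)).symm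
    · intro k hk
      refine ⟨k - (μ - h), ?_⟩
      have : μ - h ≤ k := by
        by_contra hlt
        exact hk (if_neg hlt)
      simp only
      omega
  calc _ = ∑' k, ∑' j, if k ∈ Finset.Icc (μ + j - h) (μ + j + h) then b k else 0 := by
        rw [ENNReal.tsum_comm]
        exact tsum_congr h1
    _ ≤ ∑' k, ((2 * h + 1 : ℕ) : ℝ≥0∞) * b k := ENNReal.tsum_le_tsum h2
    _ = _ := by rw [ENNReal.tsum_mul_left, h3]

lemma two_rpow_le_of_near (s q : ℝ) (hq : 0 < q) {l k h : ℕ} (h1 : l ≤ k + h) (h2 : k ≤ l + h) :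
    (2:ℝ≥0∞) ^ (s * (l : ℝ) * q) ≤ (2:ℝ≥0∞) ^ (|s| * h * q) * (2:ℝ≥0∞) ^ (s * (k : ℝ) * q) := by
  rw [← ENNReal.rpow_add _ _ (by simp) (by simp)]
  refine ENNReal.rpow_le_rpow_of_exponent_le (by norm_num) ?_
  have h1' : (l : ℝ) ≤ k + h := by exact_mod_cast h1
  have h2' : (k : ℝ) ≤ l + h := by exact_mod_cast h2
  have h3 : s * ((l : ℝ) - k) ≤ |s| * h := by
    refine (le_abs_self _).trans ?_
    rw [abs_mul]
    gcongr
    rw [abs_le]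
    constructor <;> linarith
  nlinarith

lemma cubePiece_eq (d μ : ℕ) (n : Fin d → ℤ) (k₀ : ℕ) (s q : ℝ) (g : ℕ → RD d → ℂ) :
    cubePiece d μ n k₀ s q g = ((2:ℝ≥0∞) ^ ((μ : ℝ) * (d : ℝ)) *
      ∫⁻ x in dyadicCube d μ n, ∑' j : ℕ,
        (2:ℝ≥0∞) ^ (s * ((k₀ + j : ℕ) : ℝ) * q) * ‖g (k₀ + j) x‖ₑ ^ q) ^ (1 / q) := by
  simp only [cubePiece, Nat.cast_add, enorm_eq_nnnorm]

/-- The `ℓ^q`-sums of a family over all cubes of level `μ`, weighted by `latticeWeight`, are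
controlled by the supremum of the local quantities `cubePiece`. -/
lemma tsum_latticeWeight_le_iSup_cubePiece {d μ : ℕ} (n : Fin d → ℤ) (k₀ : ℕ) (s : ℝ) {q : ℝ}
    (hq : 0 < q) {F : ℕ → RD d → ℂ} (hF : ∀ k, Continuous (F k)) :
    (2:ℝ≥0∞) ^ ((μ : ℝ) * (d : ℝ)) * ∑' i : ℕ, (2:ℝ≥0∞) ^ (s * ((k₀ + i : ℕ) : ℝ) * q) *
        ∑' n', latticeWeight d (n - n') * ∫⁻ z in dyadicCube d μ n', ‖F (k₀ + i) z‖ₑ ^ q ≤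
      (∑' m, latticeWeight d m) * (⨆ n', cubePiece d μ n' k₀ s q F) ^ q := by
  have hm : ∀ k, Measurable fun z => ‖F k z‖ₑ ^ q :=
    fun k => (hF k).enorm.measurable.pow_const q
  have hcube : ∀ n', (2:ℝ≥0∞) ^ ((μ : ℝ) * (d : ℝ)) * ∫⁻ z in dyadicCube d μ n', ∑' i : ℕ,
      (2:ℝ≥0∞) ^ (s * ((k₀ + i : ℕ) : ℝ) * q) * ‖F (k₀ + i) z‖ₑ ^ q ≤
      (⨆ n', cubePiece d μ n' k₀ s q F) ^ q := fun n' => by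
    have h := le_iSup (fun n' => cubePiece d μ n' k₀ s q F) n'
    have h' := ENNReal.rpow_le_rpow h hq.le
    rwa [cubePiece_eq, ← ENNReal.rpow_mul, one_div_mul_cancel hq.ne', ENNReal.rpow_one] at h'
  calc _ = ∑' n', latticeWeight d (n - n') * ((2:ℝ≥0∞) ^ ((μ : ℝ) * (d : ℝ)) *
        ∫⁻ z in dyadicCube d μ n', ∑' i : ℕ,
          (2:ℝ≥0∞) ^ (s * ((k₀ + i : ℕ) : ℝ) * q) * ‖F (k₀ + i) z‖ₑ ^ q) := by
        simp only [← ENNReal.tsum_mul_left]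
        rw [ENNReal.tsum_comm]
        refine tsum_congr fun n' => ?_
        rw [lintegral_tsum fun i => ((hm _).const_mul _).aemeasurable, ← ENNReal.tsum_mul_left,
          ← ENNReal.tsum_mul_left]
        refine tsum_congr fun i => ?_
        rw [lintegral_const_mul _ (hm _)]
        ring
    _ ≤ ∑' n', latticeWeight d (n - n') * (⨆ n', cubePiece d μ n' k₀ s q F) ^ q := by
        gcongr with n'
        exact hcube n'
    _ = _ := by rw [ENNReal.tsum_mul_right, tsum_latticeWeight_sub]

/-- The dyadic annulus (a ball for `k = 0`) carrying the Fourier support of the `k`-th piece. -/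
def fourierAnnulus (d : ℕ) (A : ℝ) (k : ℕ) : Set (RD d) :=
  {ξ | (k ≠ 0 → (2:ℝ) ^ k / A ≤ ‖ξ‖) ∧ ‖ξ‖ ≤ A * 2 ^ k}

/-- `Π_l F_k = 0` when `|k - l| > h` and `4A ≤ 2^h`. -/
lemma LP_eq_zero_of_far {d : ℕ} (D : LPData d) {A : ℝ} (hA : 1 < A) {h : ℕ} (hh : 4 * A ≤ 2 ^ h)
    {l k : ℕ} (hl : 1 ≤ l) {F : RD d → ℂ} (hF : Function.HasTemperateGrowth F)
    (hK : HasFourierSupportIn F (fourierAnnulus d A k))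
    (hk : k ∉ Finset.Icc (l - h) (l + h)) (x : RD d) : LP D l F x = 0 := by
  have hA0 : 0 < A := by linarith
  refine LP_eq_zero D l hl hF hK (fun η hη hη' => ?_) x
  have hl0 : (0:ℝ) < 2 ^ l := by positivity
  have hk0 : (0:ℝ) < 2 ^ k := by positivity
  rw [Finset.mem_Icc, not_and_or, not_le, not_le] at hk
  rcases hk with hk | hk
  · have h1 : (2:ℝ) ^ (k + h) ≤ 2 ^ l := pow_le_pow_right₀ (by norm_num) (by omega)
    rw [pow_add] at h1
    have h2 : (2:ℝ) ^ k * (4 * A) ≤ 2 ^ k * 2 ^ h := by gcongr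
    nlinarith [hη.2, hη'.1]
  · have h1 : (2:ℝ) ^ (l + h) ≤ 2 ^ k := pow_le_pow_right₀ (by norm_num) (by omega)
    rw [pow_add] at h1
    have h2 : (2:ℝ) ^ l * (4 * A) ≤ 2 ^ l * 2 ^ h := by gcongr
    have h3 := (div_le_iff₀ hA0).1 (hη.1 (by omega))
    have h4 : ‖η‖ * A ≤ 2 * 2 ^ l * A := by
      gcongr
      exact hη'.2
    nlinarith [mul_pos hl0 hA0]

/-- Nikol'skii-type estimate for families with Fourier support in dyadic
annuli, with the supremum on the right over dyadic cubes of the same level `μ`. -/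
theorem statement7 (d : ℕ) (hd : 1 ≤ d) (q : ℝ) (hq : 0 < q) (s : ℝ) (A : ℝ) (hA : 1 < A)
    (D : LPData d) :
    ∃ (h : ℕ) (C : ℝ≥0), ∀ (μ : ℕ), 1 ≤ μ → ∀ (n : Fin d → ℤ) (F : ℕ → RD d → ℂ),
      (∀ k, Function.HasTemperateGrowth (F k)) →
      HasFourierSupportIn (F 0) {ξ : RD d | ‖ξ‖ ≤ A} →
      (∀ k : ℕ, HasFourierSupportIn (F (k+1))
        {ξ : RD d | (2:ℝ)^(k+1) / A ≤ ‖ξ‖ ∧ ‖ξ‖ ≤ A * (2:ℝ)^(k+1)}) →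
      (∀ ψ : 𝓢(RD d, ℂ), Summable (fun k : ℕ => ∫ x, F k x * ψ x)) →
      cubePiece d μ n μ s q (fun l x => ∑' k : ℕ, LP D l (F k) x) ≤
        (C : ℝ≥0∞) * ⨆ n' : Fin d → ℤ, cubePiece d μ n' (μ - h) s q F := by
  obtain ⟨h, hh⟩ := pow_unbounded_of_one_lt (4 * A) (by norm_num : (1:ℝ) < 2)
  have hA0 : 0 < A := by linarith
  obtain ⟨C₁, hC₁⟩ := exists_enorm_LP_rpow_le D hq (B := A * 2 ^ h) (by positivity)
  set N : ℕ := 2 * h + 1 with hN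
  set c : ℝ≥0∞ := (2:ℝ≥0∞) ^ (|s| * h * q) * (N : ℝ≥0∞) ^ q * C₁ with hc
  set c' : ℝ≥0∞ := c * (2 ^ (d + 1) * ∫⁻ y, decayWeight d y) with hc'
  set M : ℝ≥0∞ := c' * N * ∑' m, latticeWeight d m with hM
  have hctop : c ≠ ⊤ := ENNReal.mul_ne_top (ENNReal.mul_ne_top
    (ENNReal.rpow_ne_top_of_nonneg (by positivity) (by simp))
    (ENNReal.rpow_ne_top_of_nonneg hq.le (by simp))) ENNReal.coe_ne_top
  have hMtop : M ≠ ⊤ := ENNReal.mul_ne_top (ENNReal.mul_ne_top (ENNReal.mul_ne_top hctop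
    (ENNReal.mul_ne_top (by simp) (lintegral_decayWeight_ne_top d))) (by simp))
    (tsum_latticeWeight_ne_top d)
  refine ⟨h, (M ^ (1 / q)).toNNReal, fun μ hμ n F hF hF0 hF1 _ => ?_⟩
  have hann : ∀ k, HasFourierSupportIn (F k) (fourierAnnulus d A k) := by
    rintro (_ | k)
    · simpa [fourierAnnulus] using hF0
    · simpa [fourierAnnulus] using hF1 k
  have hFm : ∀ k, Measurable fun z => ‖F k z‖ₑ ^ q :=
    fun k => (hF k).1.continuous.enorm.measurable.pow_const q
  set Ψ : ℕ → ℕ → RD d → ℝ≥0∞ := fun l k x => ∫⁻ z, ‖F k z‖ₑ ^ q *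
    ((2:ℝ≥0∞) ^ (l * d) * decayWeight d ((2:ℝ) ^ l • (x - z)) ^ 2) with hΨ
  have hΨm : ∀ l k, Measurable (Ψ l k) := fun l k => by
    refine Measurable.lintegral_prod_right' (f := fun p : RD d × RD d => ‖F k p.2‖ₑ ^ q *
      ((2:ℝ≥0∞) ^ (l * d) * decayWeight d ((2:ℝ) ^ l • (p.1 - p.2)) ^ 2)) ?_
    exact ((hFm k).comp measurable_snd).mul (measurable_const.mul
      (((measurable_decayWeight d).comp (by fun_prop)).pow_const 2))
  have hpoint : ∀ (j : ℕ) (x : RD d), (2:ℝ≥0∞) ^ (s * ((μ + j : ℕ) : ℝ) * q) *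
      ‖∑' k, LP D (μ + j) (F k) x‖ₑ ^ q ≤
      ∑ k ∈ Finset.Icc (μ + j - h) (μ + j + h),
        c * (2:ℝ≥0∞) ^ (s * (k : ℝ) * q) * Ψ (μ + j) k x := fun j x => by
    have hl : 1 ≤ μ + j := by omega
    rw [tsum_eq_sum (s := Finset.Icc (μ + j - h) (μ + j + h)) (fun k hk =>
      LP_eq_zero_of_far D hA hh.le hl (hF k) (hann k) hk x)]
    have hcard : (Finset.Icc (μ + j - h) (μ + j + h)).card ≤ N := by
      rw [Nat.card_Icc]
      omega
    refine (mul_le_mul_right (enorm_sum_rpow_le _ _ hq hcard) _).trans ?_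
    rw [Finset.mul_sum, Finset.mul_sum]
    refine Finset.sum_le_sum fun k hk => ?_
    rw [Finset.mem_Icc] at hk
    have hk1 : μ + j ≤ k + h := by omega
    have hball : ∀ η ∈ fourierAnnulus d A k, ‖η‖ ≤ A * 2 ^ h * 2 ^ (μ + j) := fun η hη => by
      refine hη.2.trans ?_
      rw [mul_assoc, ← pow_add]
      gcongr
      · norm_num
      · omega
    calc _ ≤ ((2:ℝ≥0∞) ^ (|s| * h * q) * (2:ℝ≥0∞) ^ (s * (k : ℝ) * q)) *
          ((N : ℝ≥0∞) ^ q * (C₁ * Ψ (μ + j) k x)) := by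
          gcongr
          · exact two_rpow_le_of_near s q hq hk1 hk.2
          · exact hC₁ _ hl _ _ (hF k) (hann k) hball x
      _ = _ := by
          rw [hc]
          ring
  set E : ℕ → ℝ≥0∞ := fun k =>
    ∑' n', latticeWeight d (n - n') * ∫⁻ z in dyadicCube d μ n', ‖F k z‖ₑ ^ q with hE
  have hint : ∫⁻ x in dyadicCube d μ n, ∑' j : ℕ,
      (2:ℝ≥0∞) ^ (s * ((μ + j : ℕ) : ℝ) * q) * ‖∑' k, LP D (μ + j) (F k) x‖ₑ ^ q ≤
      c' * N * ∑' i : ℕ, (2:ℝ≥0∞) ^ (s * ((μ - h + i : ℕ) : ℝ) * q) * E (μ - h + i) := by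
    calc _ ≤ ∫⁻ x in dyadicCube d μ n, ∑' j : ℕ, ∑ k ∈ Finset.Icc (μ + j - h) (μ + j + h),
          c * (2:ℝ≥0∞) ^ (s * (k : ℝ) * q) * Ψ (μ + j) k x :=
          lintegral_mono fun x => ENNReal.tsum_le_tsum fun j => hpoint j x
      _ = ∑' j : ℕ, ∑ k ∈ Finset.Icc (μ + j - h) (μ + j + h),
          c * (2:ℝ≥0∞) ^ (s * (k : ℝ) * q) * ∫⁻ x in dyadicCube d μ n, Ψ (μ + j) k x := by
          rw [lintegral_tsum fun j => (Finset.measurable_fun_sum _ fun k _ =>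
            (hΨm _ k).const_mul _).aemeasurable]
          refine tsum_congr fun j => ?_
          rw [lintegral_finsetSum _ fun k _ => (hΨm _ k).const_mul _]
          exact Finset.sum_congr rfl fun k _ => lintegral_const_mul _ (hΨm _ k)
      _ ≤ ∑' j : ℕ, ∑ k ∈ Finset.Icc (μ + j - h) (μ + j + h),
          c' * ((2:ℝ≥0∞) ^ (s * (k : ℝ) * q) * E k) := by
          refine ENNReal.tsum_le_tsum fun j => Finset.sum_le_sum fun k _ => ?_
          refine (mul_le_mul_right (setLIntegral_mean_le (l := μ + j) (by omega) n (hFm k))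
            _).trans_eq ?_
          rw [hc', hE]
          ring
      _ ≤ _ := by
          refine (tsum_window_le _ μ h).trans_eq ?_
          rw [ENNReal.tsum_mul_left]
          ring
  rw [cubePiece_eq, ENNReal.coe_toNNReal
    (ENNReal.rpow_ne_top_of_nonneg (by positivity) hMtop)]
  calc _ ≤ (M * (⨆ n', cubePiece d μ n' (μ - h) s q F) ^ q) ^ (1 / q) := by
        refine ENNReal.rpow_le_rpow ?_ (by positivity)
        calc _ ≤ (2:ℝ≥0∞) ^ ((μ : ℝ) * (d : ℝ)) * (c' * N * ∑' i : ℕ,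
              (2:ℝ≥0∞) ^ (s * ((μ - h + i : ℕ) : ℝ) * q) * E (μ - h + i)) := by gcongr
          _ = c' * N * ((2:ℝ≥0∞) ^ ((μ : ℝ) * (d : ℝ)) * ∑' i : ℕ,
              (2:ℝ≥0∞) ^ (s * ((μ - h + i : ℕ) : ℝ) * q) * E (μ - h + i)) := by ring
          _ ≤ c' * N * ((∑' m, latticeWeight d m) *
              (⨆ n', cubePiece d μ n' (μ - h) s q F) ^ q) := by
              gcongr c' * N * ?_
              exact tsum_latticeWeight_le_iSup_cubePiece n (μ - h) s hq
                fun k => (hF k).1.continuous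
          _ = _ := by rw [hM, mul_assoc (c' * N)]
    _ = _ := by
        rw [ENNReal.mul_rpow_of_nonneg _ _ (by positivity), ← ENNReal.rpow_mul,
          mul_one_div_cancel hq.ne', ENNReal.rpow_one]

end
end
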